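/- There exists n₀ ∈ ℕ such that the following holds. Suppose H is a 3-uniform hypergraph on n ≥ n₀ vertices, d ∈ ℕ with d ≤ n/3, and δ₁(H) > C(n-1,2) − C(n-d,2) (where C(a,b) denotes the binomial coefficient). Then H contains a matching of size at least d. -/

import Mathlib

open Finset

set_option linter.unusedSectionVars false

/-- The number of edges of a bipartite graph between two copies of `Fin 3`. -/
def wt (r : Fin 3 → Fin 3 → Bool) : ℕ := #{p : Fin 3 × Fin 3 | r p.1 p.2}

/-- The bipartite graph `r` has no perfect matching. -/
def NoPM (r : Fin 3 → Fin 3 → Bool) : Prop :=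
  ∀ σ : Equiv.Perm (Fin 3), ¬ ∀ i, r i (σ i) = true

instance : DecidablePred NoPM := fun r => by unfold NoPM; infer_instance

/-- Two vertices on the left side are joined to the whole right side. -/
def IsSource (r : Fin 3 → Fin 3 → Bool) : Prop := ∃ i₀, ∀ i, i ≠ i₀ → ∀ j, r i j = true

instance : DecidablePred IsSource := fun r => by unfold IsSource; infer_instance

/-- The edges of `r` are exactly those meeting `i` on the left or `j` on the right. -/
def IsDoubleStar (r : Fin 3 → Fin 3 → Bool) (i j : Fin 3) : Prop :=
  ∀ i' j', r i' j' = (decide (i' = i) || decide (j' = j))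

instance (r i j) : Decidable (IsDoubleStar r i j) := by unfold IsDoubleStar; infer_instance

/-- `i₁` is joined to the whole right side and `i₂` to all of it but possibly `j₃`. -/
def IsNearSource (r : Fin 3 → Fin 3 → Bool) : Prop :=
  ∃ i₁ i₂ j₃, i₁ ≠ i₂ ∧ (∀ j, r i₁ j = true) ∧ ∀ j, j ≠ j₃ → r i₂ j = true

instance : DecidablePred IsNearSource := fun r => by unfold IsNearSource; infer_instance

lemma wt_swap (r : Fin 3 → Fin 3 → Bool) : wt (fun i j => r j i) = wt r := by
  unfold wt
  exact card_bij (fun p _ => p.swap) (by simp) (fun a _ b _ h => by simpa using h)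
    (fun b hb => ⟨b.swap, by simpa using hb, by simp⟩)

/-- The entries of `r` as a table. -/
def table (a b c d e f g h i : Bool) : Fin 3 → Fin 3 → Bool :=
  ![![a, b, c], ![d, e, f], ![g, h, i]]

lemma forall_of_forall_table {P : (Fin 3 → Fin 3 → Bool) → Prop}
    (h : ∀ a b c d e f g h i, P (table a b c d e f g h i)) (r : Fin 3 → Fin 3 → Bool) : P r := by
  convert h (r 0 0) (r 0 1) (r 0 2) (r 1 0) (r 1 1) (r 1 2) (r 2 0) (r 2 1) (r 2 2)
  ext i j
  fin_cases i <;> fin_cases j <;> rfl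

lemma wt_eq (r : Fin 3 → Fin 3 → Bool) : wt r = (r 0 0).toNat + (r 0 1).toNat + (r 0 2).toNat +
    ((r 1 0).toNat + (r 1 1).toNat + (r 1 2).toNat) +
    ((r 2 0).toNat + (r 2 1).toNat + (r 2 2).toNat) := by
  simp only [wt, card_filter, Fintype.sum_prod_type, Fin.sum_univ_three, Bool.toNat, Bool.cond_eq_ite]

lemma NoPM.of_ne {r : Fin 3 → Fin 3 → Bool} (h : NoPM r) {i j k : Fin 3} (hij : i ≠ j)
    (hik : i ≠ k) (hjk : j ≠ k) : (r 0 i && r 1 j && r 2 k) = false := by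
  have hinj : Function.Injective ![i, j, k] := by
    intro a b hab
    fin_cases a <;> fin_cases b <;> simp_all [eq_comm]
  have := h (Equiv.ofBijective _ (Finite.injective_iff_bijective.1 hinj))
  by_contra hc
  refine this fun l => ?_
  simp only [Bool.not_eq_false, Bool.and_eq_true] at hc
  fin_cases l <;> simp [hc]

lemma NoPM.permanent {r : Fin 3 → Fin 3 → Bool} (h : NoPM r) :
    (r 0 0 && r 1 1 && r 2 2 || r 0 0 && r 1 2 && r 2 1 || r 0 1 && r 1 0 && r 2 2 ||
      r 0 1 && r 1 2 && r 2 0 || r 0 2 && r 1 0 && r 2 1 || r 0 2 && r 1 1 && r 2 0) = false := by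
  simp only [Bool.or_eq_false_iff]
  refine ⟨⟨⟨⟨⟨?_, ?_⟩, ?_⟩, ?_⟩, ?_⟩, ?_⟩ <;> exact h.of_ne (by decide) (by decide) (by decide)

lemma wt_le_six (r) (h : NoPM r) : wt r ≤ 6 := by
  rw [wt_eq]
  replace h := h.permanent
  revert r
  refine forall_of_forall_table ?_
  decide +kernel

lemma source_of_wt_eq_six (r) (h : NoPM r) :
    wt r = 6 → IsSource r ∨ IsSource (fun i j => r j i) := by
  rw [wt_eq]
  replace h := h.permanent
  revert r
  refine forall_of_forall_table ?_
  decide +kernel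

lemma wt_eq_five_cases (r) (h : NoPM r) : wt r = 5 →
    (∃ i j, IsDoubleStar r i j) ∨ IsNearSource r ∨ IsNearSource (fun i j => r j i) := by
  rw [wt_eq]
  replace h := h.permanent
  revert r
  refine forall_of_forall_table ?_
  decide +kernel

lemma toNat_add_toNat_le {a b : Bool} (h : a = true → b = true → False) :
    a.toNat + b.toNat ≤ 1 := by
  cases a <;> cases b <;> simp_all

lemma wt_le_three (r : Fin 3 → Fin 3 → Bool)
    (h : ∀ i j i' j', i ≠ i' → j ≠ j' → r i j = true → r i' j' = true → False) : wt r ≤ 3 := by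
  have key : ∀ i j i' j', i ≠ i' → j ≠ j' → (r i j).toNat + (r i' j').toNat ≤ 1 :=
    fun i j i' j' hi hj => toNat_add_toNat_le (h i j i' j' hi hj)
  rw [wt_eq]
  have := key 0 0 1 1 (by decide) (by decide)
  have := key 0 0 2 2 (by decide) (by decide)
  have := key 1 1 2 2 (by decide) (by decide)
  have := key 0 1 1 2 (by decide) (by decide)
  have := key 0 1 2 0 (by decide) (by decide)
  have := key 1 2 2 0 (by decide) (by decide)
  have := key 0 2 1 0 (by decide) (by decide)
  have := key 0 2 2 1 (by decide) (by decide)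
  have := key 1 0 2 1 (by decide) (by decide)
  omega

lemma eq_false_of_cross {r : Fin 3 → Fin 3 → Bool} {i₀ j₀ : Fin 3}
    (h : ∀ i j, r i j = true → i ≠ i₀ ∧ j ≠ j₀) :
    (∀ j, (r i₀ j).toNat = 0) ∧ ∀ i, (r i j₀).toNat = 0 := by
  refine ⟨fun j => ?_, fun i => ?_⟩
  · cases hr : r i₀ j
    exacts [rfl, absurd rfl (h _ _ hr).1]
  · cases hr : r i j₀
    exacts [rfl, absurd rfl (h _ _ hr).2]

lemma wt_le_four (r : Fin 3 → Fin 3 → Bool) (i₀ j₀ : Fin 3)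
    (h : ∀ i j, r i j = true → i ≠ i₀ ∧ j ≠ j₀) : wt r ≤ 4 := by
  obtain ⟨h1, h2⟩ := eq_false_of_cross h
  have hle : ∀ i j, (r i j).toNat ≤ 1 := fun _ _ => Bool.toNat_le _
  rw [wt_eq]
  have := h1 0
  have := h1 1
  have := h1 2
  have := h2 0
  have := h2 1
  have := h2 2
  have := hle 0 0
  have := hle 0 1
  have := hle 0 2
  have := hle 1 0
  have := hle 1 1
  have := hle 1 2
  have := hle 2 0
  have := hle 2 1
  have := hle 2 2
  fin_cases i₀ <;> fin_cases j₀ <;> simp only [Fin.zero_eta, Fin.mk_one, Fin.reduceFinMk] at * <;>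
    omega

lemma wt_le_two (r : Fin 3 → Fin 3 → Bool) (i₀ j₀ : Fin 3)
    (h : ∀ i j, r i j = true → i ≠ i₀ ∧ j ≠ j₀)
    (h' : ∀ i j i' j', i ≠ i' → j ≠ j' → r i j = true → r i' j' = true → False) : wt r ≤ 2 := by
  obtain ⟨h1, h2⟩ := eq_false_of_cross h
  have key : ∀ i j i' j', i ≠ i' → j ≠ j' → (r i j).toNat + (r i' j').toNat ≤ 1 :=
    fun i j i' j' hi hj => toNat_add_toNat_le (h' i j i' j' hi hj)
  rw [wt_eq]
  have := h1 0
  have := h1 1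
  have := h1 2
  have := h2 0
  have := h2 1
  have := h2 2
  have := key 0 0 1 1 (by decide) (by decide)
  have := key 0 0 2 2 (by decide) (by decide)
  have := key 1 1 2 2 (by decide) (by decide)
  have := key 0 1 1 2 (by decide) (by decide)
  have := key 0 1 2 0 (by decide) (by decide)
  have := key 1 2 2 0 (by decide) (by decide)
  have := key 0 2 1 0 (by decide) (by decide)
  have := key 0 2 2 1 (by decide) (by decide)
  have := key 1 0 2 1 (by decide) (by decide)
  have := key 0 0 1 2 (by decide) (by decide)
  have := key 0 0 2 1 (by decide) (by decide)
  have := key 0 1 1 0 (by decide) (by decide)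
  have := key 0 1 2 2 (by decide) (by decide)
  have := key 0 2 1 1 (by decide) (by decide)
  have := key 0 2 2 0 (by decide) (by decide)
  have := key 1 0 2 2 (by decide) (by decide)
  have := key 1 1 2 0 (by decide) (by decide)
  have := key 1 2 2 1 (by decide) (by decide)
  fin_cases i₀ <;> fin_cases j₀ <;> simp only [Fin.zero_eta, Fin.mk_one, Fin.reduceFinMk] at * <;>
    omega

set_option synthInstance.maxHeartbeats 400000 in
set_option synthInstance.maxSize 1000 in
lemma eq_missing_of_wt_eq_five (r : Fin 3 → Fin 3 → Bool) : ∀ i₃ : Fin 3,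
    (∀ j, r i₃ j = false) → wt r = 5 →
    ∃ i₀ j₀, ∀ i, i ≠ i₃ → ∀ j, r i j = true ∨ (i = i₀ ∧ j = j₀) := by
  rw [wt_eq]
  revert r
  refine forall_of_forall_table ?_
  decide +kernel

lemma wt_ne_five (r : Fin 3 → Fin 3 → Bool) (i₃ j₃ : Fin 3)
    (h : ∀ i j i' j', i ≠ i' → j ≠ j' → r i j = true → r i' j' = true →
      i ≠ i₃ ∧ i' ≠ i₃ ∧ j ≠ j₃ ∧ j' ≠ j₃) : wt r ≠ 5 := by
  have key : ∀ i j i' j', i ≠ i' → j ≠ j' → i = i₃ ∨ i' = i₃ ∨ j = j₃ ∨ j' = j₃ →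
      (r i j).toNat + (r i' j').toNat ≤ 1 := by
    refine fun i j i' j' hi hj hc => toNat_add_toNat_le fun h₁ h₂ => ?_
    have := h i j i' j' hi hj h₁ h₂
    tauto
  have hle : ∀ i j, (r i j).toNat ≤ 1 := fun _ _ => Bool.toNat_le _
  rw [wt_eq]
  have := hle 0 0
  have := hle 0 1
  have := hle 0 2
  have := hle 1 0
  have := hle 1 1
  have := hle 1 2
  have := hle 2 0
  have := hle 2 1
  have := hle 2 2
  have := key 0 0 1 1 (by decide) (by decide)
  have := key 0 0 2 2 (by decide) (by decide)
  have := key 1 1 2 2 (by decide) (by decide)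
  have := key 0 1 1 2 (by decide) (by decide)
  have := key 0 1 2 0 (by decide) (by decide)
  have := key 1 2 2 0 (by decide) (by decide)
  have := key 0 2 1 0 (by decide) (by decide)
  have := key 0 2 2 1 (by decide) (by decide)
  have := key 1 0 2 1 (by decide) (by decide)
  have := key 0 0 1 2 (by decide) (by decide)
  have := key 0 0 2 1 (by decide) (by decide)
  have := key 0 1 1 0 (by decide) (by decide)
  have := key 0 1 2 2 (by decide) (by decide)
  have := key 0 2 1 1 (by decide) (by decide)
  have := key 0 2 2 0 (by decide) (by decide)
  have := key 1 0 2 2 (by decide) (by decide)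
  have := key 1 1 2 0 (by decide) (by decide)
  have := key 1 2 2 1 (by decide) (by decide)
  clear h key hle
  fin_cases i₃ <;> fin_cases j₃ <;>
    simp only [Fin.zero_eta, Fin.mk_one, Fin.reduceFinMk, Fin.isValue, Fin.reduceEq, zero_ne_one,
      one_ne_zero, or_true, or_false, forall_const, IsEmpty.forall_iff] at * <;>
    omega

lemma doubleStar_of_wt_eq_five (r : Fin 3 → Fin 3 → Bool) (i j : Fin 3)
    (h : ∀ i' j', i' ≠ i → j' ≠ j → r i' j' = false) (h5 : wt r = 5) : IsDoubleStar r i j := by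
  have zero : ∀ i' j', i' ≠ i → j' ≠ j → (r i' j').toNat = 0 :=
    fun i' j' hi hj => by simp [h i' j' hi hj]
  have hle : ∀ i j, (r i j).toNat ≤ 1 := fun _ _ => Bool.toNat_le _
  have one : ∀ i' j', i' = i ∨ j' = j → (r i' j').toNat = 1 := by
    rw [wt_eq] at h5
    have := hle 0 0
    have := hle 0 1
    have := hle 0 2
    have := hle 1 0
    have := hle 1 1
    have := hle 1 2
    have := hle 2 0
    have := hle 2 1
    have := hle 2 2
    have := zero 0 0
    have := zero 0 1
    have := zero 0 2
    have := zero 1 0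
    have := zero 1 1
    have := zero 1 2
    have := zero 2 0
    have := zero 2 1
    have := zero 2 2
    clear h zero hle
    intro i' j'
    fin_cases i <;> fin_cases j <;>
      simp only [Fin.zero_eta, Fin.mk_one, Fin.reduceFinMk, Fin.isValue, Fin.reduceEq, ne_eq,
        not_true_eq_false, not_false_eq_true, zero_ne_one, one_ne_zero, forall_const,
        IsEmpty.forall_iff] at * <;>
      fin_cases i' <;> fin_cases j' <;>
      simp only [Fin.zero_eta, Fin.mk_one, Fin.reduceFinMk, Fin.isValue, Fin.reduceEq, or_true,
        true_or, or_self, zero_ne_one, one_ne_zero, forall_const, IsEmpty.forall_iff] <;>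
      omega
  intro i' j'
  by_cases hc : i' = i ∨ j' = j
  · have := one i' j' hc
    rw [Bool.toNat_eq_one] at this
    rw [this, eq_comm, Bool.or_eq_true, decide_eq_true_iff, decide_eq_true_iff]
    exact hc
  · push Not at hc
    rw [h i' j' hc.1 hc.2]
    simp [hc]

lemma doubleStar_unique : ∀ (r : Fin 3 → Fin 3 → Bool) (i j i' j' : Fin 3),
    IsDoubleStar r i j → IsDoubleStar r i' j' → i = i' ∧ j = j' := by
  intro r i j i' j' h h'
  have : ∀ a b, ((decide (a = i) || decide (b = j)) = (decide (a = i') || decide (b = j'))) :=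
    fun a b => (h a b).symm.trans (h' a b)
  clear h h'
  revert i j i' j'
  decide +kernel

lemma exists_third : ∀ a b : Fin 3, ∃ c, c ≠ a ∧ c ≠ b := by decide

lemma exists_third' : ∀ a : Fin 3, ∃ b c, b ≠ a ∧ c ≠ a ∧ b ≠ c := by decide

/-- A family of bipartite graphs between copies of `Fin 3` indexed by `ι`, such that there are
no three disjoint edges on two copies and no four disjoint edges on three copies. -/
structure IsTight {ι : Type*} (g : ι → ι → Fin 3 → Fin 3 → Bool) : Prop where
  symm : ∀ E F i j, g E F i j = g F E j i
  two : ∀ E F, E ≠ F → NoPM (g E F)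
  three : ∀ E F K, E ≠ F → E ≠ K → F ≠ K → ∀ i₀ i₁ i₂ j₀ j₁ j₂ k₀ k₁,
    i₀ ≠ i₁ → i₀ ≠ i₂ → i₁ ≠ i₂ → j₀ ≠ j₁ → j₀ ≠ j₂ → j₁ ≠ j₂ → k₀ ≠ k₁ →
    g E F i₀ j₀ = true → g E F i₁ j₁ = true → g E K i₂ k₀ = true → g F K j₂ k₁ = true → False

namespace IsTight

variable {ι : Type*} {g : ι → ι → Fin 3 → Fin 3 → Bool}

lemma wt_comm (hg : IsTight g) (E F : ι) : wt (g E F) = wt (g F E) := by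
  rw [← wt_swap]; congr 1; funext i j; exact hg.symm _ _ _ _

lemma cosource (hg : IsTight g) {E F K : ι} (hEF : E ≠ F) (hEK : E ≠ K) (hFK : F ≠ K)
    (h₁ : IsSource (g E F)) (h₂ : IsSource (g K F)) :
    ∃ i₀ k₀, ∀ i k, g E K i k = true → i ≠ i₀ ∧ k ≠ k₀ := by
  obtain ⟨i₀, hi⟩ := h₁
  obtain ⟨k₀, hk⟩ := h₂
  refine ⟨i₀, k₀, fun i k h => ⟨?_, ?_⟩⟩
  · rintro rfl
    obtain ⟨k', hk', hkk'⟩ := exists_third k₀ k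
    obtain ⟨a, b, ha, hb, hab⟩ := exists_third' i
    exact hg.three E F K hEF hEK hFK a b i 0 1 2 k k' hab ha hb (by decide) (by decide)
      (by decide) hkk'.symm (hi a ha 0) (hi b hb 1) h (by rw [hg.symm]; exact hk k' hk' 2)
  · rintro rfl
    obtain ⟨i', hi', hii'⟩ := exists_third i₀ i
    obtain ⟨a, b, ha, hb, hab⟩ := exists_third' k
    exact hg.three K F E hFK.symm hEK.symm hEF.symm a b k 0 1 2 i i' hab ha hb (by decide)
      (by decide) (by decide) hii'.symm (hk a ha 0) (hk b hb 1) (by rw [hg.symm]; exact h)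
      (by rw [hg.symm]; exact hi i' hi' 2)

lemma cosink (hg : IsTight g) {E F K : ι} (hEF : E ≠ F) (hEK : E ≠ K) (hFK : F ≠ K)
    (h₁ : IsSource (g E F)) (h₂ : IsSource (g E K)) :
    ∀ i j i' j', i ≠ i' → j ≠ j' → g F K i j = true → g F K i' j' = true → False := by
  obtain ⟨a, ha⟩ := h₁
  obtain ⟨b, hb⟩ := h₂
  intro i j i' j' hi hj h h'
  obtain ⟨i'', h₁, h₂⟩ := exists_third i i'
  obtain ⟨j'', h₃, h₄⟩ := exists_third j j'
  obtain ⟨c, d, hc, hd, hcd⟩ : ∃ c d : Fin 3, c ≠ a ∧ d ≠ b ∧ c ≠ d := by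
    clear ha hb; revert a b; decide
  exact hg.three F K E hFK hEF.symm hEK.symm i i' i'' j j' j'' c d hi h₁.symm h₂.symm hj h₃.symm
    h₄.symm hcd h h' (by rw [hg.symm]; exact ha c hc _) (by rw [hg.symm]; exact hb d hd _)

lemma not_nearSource (hg : IsTight g) {E F K : ι} (hEF : E ≠ F) (hEK : E ≠ K) (hFK : F ≠ K)
    (h₂ : wt (g E K) = 5) (h₃ : wt (g F K) = 5) :
    ¬ IsNearSource (g E F) := by
  rintro ⟨i₁, i₂, j₃, hi, hf, hs⟩
  obtain ⟨i₃, hi₁, hi₂⟩ := exists_third i₁ i₂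
  have hm : ∀ j, ∃ j₀ j₁, j₀ ≠ j₁ ∧ j₀ ≠ j ∧ j₁ ≠ j ∧ j₁ ≠ j₃ := by
    clear hf hs; revert j₃; decide
  have key : ∀ k₀, g E K i₃ k₀ = false := by
    intro k₀
    by_contra hk
    have hk : g E K i₃ k₀ = true := by simpa using hk
    have : ∀ j k, g F K j k = true → k = k₀ := by
      intro j k h
      by_contra hne
      obtain ⟨j₀, j₁, h01, h0, h1, h13⟩ := hm j
      exact hg.three E F K hEF hEK hFK i₁ i₂ i₃ j₀ j₁ j k₀ k hi hi₁.symm hi₂.symm h01 h0 h1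
        (Ne.symm hne) (hf _) (hs _ h13) hk h
    have := wt_le_three (g F K) fun i j i' j' _ hj h h' => hj ((this _ _ h).trans (this _ _ h').symm)
    omega
  obtain ⟨i₀, k₀, hmiss⟩ := eq_missing_of_wt_eq_five _ _ key h₂
  have step : ∀ j j' j'' k k' k'' a b, j ≠ j' → j'' ≠ j → j'' ≠ j' → k ≠ k' → k'' ≠ k → k'' ≠ k' →
      a ≠ b → g F K j k = true → g F K j' k' = true → g E F a j'' = true → g E K b k'' = true →
      False := by
    intro j j' j'' k k' k'' a b h1 h2 h3 h4 h5 h6 h7 e1 e2 e3 e4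
    exact hg.three F K E hFK hEF.symm hEK.symm j j' j'' k k' k'' a b h1 h2.symm h3.symm h4 h5.symm
      h6.symm h7 e1 e2 (by rw [hg.symm]; exact e3) (by rw [hg.symm]; exact e4)
  refine wt_ne_five (g F K) j₃ k₀ (fun j k j' k' hj hk e1 e2 => ?_) h₃
  obtain ⟨j'', a1, a2⟩ := exists_third j j'
  obtain ⟨k'', b1, b2⟩ := exists_third k k'
  have A := step j j' j'' k k' k'' i₁ i₂ hj a1 a2 hk b1 b2 hi e1 e2 (hf _)
  have B := fun h => step j j' j'' k k' k'' i₂ i₁ hj a1 a2 hk b1 b2 hi.symm e1 e2 (hs j'' h)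
  obtain ⟨h0, rfl⟩ : i₂ = i₀ ∧ k'' = k₀ := by
    rcases hmiss i₂ hi₂.symm k'' with h | h
    · exact (A h).elim
    · exact h
  have hj'' : j'' = j₃ := by
    by_contra h
    rcases hmiss i₁ hi₁.symm k'' with h' | h'
    · exact B h h'
    · exact hi (h'.1.trans h0.symm)
  subst hj''
  exact ⟨a1.symm, a2.symm, b1.symm, b2.symm⟩

lemma doubleStar_center (hg : IsTight g) {E F K : ι} (hEF : E ≠ F) (hEK : E ≠ K) (hFK : F ≠ K)
    (h : wt (g F K) = 5) {i i' j k : Fin 3} (h₁ : IsDoubleStar (g E F) i j)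
    (h₂ : IsDoubleStar (g E K) i' k) : i = i' := by
  by_contra hne
  have hfk : ∀ j' k', j' ≠ j → k' ≠ k → g F K j' k' = false := by
    intro j' k' hj hk
    by_contra hc
    obtain ⟨i'', a1, a2⟩ := exists_third i i'
    obtain ⟨j'', b1, b2⟩ := exists_third j j'
    obtain ⟨k'', c1, c2⟩ := exists_third k k'
    exact hg.three E F K hEF hEK hFK i i'' i' j'' j j' k'' k' a1.symm hne a2 b1 b2 hj.symm c2
      (by rw [h₁]; simp) (by rw [h₁]; simp) (by rw [h₂]; simp) (by simpa using hc)
  have h₃ := doubleStar_of_wt_eq_five _ _ _ hfk h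
  obtain ⟨j₁, j₂, x1, x2, x3⟩ := exists_third' j
  obtain ⟨k₁, k₂, y1, y2, y3⟩ := exists_third' k
  exact hg.three F K E hFK hEF.symm hEK.symm j j₁ j₂ k₁ k k₂ i i' x1.symm x2.symm x3 y1 y3 y2.symm
    hne (by rw [h₃]; simp) (by rw [h₃]; simp) (by rw [hg.symm, h₁]; simp)
    (by rw [hg.symm, h₂]; simp)

lemma doubleStar_swap (hg : IsTight g) {E F : ι} {i j : Fin 3} (h : IsDoubleStar (g E F) i j) :
    IsDoubleStar (g F E) j i := by
  intro a b
  rw [hg.symm, h, Bool.or_comm]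

lemma exists_doubleStar (hg : IsTight g) {E F K : ι} (hEF : E ≠ F) (hEK : E ≠ K) (hFK : F ≠ K)
    (h₁ : wt (g E F) = 5) (h₂ : wt (g E K) = 5) (h₃ : wt (g F K) = 5) :
    ∃ i j, IsDoubleStar (g E F) i j := by
  have e : (fun i j => g E F j i) = g F E := by funext i j; exact hg.symm _ _ _ _
  rcases wt_eq_five_cases _ (hg.two _ _ hEF) h₁ with h | h | h
  · exact h
  · exact (hg.not_nearSource hEF hEK hFK h₂ h₃ h).elim
  · rw [e] at h
    exact (hg.not_nearSource hEF.symm hFK hEK h₃ h₂ h).elim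

lemma doubleStar_triple (hg : IsTight g) {E F K : ι} (hEF : E ≠ F) (hEK : E ≠ K) (hFK : F ≠ K)
    (h₁ : wt (g E F) = 5) (h₂ : wt (g E K) = 5) (h₃ : wt (g F K) = 5) :
    ∃ i j k, IsDoubleStar (g E F) i j ∧ IsDoubleStar (g E K) i k ∧ IsDoubleStar (g F K) j k := by
  have h₁' := hg.wt_comm E F ▸ h₁
  have h₂' := hg.wt_comm E K ▸ h₂
  have h₃' := hg.wt_comm F K ▸ h₃
  obtain ⟨i, j, hij⟩ := hg.exists_doubleStar hEF hEK hFK h₁ h₂ h₃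
  obtain ⟨i', k, hik⟩ := hg.exists_doubleStar hEK hEF hFK.symm h₂ h₁ h₃'
  obtain ⟨j', k', hjk⟩ := hg.exists_doubleStar hFK hEF.symm hEK.symm h₃ h₁' h₂'
  obtain rfl := hg.doubleStar_center hEF hEK hFK h₃ hij hik
  obtain rfl := hg.doubleStar_center hEF.symm hFK hEK h₂ (hg.doubleStar_swap hij) hjk
  obtain rfl := hg.doubleStar_center hEK.symm hFK.symm hEF h₁ (hg.doubleStar_swap hik)
    (hg.doubleStar_swap hjk)
  exact ⟨i, j, k, hij, hik, hjk⟩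

end IsTight

/-- If the arcs of a digraph force, at each end, at least as many related vertices as the other
end has neighbours, then there are few arcs. -/
lemma arcs_le {ι : Type*} [Fintype ι] (arc : ι → ι → Prop) [DecidableRel arc] (s t : ι → ℝ)
    (hs0 : ∀ E, 0 ≤ s E) (ht0 : ∀ E, 0 ≤ t E)
    (hs : ∀ E F, arc E F → (#{K | arc K F} : ℝ) ≤ s E)
    (ht : ∀ E F, arc E F → (#{K | arc E K} : ℝ) ≤ t F) :
    5 / 2 * (∑ E, ∑ F, if arc E F then (1 : ℝ) else 0) ≤ ∑ E, s E + 2 * ∑ F, t F := by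
  set dp : ι → ℝ := fun E => (#{K | arc E K} : ℝ) with hdp
  set dm : ι → ℝ := fun F => (#{K | arc K F} : ℝ) with hdm
  have h1 : ∀ E, (∑ F, if arc E F then dm F / dp E else 0) ≤ s E := by
    intro E
    rw [← sum_filter]
    calc _ ≤ ∑ F with arc E F, s E / dp E := by
          refine sum_le_sum fun F hF => ?_
          have := hs E F (by simpa using hF)
          exact div_le_div_of_nonneg_right this (by positivity)
      _ = dp E * (s E / dp E) := by rw [sum_const, nsmul_eq_mul]
      _ = s E * (dp E / dp E) := by ring
      _ ≤ s E := mul_le_of_le_one_right (hs0 E) (div_self_le_one _)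
  have h2 : ∀ F, (∑ E, if arc E F then dp E / dm F else 0) ≤ t F := by
    intro F
    rw [← sum_filter]
    calc _ ≤ ∑ E with arc E F, t F / dm F := by
          refine sum_le_sum fun E hE => ?_
          have := ht E F (by simpa using hE)
          exact div_le_div_of_nonneg_right this (by positivity)
      _ = dm F * (t F / dm F) := by rw [sum_const, nsmul_eq_mul]
      _ = t F * (dm F / dm F) := by ring
      _ ≤ t F := mul_le_of_le_one_right (ht0 F) (div_self_le_one _)
  have h3 := sum_le_sum fun E (_ : E ∈ univ) => h1 E
  have h4 := sum_le_sum fun F (_ : F ∈ univ) => h2 F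
  rw [sum_comm] at h4
  have h5 : 5 / 2 * (∑ E, ∑ F, if arc E F then (1 : ℝ) else 0) ≤
      (∑ E, ∑ F, if arc E F then dm F / dp E else 0) +
        2 * ∑ E, ∑ F, if arc E F then dp E / dm F else 0 := by
    rw [mul_sum, mul_sum, ← sum_add_distrib]
    refine sum_le_sum fun E _ => ?_
    rw [mul_sum, mul_sum, ← sum_add_distrib]
    refine sum_le_sum fun F _ => ?_
    split_ifs with h
    · have p1 : 0 < dp E := by
        simp only [hdp, Nat.cast_pos, card_pos]; exact ⟨F, by simpa using h⟩
      have p2 : 0 < dm F := by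
        simp only [hdm, Nat.cast_pos, card_pos]; exact ⟨E, by simpa using h⟩
      have : dm F / dp E + 2 * (dp E / dm F) = (dm F ^ 2 + 2 * dp E ^ 2) / (dp E * dm F) := by
        field_simp
      rw [this, mul_one, le_div_iff₀ (by positivity)]
      nlinarith [sq_nonneg (dm F - 5 / 4 * dp E), sq_nonneg (dp E)]
    · simp
  linarith

namespace IsTight

variable {ι : Type*} {g : ι → ι → Fin 3 → Fin 3 → Bool}

/-- In the pair `E, F`, all edges at the distinguished vertices `c E` and `c F` are present. -/
def CenteredAt (g : ι → ι → Fin 3 → Fin 3 → Bool) (c : ι → Fin 3) (E F : ι) : Prop :=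
  (∀ j, g E F (c E) j = true) ∧ ∀ i, g E F i (c F) = true

open Classical in
lemma card_wt_ne_five_le [Fintype ι] (hg : IsTight g) {S : ℝ}
    (hS : ∑ p ∈ (univ : Finset ι).offDiag, (5 - wt (g p.1 p.2) : ℝ) ≤ S) :
    (#{p ∈ (univ : Finset ι).offDiag | wt (g p.1 p.2) ≠ 5} : ℝ) ≤ 9 * S + 24 * Fintype.card ι := by
  set m := Fintype.card ι
  set arc : ι → ι → Prop := fun E F => E ≠ F ∧ IsSource (g E F) with harc
  set cs : ι → ι → Prop := fun E K => E ≠ K ∧ ∃ F, arc E F ∧ arc K F with hcs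
  set ck : ι → ι → Prop := fun F K => F ≠ K ∧ ∃ E, arc E F ∧ arc E K with hck
  let a : ι × ι → ℝ := fun p => if arc p.1 p.2 then 1 else 0
  let a' : ι × ι → ℝ := fun p => if arc p.2 p.1 then 1 else 0
  let s : ι × ι → ℝ := fun p => if cs p.1 p.2 then 1 else 0
  let k : ι × ι → ℝ := fun p => if ck p.1 p.2 then 1 else 0
  have off : ∀ f : ι × ι → ℝ, (∀ x, f (x, x) = 0) →
      ∑ p ∈ (univ : Finset ι).offDiag, f p = ∑ x, ∑ y, f (x, y) := by
    intro f hf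
    rw [← sum_product', univ_product_univ]
    refine sum_subset (subset_univ _) fun p _ hp => ?_
    obtain ⟨x, y⟩ := p
    have : x = y := by simpa using hp
    subst this; exact hf x
  have key : ∀ p ∈ (univ : Finset ι).offDiag,
      s p + 2 * k p ≤ (5 - wt (g p.1 p.2) : ℝ) + a p + a' p := by
    rintro ⟨E, F⟩ hp
    have hEF : E ≠ F := by simpa using hp
    have e : (fun i j => g E F j i) = g F E := by funext i j; exact hg.symm _ _ _ _
    have w6 := wt_le_six _ (hg.two _ _ hEF)
    have A : 0 ≤ a (E, F) ∧ 0 ≤ a' (E, F) := by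
      constructor <;> simp only [a, a'] <;> split_ifs <;> norm_num
    have B : cs E F → wt (g E F) ≤ 4 := by
      rintro ⟨-, K, h1, h2⟩
      obtain ⟨i, j, h⟩ := hg.cosource h1.1 hEF h2.1.symm h1.2 h2.2
      exact wt_le_four _ i j h
    have C : ck E F → wt (g E F) ≤ 3 := by
      rintro ⟨-, K, h1, h2⟩
      exact wt_le_three _ (hg.cosink h1.1 h2.1 hEF h1.2 h2.2)
    have D : cs E F → ck E F → wt (g E F) ≤ 2 := by
      rintro ⟨-, K, h1, h2⟩ ⟨-, K', h3, h4⟩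
      obtain ⟨i, j, h⟩ := hg.cosource h1.1 hEF h2.1.symm h1.2 h2.2
      exact wt_le_two _ i j h (hg.cosink h3.1 h4.1 hEF h3.2 h4.2)
    by_cases h1 : cs E F <;> by_cases h2 : ck E F
    · have : (wt (g E F) : ℝ) ≤ 2 := by exact_mod_cast D h1 h2
      simp only [s, k, h1, h2, if_true]; linarith
    · have : (wt (g E F) : ℝ) ≤ 4 := by exact_mod_cast B h1
      simp only [s, k, h1, h2, if_true, if_false]; linarith
    · have : (wt (g E F) : ℝ) ≤ 3 := by exact_mod_cast C h2
      simp only [s, k, h1, h2, if_true, if_false]; linarith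
    · simp only [s, k, h1, h2, if_false]
      rcases w6.lt_or_eq with h | h
      · have : (wt (g E F) : ℝ) ≤ 5 := by exact_mod_cast Nat.le_of_lt_succ h
        linarith
      · rcases source_of_wt_eq_six _ (hg.two _ _ hEF) h with h' | h'
        · have : a (E, F) = 1 := if_pos ⟨hEF, h'⟩
          rw [this, h]; push_cast; linarith
        · rw [e] at h'
          have : a' (E, F) = 1 := if_pos ⟨hEF.symm, h'⟩
          rw [this, h]; push_cast; linarith
  have key2 : ∀ p ∈ (univ : Finset ι).offDiag,
      (if wt (g p.1 p.2) ≠ 5 then (1 : ℝ) else 0) ≤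
        (5 - wt (g p.1 p.2) : ℝ) + 2 * a p + 2 * a' p := by
    rintro ⟨E, F⟩ hp
    have hEF : E ≠ F := by simpa using hp
    have e : (fun i j => g E F j i) = g F E := by funext i j; exact hg.symm _ _ _ _
    have w6 := wt_le_six _ (hg.two _ _ hEF)
    have A : 0 ≤ a (E, F) ∧ 0 ≤ a' (E, F) := by
      constructor <;> simp only [a, a'] <;> split_ifs <;> norm_num
    rcases lt_trichotomy (wt (g E F)) 5 with h | h | h
    · have : (wt (g E F) : ℝ) ≤ 4 := by exact_mod_cast Nat.le_of_lt_succ h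
      simp only [h.ne, ne_eq, not_false_eq_true, if_true]; linarith
    · simp only [h, ne_eq, not_true_eq_false, if_false]; push_cast; linarith
    · have h : wt (g E F) = 6 := by omega
      simp only [h]
      rcases source_of_wt_eq_six _ (hg.two _ _ hEF) h with h' | h'
      · have : a (E, F) = 1 := if_pos ⟨hEF, h'⟩
        rw [this]; norm_num; linarith
      · rw [e] at h'
        have : a' (E, F) = 1 := if_pos ⟨hEF.symm, h'⟩
        rw [this]; norm_num; linarith
  have sum1 := sum_le_sum key
  have sum2 := sum_le_sum key2
  simp only [sum_add_distrib, ← mul_sum] at sum1 sum2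
  rw [← sum_filter, sum_const, nsmul_eq_mul, mul_one] at sum2
  have ea : ∑ p ∈ (univ : Finset ι).offDiag, a p = ∑ E, ∑ F, a (E, F) :=
    off _ fun x => by simp [a, harc]
  have ea' : ∑ p ∈ (univ : Finset ι).offDiag, a' p = ∑ E, ∑ F, a (E, F) := by
    rw [off _ fun x => by simp [a', harc], sum_comm]
  have es : ∑ p ∈ (univ : Finset ι).offDiag, s p = ∑ E, ∑ F, s (E, F) :=
    off _ fun x => by simp [s, hcs]
  have ek : ∑ p ∈ (univ : Finset ι).offDiag, k p = ∑ E, ∑ F, k (E, F) :=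
    off _ fun x => by simp [k, hck]
  have main := arcs_le arc (fun E => ∑ F, s (E, F) + 1) (fun E => ∑ F, k (E, F) + 1)
    (fun E => by
      have : 0 ≤ ∑ F, s (E, F) := sum_nonneg fun F _ => by simp only [s]; split_ifs <;> norm_num
      linarith)
    (fun E => by
      have : 0 ≤ ∑ F, k (E, F) := sum_nonneg fun F _ => by simp only [k]; split_ifs <;> norm_num
      linarith)
    (fun E F h => by
      simp only [s]
      rw [← sum_filter, sum_const, nsmul_eq_mul, mul_one]
      have : ({K | arc K F} : Finset ι) ⊆ insert E ({K | cs E K} : Finset ι) := by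
        intro K hK
        by_cases hKE : K = E
        · simp [hKE]
        · have hK : arc K F := by simpa using hK
          simp only [mem_insert, mem_filter, mem_univ, true_and]
          exact Or.inr ⟨Ne.symm hKE, F, h, hK⟩
      exact_mod_cast (card_le_card this).trans (card_insert_le _ _))
    (fun E F h => by
      simp only [k]
      rw [← sum_filter, sum_const, nsmul_eq_mul, mul_one]
      have : ({K | arc E K} : Finset ι) ⊆ insert F ({K | ck F K} : Finset ι) := by
        intro K hK
        by_cases hKE : K = F
        · simp [hKE]
        · have hK : arc E K := by simpa using hK
          simp only [mem_insert, mem_filter, mem_univ, true_and]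
          exact Or.inr ⟨Ne.symm hKE, E, h, hK⟩
      exact_mod_cast (card_le_card this).trans (card_insert_le _ _))
  simp only [sum_add_distrib, sum_const, nsmul_eq_mul, mul_one, card_univ] at main
  rw [ea, ea', es, ek] at sum1
  rw [ea, ea'] at sum2
  have : ∑ E, ∑ F, a (E, F) = ∑ E, ∑ F, if arc E F then (1 : ℝ) else 0 := rfl
  rw [← this] at main
  change _ ≤ _ + (m : ℝ) + 2 * (_ + (m : ℝ)) at main
  linarith

open Classical in
lemma exists_center [Fintype ι] (hg : IsTight g) {S : ℝ}
    (hS : ∑ p ∈ (univ : Finset ι).offDiag, (5 - wt (g p.1 p.2) : ℝ) ≤ S) :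
    ∃ c : ι → Fin 3, (#{p ∈ (univ : Finset ι).offDiag | ¬ CenteredAt g c p.1 p.2} : ℝ) ≤
      27 * S + 74 * Fintype.card ι := by
  have h5 := hg.card_wt_ne_five_le hS
  set m := Fintype.card ι with hm
  set N := ({p ∈ (univ : Finset ι).offDiag | wt (g p.1 p.2) ≠ 5} : Finset (ι × ι)) with hN
  rcases isEmpty_or_nonempty ι with hι | hι
  · refine ⟨fun _ => 0, ?_⟩
    have h0 : #N = 0 := by simp [hN]
    have : m = 0 := Fintype.card_eq_zero
    simp only [univ_eq_empty, offDiag_empty, filter_empty, card_empty]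
    rw [h0] at h5
    rw [this] at h5 ⊢
    push_cast at h5 ⊢; linarith
  let b : ι → Finset ι := fun E => {F | E ≠ F ∧ wt (g E F) ≠ 5}
  have hb : #N = ∑ E, #(b E) := by
    rw [hN, ← card_sigma]
    refine card_bij (fun p _ => ⟨p.1, p.2⟩) ?_ ?_ ?_
    · rintro ⟨E, F⟩ h; simpa [b] using h
    · rintro ⟨E, F⟩ _ ⟨E', F'⟩ _ h; simpa using h
    · rintro ⟨E, F⟩ h; exact ⟨(E, F), by simpa [b] using h, rfl⟩
  obtain ⟨E₀, -, hE₀⟩ := exists_min_image univ (fun E => #(b E)) univ_nonempty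
  have hmin : m * #(b E₀) ≤ #N := by
    rw [hb]
    have := card_nsmul_le_sum univ (fun E => #(b E)) _ (fun E _ => hE₀ E (mem_univ _))
    simpa [card_univ] using this
  let Q : Finset ι := insert E₀ (b E₀)
  have hQ : #Q ≤ #(b E₀) + 1 := card_insert_le _ _
  have hQ' : ∀ F, F ∉ Q → E₀ ≠ F ∧ wt (g E₀ F) = 5 := by
    intro F hF
    simp only [Q, b, mem_insert, mem_filter, mem_univ, true_and, not_or, not_and, not_not] at hF
    exact ⟨Ne.symm hF.1, hF.2 (Ne.symm hF.1)⟩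
  let c : ι → Fin 3 := fun F => if h : ∃ j i, IsDoubleStar (g E₀ F) i j then h.choose else 0
  have hc : ∀ F i j, IsDoubleStar (g E₀ F) i j → c F = j := by
    intro F i j h
    have hex : ∃ j i, IsDoubleStar (g E₀ F) i j := ⟨j, i, h⟩
    simp only [c, hex, dif_pos]
    obtain ⟨i', h'⟩ := hex.choose_spec
    exact (doubleStar_unique _ _ _ _ _ h' h).2
  refine ⟨c, ?_⟩
  have hsub : ({p ∈ (univ : Finset ι).offDiag | ¬ CenteredAt g c p.1 p.2} : Finset (ι × ι)) ⊆
      N ∪ (Q ×ˢ univ ∪ univ ×ˢ Q) := by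
    rintro ⟨F, K⟩ hp
    by_contra hcon
    simp only [mem_filter, mem_offDiag, mem_univ, true_and] at hp
    obtain ⟨hFK, hp⟩ := hp
    simp only [hN, mem_union, mem_filter, mem_offDiag, mem_univ, true_and, mem_product, and_true,
      not_or, not_and, not_not] at hcon
    obtain ⟨h1, h2, h3⟩ := hcon
    obtain ⟨n1, w1⟩ := hQ' F h2
    obtain ⟨n2, w2⟩ := hQ' K h3
    obtain ⟨i, j, k, d1, d2, d3⟩ := hg.doubleStar_triple n1 n2 hFK w1 w2 (h1 hFK)
    have e1 := hc _ _ _ d1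
    have e2 := hc _ _ _ d2
    apply hp
    constructor
    · intro x; rw [d3]; simp [e1]
    · intro x; rw [d3]; simp [e2]
  have hcard := (card_le_card hsub).trans ((card_union_le _ _).trans
    (Nat.add_le_add_left (card_union_le _ _) _))
  rw [card_product, card_product, card_univ, ← hm] at hcard
  have h6 : m * #Q ≤ #N + m := by
    calc m * #Q ≤ m * (#(b E₀) + 1) := Nat.mul_le_mul_left _ hQ
      _ = m * #(b E₀) + m := by ring
      _ ≤ _ := by omega
  have h7 : #{p ∈ (univ : Finset ι).offDiag | ¬ CenteredAt g c p.1 p.2} ≤ 3 * #N + 2 * m := by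
    rw [mul_comm (#Q)] at hcard; omega
  have h8 : (#{p ∈ (univ : Finset ι).offDiag | ¬ CenteredAt g c p.1 p.2} : ℝ) ≤
      3 * #N + 2 * m := by exact_mod_cast h7
  linarith

end IsTight

section Matchings

variable {V : Type*} [DecidableEq V]

/-- The hypergraph `H` has a matching of size `k` all of whose edges lie in `X`. -/
def HasMatchingIn (H : Finset (Finset V)) (X : Finset V) (k : ℕ) : Prop :=
  ∃ M ⊆ H, (M : Set (Finset V)).PairwiseDisjoint id ∧ (∀ e ∈ M, e ⊆ X) ∧ #M = k

namespace HasMatchingIn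

variable {H : Finset (Finset V)} {X Y : Finset V} {k l : ℕ}

lemma mono (h : HasMatchingIn H X k) (hXY : X ⊆ Y) : HasMatchingIn H Y k := by
  obtain ⟨M, h1, h2, h3, h4⟩ := h
  exact ⟨M, h1, h2, fun e he => (h3 e he).trans hXY, h4⟩

lemma mono_left {H' : Finset (Finset V)} (h : HasMatchingIn H X k) (hH : H ⊆ H') :
    HasMatchingIn H' X k := by
  obtain ⟨M, h1, h2, h3, h4⟩ := h
  exact ⟨M, h1.trans hH, h2, h3, h4⟩

lemma of_le (h : HasMatchingIn H X k) (hl : l ≤ k) : HasMatchingIn H X l := by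
  obtain ⟨M, h1, h2, h3, h4⟩ := h
  obtain ⟨M', h5, h6⟩ := exists_subset_card_eq (hl.trans h4.ge)
  exact ⟨M', h5.trans h1, h2.subset (by exact_mod_cast h5), fun e he => h3 e (h5 he), h6⟩

lemma zero : HasMatchingIn H X 0 := ⟨∅, by simp, by simp, by simp, rfl⟩

lemma one {e : Finset V} (he : e ∈ H) (heX : e ⊆ X) : HasMatchingIn H X 1 :=
  ⟨{e}, by simpa using he, by simp, by simpa using heX, by simp⟩

lemma union (hH : ∀ e ∈ H, #e = 3) (h : HasMatchingIn H X k) (h' : HasMatchingIn H Y l)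
    (hXY : Disjoint X Y) : HasMatchingIn H (X ∪ Y) (k + l) := by
  obtain ⟨M, h1, h2, h3, h4⟩ := h
  obtain ⟨N, k1, k2, k3, k4⟩ := h'
  have hMN : ∀ e ∈ M, ∀ f ∈ N, Disjoint e f := fun e he f hf =>
    hXY.mono (h3 e he) (k3 f hf)
  refine ⟨M ∪ N, union_subset h1 k1, ?_, ?_, ?_⟩
  · rw [coe_union, Set.pairwiseDisjoint_union]
    exact ⟨h2, k2, fun e he f hf _ => hMN e he f hf⟩
  · intro e he
    rcases mem_union.1 he with he | he
    · exact (h3 e he).trans subset_union_left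
    · exact (k3 e he).trans subset_union_right
  · rw [card_union_of_disjoint, h4, k4]
    rw [disjoint_left]
    intro e he he'
    have h0 := hMN e he e he'
    rw [disjoint_self] at h0
    have := hH e (h1 he)
    rw [h0] at this
    simp at this

/-- If no small set of vertices meets all the edges inside `X`, a matching can be chosen
greedily. -/
lemma greedy (hH : ∀ e ∈ H, #e = 3)
    (h : ∀ U : Finset V, #U + 3 ≤ 3 * k → ∃ e ∈ H, e ⊆ X ∧ Disjoint e U) :
    HasMatchingIn H X k := by
  induction k with
  | zero => exact zero
  | succ k ih =>
    obtain ⟨M, h1, h2, h3, h4⟩ := ih fun U hU => h U (by omega)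
    have hc : #(M.biUnion id) = 3 * k := by
      rw [card_biUnion h2, sum_congr rfl fun e he => show #(id e) = 3 from hH e (h1 he), sum_const,
        h4, smul_eq_mul, mul_comm]
    obtain ⟨e, he, heX, hd⟩ := h (M.biUnion id) (by omega)
    have hM : HasMatchingIn H (M.biUnion id) k :=
      ⟨M, h1, h2, fun e he => subset_biUnion_of_mem id he, h4⟩
    exact (hM.union hH (one he subset_rfl) hd.symm).mono
      (union_subset (biUnion_subset.2 h3) heX)

end HasMatchingIn

lemma triple_rotate (a b c : V) : ({a, b, c} : Finset V) = {b, c, a} := by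
  ext; simp; tauto

lemma triple_swap (a b c : V) : ({a, b, c} : Finset V) = {a, c, b} := by
  ext; simp; tauto

lemma ne_of_card_triple {a b c : V} (h : #({a, b, c} : Finset V) = 3) :
    a ≠ b ∧ a ≠ c ∧ b ≠ c := by
  refine ⟨?_, ?_, ?_⟩
  · rintro rfl; rw [insert_idem] at h; have := card_le_two (a := a) (b := c); omega
  · rintro rfl; rw [pair_comm, insert_idem] at h; have := card_le_two (a := a) (b := b); omega
  · rintro rfl; simp at h; have := card_le_two (a := a) (b := b); omega

end Matchings

/-- A matching in `H` avoiding `W`, given by an enumeration of its vertices, which is a largest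
one among the matchings avoiding `W`. The vertices outside `W` that it does not cover form `L`. -/
structure IsMaxSystem {V ι : Type*} [Fintype V] [DecidableEq V] [Fintype ι] [DecidableEq ι]
    (H : Finset (Finset V)) (W L : Finset V) (vert : ι → Fin 3 → V) : Prop where
  uniform : ∀ e ∈ H, #e = 3
  inj : ∀ E F i j, vert E i = vert F j → E = F ∧ i = j
  edge : ∀ E, univ.image (vert E) ∈ H
  mem_left : ∀ v, v ∈ L ↔ v ∉ W ∧ ∀ E i, vert E i ≠ v
  notMem : ∀ E i, vert E i ∉ W
  max : ¬ HasMatchingIn H Wᶜ (Fintype.card ι + 1)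

/-- The pair `u v` extends to an edge by at least four vertices of `L`. -/
def IsRich {V : Type*} [DecidableEq V] (H : Finset (Finset V)) (L : Finset V) (u v : V) : Prop :=
  4 ≤ #{x ∈ L | ({x, u, v} : Finset V) ∈ H}

instance {V : Type*} [DecidableEq V] (H : Finset (Finset V)) (L : Finset V) (u v : V) :
    Decidable (IsRich H L u v) := by unfold IsRich; infer_instance

lemma isRich_comm {V : Type*} [DecidableEq V] {H : Finset (Finset V)} {L : Finset V} {u v : V} :
    IsRich H L u v ↔ IsRich H L v u := by
  simp only [IsRich, triple_swap _ u v]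

namespace IsMaxSystem

variable {V ι : Type*} [Fintype V] [DecidableEq V] [Fintype ι] [DecidableEq ι]
  {H : Finset (Finset V)} {W L : Finset V} {vert : ι → Fin 3 → V}

lemma vert_eq (h : IsMaxSystem H W L vert) {E F : ι} {i j : Fin 3} :
    vert E i = vert F j ↔ E = F ∧ i = j :=
  ⟨h.inj E F i j, fun ⟨a, b⟩ => by rw [a, b]⟩

lemma vert_notMem (h : IsMaxSystem H W L vert) (E : ι) (i : Fin 3) : vert E i ∉ L :=
  fun hc => ((h.mem_left _).1 hc).2 E i rfl

/-- The set of vertices of the matching edges indexed by `S`. -/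
def cover (vert : ι → Fin 3 → V) (S : Finset ι) : Finset V :=
  S.biUnion fun E => univ.image (vert E)

lemma mem_cover {S : Finset ι} {v : V} : v ∈ cover vert S ↔ ∃ E ∈ S, ∃ i, vert E i = v := by
  simp [cover]

lemma vert_mem_cover {S : Finset ι} {E : ι} (hE : E ∈ S) (i : Fin 3) :
    vert E i ∈ cover vert S := mem_cover.2 ⟨E, hE, i, rfl⟩

lemma hasMatchingIn_cover (h : IsMaxSystem H W L vert) (S : Finset ι) :
    HasMatchingIn H (cover vert S) #S := by
  induction S using Finset.induction_on with
  | empty => exact HasMatchingIn.zero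
  | insert E S hE ih =>
    have h1 : HasMatchingIn H (cover vert {E}) 1 :=
      HasMatchingIn.one (h.edge E) (by simp [cover])
    rw [card_insert_of_notMem hE]
    refine (ih.union h.uniform h1 ?_).mono ?_
    · rw [disjoint_left]
      intro v hv hv'
      obtain ⟨F, hF, i, rfl⟩ := mem_cover.1 hv
      obtain ⟨F', hF', j, hj⟩ := mem_cover.1 hv'
      obtain ⟨rfl, -⟩ := h.vert_eq.1 hj
      rw [mem_singleton] at hF'
      exact hE (hF' ▸ hF)
    · intro v hv
      simp only [mem_union, mem_cover, mem_singleton, mem_insert] at hv ⊢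
      rcases hv with ⟨F, hF, i, rfl⟩ | ⟨F, hF, i, rfl⟩
      · exact ⟨F, Or.inr hF, i, rfl⟩
      · exact ⟨F, Or.inl hF, i, rfl⟩

lemma not_augment (h : IsMaxSystem H W L vert) (S : Finset ι) :
    ¬ HasMatchingIn H (cover vert S ∪ L) (#S + 1) := by
  intro hS
  have h1 := h.hasMatchingIn_cover Sᶜ
  have hd : Disjoint (cover vert S ∪ L) (cover vert Sᶜ) := by
    rw [disjoint_left]
    intro v hv hv'
    obtain ⟨F', hF', j, rfl⟩ := mem_cover.1 hv'
    rcases mem_union.1 hv with hv | hv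
    · obtain ⟨F, hF, i, hi⟩ := mem_cover.1 hv
      obtain ⟨rfl, -⟩ := h.vert_eq.1 hi
      exact (mem_compl.1 hF') hF
    · exact h.vert_notMem _ _ hv
  have h2 := hS.union h.uniform h1 hd
  have h3 : #S + 1 + #Sᶜ = Fintype.card ι + 1 := by rw [← card_add_card_compl S]; ring
  rw [h3] at h2
  refine h.max (h2.mono ?_)
  intro v hv
  rw [mem_compl]
  simp only [mem_union, mem_cover] at hv
  rcases hv with (⟨F, _, i, rfl⟩ | hv) | ⟨F, _, i, rfl⟩
  · exact h.notMem _ _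
  · exact ((h.mem_left _).1 hv).1
  · exact h.notMem _ _

/-- There is a matching of size `k` inside `X` and at most `c` vertices of `L`. -/
def Extends (H : Finset (Finset V)) (L X : Finset V) (k c : ℕ) : Prop :=
  ∃ U ⊆ L, #U ≤ c ∧ HasMatchingIn H (X ∪ U) k

lemma extends_pair (h : IsMaxSystem H W L vert) {X : Finset V} {k c : ℕ}
    (hX : Extends H L X k c) (hc : c ≤ 3) {u v : V} (huv : IsRich H L u v)
    (hu : u ∉ X) (hv : v ∉ X) (hu' : u ∉ L) (hv' : v ∉ L) (hXL : Disjoint X L) :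
    Extends H L (insert u (insert v X)) (k + 1) (c + 1) := by
  obtain ⟨U, hU, hUc, hM⟩ := hX
  obtain ⟨x, hx, hxU⟩ : ∃ x ∈ ({x ∈ L | ({x, u, v} : Finset V) ∈ H} : Finset V), x ∉ U :=
    exists_mem_notMem_of_card_lt_card (lt_of_lt_of_le (by omega) huv)
  rw [mem_filter] at hx
  have h1 : HasMatchingIn H {x, u, v} 1 := HasMatchingIn.one hx.2 subset_rfl
  refine ⟨insert x U, insert_subset hx.1 hU, (card_insert_le _ _).trans (by omega), ?_⟩
  refine (hM.union h.uniform h1 ?_).mono ?_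
  · rw [disjoint_right]
    intro y hy
    simp only [mem_insert, mem_singleton] at hy
    rw [mem_union, not_or]
    rcases hy with rfl | rfl | rfl
    · exact ⟨fun hc => disjoint_left.1 hXL hc hx.1, hxU⟩
    · exact ⟨hu, fun hc => hu' (hU hc)⟩
    · exact ⟨hv, fun hc => hv' (hU hc)⟩
  · intro y; simp only [mem_union, mem_insert, mem_singleton]; tauto

lemma extends_vert (h : IsMaxSystem H W L vert) {X : Finset V} {k c : ℕ} {S : Finset ι}
    (hX : Extends H L X k c ∧ X ⊆ cover vert S) (hc : c ≤ 3) {E F : ι} {i j : Fin 3}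
    (hE : E ∈ S) (hF : F ∈ S)
    (huv : IsRich H L (vert E i) (vert F j)) (hu : vert E i ∉ X) (hv : vert F j ∉ X) :
    Extends H L (insert (vert E i) (insert (vert F j) X)) (k + 1) (c + 1) ∧
      insert (vert E i) (insert (vert F j) X) ⊆ cover vert S := by
  refine ⟨h.extends_pair hX.1 hc huv hu hv (h.vert_notMem _ _) (h.vert_notMem _ _) ?_, ?_⟩
  · rw [disjoint_left]
    intro v hv
    obtain ⟨E, _, i, rfl⟩ := mem_cover.1 (hX.2 hv)
    exact h.vert_notMem _ _
  · exact insert_subset (vert_mem_cover hE _) (insert_subset (vert_mem_cover hF _) hX.2)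

lemma not_extends (h : IsMaxSystem H W L vert) {X : Finset V} {k c : ℕ} {S : Finset ι}
    (hX : Extends H L X k c ∧ X ⊆ cover vert S) (hk : k = #S + 1) : False := by
  obtain ⟨⟨U, hU, -, hM⟩, hXS⟩ := hX
  subst hk
  exact h.not_augment S (hM.mono (union_subset_union hXS hU))

lemma extends_empty (S : Finset ι) : Extends H L ∅ 0 0 ∧ ∅ ⊆ cover vert S :=
  ⟨⟨∅, by simp, by simp, HasMatchingIn.zero⟩, by simp⟩

/-- The bipartite graphs of rich pairs between the edges of the matching. -/
def richGraph (H : Finset (Finset V)) (L : Finset V) (vert : ι → Fin 3 → V)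
    (E F : ι) (i j : Fin 3) : Bool := decide (IsRich H L (vert E i) (vert F j))

lemma isTight (h : IsMaxSystem H W L vert) : IsTight (richGraph H L vert) where
  symm E F i j := by
    simp only [richGraph, isRich_comm]
  two E F hEF σ hσ := by
    simp only [richGraph, decide_eq_true_eq] at hσ
    have hS : #({E, F} : Finset ι) = 2 := card_pair hEF
    have hσ' : ∀ a b, σ a = σ b ↔ a = b := fun a b => σ.injective.eq_iff
    have p0 := extends_empty (H := H) (L := L) (vert := vert) {E, F}
    have p1 := h.extends_vert p0 (by omega) (by simp) (by simp) (hσ 0) (by simp) (by simp)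
    have p2 := h.extends_vert p1 (by omega) (by simp) (by simp) (hσ 1)
      (by simp [h.vert_eq, hEF]) (by simp [h.vert_eq, hEF.symm])
    have p3 := h.extends_vert p2 (by omega) (by simp) (by simp) (hσ 2)
      (by simp [h.vert_eq, hEF]) (by simp [h.vert_eq, hEF.symm])
    exact h.not_extends p3 (by omega)
  three E F K hEF hEK hFK i₀ i₁ i₂ j₀ j₁ j₂ k₀ k₁ a1 a2 a3 b1 b2 b3 c1 e1 e2 e3 e4 := by
    simp only [richGraph, decide_eq_true_eq] at e1 e2 e3 e4
    have hS : #({E, F, K} : Finset ι) = 3 := card_eq_three.2 ⟨E, F, K, hEF, hEK, hFK, rfl⟩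
    have p0 := extends_empty (H := H) (L := L) (vert := vert) {E, F, K}
    have p1 := h.extends_vert p0 (by omega) (by simp) (by simp) e1 (by simp) (by simp)
    have p2 := h.extends_vert p1 (by omega) (by simp) (by simp) e2
      (by simp [h.vert_eq, *, Ne.symm]) (by simp [h.vert_eq, *, Ne.symm])
    have p3 := h.extends_vert p2 (by omega) (by simp) (by simp) e3
      (by simp [h.vert_eq, *, Ne.symm]) (by simp [h.vert_eq, *, Ne.symm])
    have p4 := h.extends_vert p3 (by omega) (by simp) (by simp) e4
      (by simp [h.vert_eq, *, Ne.symm]) (by simp [h.vert_eq, *, Ne.symm])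
    exact h.not_extends p4 (by omega)

/-- No edge avoids the centers of three pairwise centered edges of the matching. -/
lemma notMem_of_centeredAt (h : IsMaxSystem H W L vert) {c : ι → Fin 3} {E F K : ι} (hEF : E ≠ F)
    (hEK : E ≠ K) (hFK : F ≠ K) (h₁ : IsTight.CenteredAt (richGraph H L vert) c E F)
    (h₂ : IsTight.CenteredAt (richGraph H L vert) c F K)
    (h₃ : IsTight.CenteredAt (richGraph H L vert) c K E) {i j k : Fin 3} (hi : i ≠ c E)
    (hj : j ≠ c F) (hk : k ≠ c K) : ({vert E i, vert F j, vert K k} : Finset V) ∉ H := by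
  intro hH
  have hS : #({E, F, K} : Finset ι) = 3 := card_eq_three.2 ⟨E, F, K, hEF, hEK, hFK, rfl⟩
  obtain ⟨i', hi1, hi2⟩ := exists_third (c E) i
  obtain ⟨j', hj1, hj2⟩ := exists_third (c F) j
  obtain ⟨k', hk1, hk2⟩ := exists_third (c K) k
  have e1 : IsRich H L (vert E (c E)) (vert F j') := by simpa [richGraph] using h₁.1 j'
  have e2 : IsRich H L (vert F (c F)) (vert K k') := by simpa [richGraph] using h₂.1 k'
  have e3 : IsRich H L (vert K (c K)) (vert E i') := by simpa [richGraph] using h₃.1 i'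
  have p0 : Extends H L {vert E i, vert F j, vert K k} 1 0 ∧
      {vert E i, vert F j, vert K k} ⊆ cover vert {E, F, K} := by
    refine ⟨⟨∅, by simp, by simp, HasMatchingIn.one hH (by simp)⟩, ?_⟩
    refine insert_subset (vert_mem_cover (by simp) _) (insert_subset (vert_mem_cover (by simp) _)
      (singleton_subset_iff.2 (vert_mem_cover (by simp) _)))
  have hi := hi.symm
  have hj := hj.symm
  have hk := hk.symm
  have p1 := h.extends_vert p0 (by omega) (by simp) (by simp) e1
      (by simp [h.vert_eq, *]) (by simp [h.vert_eq, *, hEF.symm])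
  have p2 := h.extends_vert p1 (by omega) (by simp) (by simp) e2
      (by simp [h.vert_eq, *, hEF.symm, hj1.symm]) (by simp [h.vert_eq, *, Ne.symm])
  have p3 := h.extends_vert p2 (by omega) (by simp) (by simp) e3
      (by simp [h.vert_eq, *, hEK.symm, hFK.symm, hk1.symm]) (by simp [h.vert_eq, *, Ne.symm])
  exact h.not_extends p3 (by omega)

end IsMaxSystem

/-- The indicator of `{x, y, z}` being an edge. -/
def ind {V : Type*} [DecidableEq V] (H : Finset (Finset V)) (x y z : V) : ℝ :=
  if ({x, y, z} : Finset V) ∈ H then 1 else 0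

section Indicator

variable {V : Type*} [DecidableEq V] {H : Finset (Finset V)}

lemma ind_nonneg (x y z : V) : 0 ≤ ind H x y z := by unfold ind; split_ifs <;> norm_num

lemma ind_le_one (x y z : V) : ind H x y z ≤ 1 := by unfold ind; split_ifs <;> norm_num

lemma ind_swap (x y z : V) : ind H x y z = ind H x z y := by unfold ind; rw [triple_swap]

lemma ind_rotate (x y z : V) : ind H x y z = ind H y z x := by unfold ind; rw [triple_rotate]

lemma sum_le_card_mul {α : Type*} {s : Finset α} {f : α → ℝ} {c : ℝ} (h : ∀ x ∈ s, f x ≤ c) :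
    ∑ x ∈ s, f x ≤ #s * c := by
  simpa using sum_le_card_nsmul s f c h

end Indicator

namespace IsMaxSystem

variable {V ι : Type*} [Fintype V] [DecidableEq V] [Fintype ι] [DecidableEq ι]
  {H : Finset (Finset V)} {W L : Finset V} {vert : ι → Fin 3 → V}

lemma sum_split (h : IsMaxSystem H W L vert) (F : V → ℝ) :
    ∑ u, F u = ∑ u ∈ W, F u + ∑ u ∈ L, F u + ∑ E, ∑ i, F (vert E i) := by
  have h1 : Disjoint W L := disjoint_left.2 fun v hv hv' => ((h.mem_left v).1 hv').1 hv
  have h2 : Disjoint (W ∪ L) (cover vert univ) := by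
    rw [disjoint_right]
    intro v hv
    obtain ⟨E, -, i, rfl⟩ := mem_cover.1 hv
    rw [mem_union, not_or]
    exact ⟨h.notMem _ _, h.vert_notMem _ _⟩
  have h3 : (univ : Finset V) = (W ∪ L) ∪ cover vert univ := by
    ext v
    simp only [mem_univ, mem_union, h.mem_left, mem_cover, true_and, true_iff]
    by_cases hv : ∃ E i, vert E i = v
    · exact Or.inr hv
    · push Not at hv
      tauto
  rw [h3, sum_union h2, sum_union h1]
  congr 1
  unfold cover
  rw [sum_biUnion]
  · refine sum_congr rfl fun E _ => ?_
    rw [sum_image]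
    intro i _ j _ hij
    exact (h.inj _ _ _ _ hij).2
  · intro E _ F _ hEF
    simp only [Function.onFun]
    rw [disjoint_left]
    intro v hv hv'
    obtain ⟨i, -, rfl⟩ := mem_image.1 hv
    obtain ⟨j, -, hj⟩ := mem_image.1 hv'
    exact hEF (h.inj _ _ _ _ hj).1.symm

lemma card_split (h : IsMaxSystem H W L vert) :
    (Fintype.card V : ℝ) = #W + #L + 3 * Fintype.card ι := by
  have := h.sum_split fun _ => 1
  simpa [mul_comm] using this

lemma ind_left (h : IsMaxSystem H W L vert) {x y z : V} (hx : x ∈ L) (hy : y ∈ L) (hz : z ∈ L) :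
    ind H x y z = 0 := by
  unfold ind
  rw [if_neg]
  intro hH
  refine h.not_augment ∅ (HasMatchingIn.one hH ?_)
  simp only [insert_subset_iff, singleton_subset_iff, mem_union]
  exact ⟨Or.inr hx, Or.inr hy, Or.inr hz⟩

lemma leftLink_le (h : IsMaxSystem H W L vert) {E : ι} {i j : Fin 3} (hij : i ≠ j)
    (hi : (4 * #L : ℝ) < ∑ x ∈ L, ∑ y ∈ L, ind H (vert E i) x y) :
    ∑ x ∈ L, ∑ y ∈ L, ind H (vert E j) x y ≤ 4 * #L := by
  by_contra! hj
  obtain ⟨x, hx, y, hy, hxy⟩ : ∃ x ∈ L, ∃ y ∈ L, ({vert E i, x, y} : Finset V) ∈ H := by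
    by_contra! hc
    have : ∑ x ∈ L, ∑ y ∈ L, ind H (vert E i) x y = 0 :=
      sum_eq_zero fun x hx => sum_eq_zero fun y hy => by rw [ind, if_neg (hc x hx y hy)]
    have : (0 : ℝ) ≤ #L := by positivity
    linarith
  obtain ⟨x', hx', y', hy', hxy', hd⟩ : ∃ x' ∈ L, ∃ y' ∈ L, ({vert E j, x', y'} : Finset V) ∈ H ∧
      ¬ (x' = x ∨ x' = y ∨ y' = x ∨ y' = y) := by
    by_contra! hc
    have h1 : ∑ x' ∈ L, ∑ y' ∈ L, ind H (vert E j) x' y' ≤ ∑ x' ∈ L, ∑ y' ∈ L,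
        ((if x' = x then 1 else 0) + (if x' = y then 1 else 0) + (if y' = x then 1 else 0) +
          (if y' = y then 1 else 0)) := by
      refine sum_le_sum fun x' hx' => sum_le_sum fun y' hy' => ?_
      unfold ind
      split_ifs with h0 <;> norm_num
      exact absurd (hc x' hx' y' hy' h0) (by tauto)
    simp only [sum_add_distrib, sum_const, sum_ite_eq', hx, hy, if_true, smul_ite, smul_zero] at h1
    simp at h1
    linarith
  push Not at hd
  have h1 : HasMatchingIn H {vert E i, x, y} 1 := HasMatchingIn.one hxy subset_rfl
  have h2 : HasMatchingIn H {vert E j, x', y'} 1 := HasMatchingIn.one hxy' subset_rfl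
  refine h.not_augment {E} ((h1.union h.uniform h2 ?_).mono ?_)
  · rw [disjoint_left]
    have hne : ∀ k, ∀ z ∈ L, vert E k ≠ z := fun k z hz hk => h.vert_notMem E k (hk ▸ hz)
    intro v hv hv'
    simp only [mem_insert, mem_singleton] at hv hv'
    have e1 := hne i x' hx'
    have e2 := hne i y' hy'
    have e3 := hne j x hx
    have e4 := hne j y hy
    have e5 : vert E i ≠ vert E j := fun hc => hij (h.inj _ _ _ _ hc).2
    grind
  · have e1 : ∀ k, vert E k ∈ cover vert {E} := fun k => vert_mem_cover (by simp) k
    simp only [union_subset_iff, insert_subset_iff, singleton_subset_iff, mem_union]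
    tauto

lemma sum_leftLink_le (h : IsMaxSystem H W L vert) (E : ι) :
    ∑ i, ∑ x ∈ L, ∑ y ∈ L, ind H (vert E i) x y ≤ #L * #L + 8 * #L := by
  have h1 : ∀ i, ∑ x ∈ L, ∑ y ∈ L, ind H (vert E i) x y ≤ #L * #L := fun i =>
    (sum_le_card_mul fun x _ => (sum_le_card_mul fun y _ => ind_le_one _ _ _)).trans (by simp)
  have h2 : ∀ i j, i ≠ j → _ := fun i j hij => h.leftLink_le (E := E) (i := i) (j := j) hij
  have hL : (0 : ℝ) ≤ #L := by positivity
  have hL' : (0 : ℝ) ≤ #L * #L := by positivity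
  rw [Fin.sum_univ_three]
  have a0 := h1 0
  have a1 := h1 1
  have a2 := h1 2
  by_cases c0 : (4 * #L : ℝ) < ∑ x ∈ L, ∑ y ∈ L, ind H (vert E 0) x y
  · have := h2 0 1 (by decide) c0
    have := h2 0 2 (by decide) c0
    linarith
  · by_cases c1 : (4 * #L : ℝ) < ∑ x ∈ L, ∑ y ∈ L, ind H (vert E 1) x y
    · have := h2 1 2 (by decide) c1
      linarith
    · linarith

lemma sum_pair_le {E F : ι} :
    ∑ i, ∑ j, ∑ x ∈ L, ind H x (vert E i) (vert F j) ≤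
      27 + #L * wt (richGraph H L vert E F) := by
  have h1 : ∀ i j, ∑ x ∈ L, ind H x (vert E i) (vert F j) ≤
      3 + #L * (if richGraph H L vert E F i j = true then 1 else 0) := by
    intro i j
    have e1 : ∑ x ∈ L, ind H x (vert E i) (vert F j) =
        #{x ∈ L | ({x, vert E i, vert F j} : Finset V) ∈ H} := by
      simp [ind]
    split_ifs with hr
    · refine (sum_le_card_mul fun x _ => ind_le_one _ _ _).trans ?_
      linarith
    · rw [e1]
      replace hr : ¬ IsRich H L (vert E i) (vert F j) := by simpa [richGraph] using hr
      unfold IsRich at hr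
      have : #{x ∈ L | ({x, vert E i, vert F j} : Finset V) ∈ H} ≤ 3 := by omega
      have : (#{x ∈ L | ({x, vert E i, vert F j} : Finset V) ∈ H} : ℝ) ≤ 3 := by exact_mod_cast this
      linarith
  have h2 : (wt (richGraph H L vert E F) : ℝ) =
      ∑ i, ∑ j, if richGraph H L vert E F i j = true then 1 else 0 := by
    rw [wt, card_filter, ← univ_product_univ, sum_product]
    push_cast
    rfl
  calc _ ≤ ∑ i, ∑ j, (3 + #L * (if richGraph H L vert E F i j = true then 1 else 0 : ℝ)) :=
        sum_le_sum fun i _ => sum_le_sum fun j _ => h1 i j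
    _ = 27 + #L * wt (richGraph H L vert E F) := by
        rw [h2]
        simp only [sum_add_distrib, mul_sum]
        simp
        norm_num

/-- Counting the edges at the vertices of `L`. -/
lemma sum_link_le (h : IsMaxSystem H W L vert) :
    ∑ x ∈ L, ∑ u, ∑ v, ind H x u v ≤ 2 * #L * #W * Fintype.card V +
      2 * Fintype.card ι * (#L * #L + 8 * #L) + 9 * Fintype.card ι * #L +
      27 * (Fintype.card ι * Fintype.card ι) +
      #L * ∑ p ∈ (univ : Finset ι).offDiag, (wt (richGraph H L vert p.1 p.2) : ℝ) := by
  set n : ℝ := (Fintype.card V : ℝ) with hn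
  set m : ℝ := (Fintype.card ι : ℝ) with hm
  have hsum := h.card_split
  rw [← hn, ← hm] at hsum
  have hW : (0 : ℝ) ≤ #W := by positivity
  have hL : (0 : ℝ) ≤ #L := by positivity
  have hm0 : 0 ≤ m := by positivity
  -- pairs within `R`
  have hR : ∑ x ∈ L, ∑ E, ∑ i, ∑ F, ∑ j, ind H x (vert E i) (vert F j) ≤ 9 * m * #L +
      27 * (m * m) + #L * ∑ p ∈ (univ : Finset ι).offDiag,
        (wt (richGraph H L vert p.1 p.2) : ℝ) := by
    have e1 : ∑ x ∈ L, ∑ E, ∑ i, ∑ F, ∑ j, ind H x (vert E i) (vert F j) =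
        ∑ E, ∑ F, ∑ i, ∑ j, ∑ x ∈ L, ind H x (vert E i) (vert F j) := by
      rw [sum_comm]
      refine sum_congr rfl fun E _ => ?_
      rw [sum_comm]
      rw [sum_comm (s := univ) (t := univ)]
      refine sum_congr rfl fun i _ => ?_
      rw [sum_comm]
      refine sum_congr rfl fun F _ => ?_
      rw [sum_comm]
    have e2 : ∀ E F, ∑ i, ∑ j, ∑ x ∈ L, ind H x (vert E i) (vert F j) ≤
        27 + (if E = F then 9 * #L else 0 : ℝ) +
          #L * (if E ≠ F then (wt (richGraph H L vert E F) : ℝ) else 0) := by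
      intro E F
      by_cases hEF : E = F
      · have : ∑ i, ∑ j, ∑ x ∈ L, ind H x (vert E i) (vert F j) ≤ 9 * #L := by
          calc _ ≤ ∑ i : Fin 3, ∑ j : Fin 3, ∑ x ∈ L, (1 : ℝ) :=
                sum_le_sum fun i _ => sum_le_sum fun j _ => sum_le_sum fun x _ => ind_le_one _ _ _
            _ = 9 * #L := by simp; ring
        simp only [hEF, if_true, ne_eq, not_true_eq_false, if_false] at this ⊢
        linarith
      · have := sum_pair_le (H := H) (L := L) (vert := vert) (E := E) (F := F)
        simp only [hEF, ne_eq, not_false_eq_true, if_true, if_false]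
        linarith
    have e3 : ∑ p ∈ (univ : Finset ι).offDiag, (wt (richGraph H L vert p.1 p.2) : ℝ) =
        ∑ E, ∑ F, (if E ≠ F then (wt (richGraph H L vert E F) : ℝ) else 0) := by
      rw [← sum_product', univ_product_univ, ← sum_filter]
      refine sum_congr ?_ fun _ _ => rfl
      ext p; simp
    rw [e1, e3]
    refine (sum_le_sum fun E _ => sum_le_sum fun F _ => e2 E F).trans (le_of_eq ?_)
    simp only [sum_add_distrib, ← mul_sum]
    simp
    ring
  have hLR : ∑ x ∈ L, ∑ u ∈ L, ∑ E, ∑ i, ind H x u (vert E i) ≤ m * (#L * #L + 8 * #L) := by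
    have e1 : ∑ x ∈ L, ∑ u ∈ L, ∑ E, ∑ i, ind H x u (vert E i) =
        ∑ E, ∑ i, ∑ x ∈ L, ∑ u ∈ L, ind H (vert E i) x u := by
      simp_rw [ind_rotate (vert _ _)]
      rw [sum_congr rfl fun x _ => sum_comm (s := L) (t := univ)]
      rw [sum_comm]
      refine sum_congr rfl fun E _ => ?_
      rw [sum_congr rfl fun x _ => sum_comm (s := L) (t := univ)]
      rw [sum_comm]
    rw [e1]
    exact (sum_le_card_mul fun E _ => h.sum_leftLink_le E).trans (by simp [hm])
  have hRL : ∑ x ∈ L, ∑ E, ∑ i, ∑ u ∈ L, ind H x (vert E i) u =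
      ∑ x ∈ L, ∑ u ∈ L, ∑ E, ∑ i, ind H x u (vert E i) := by
    refine sum_congr rfl fun x _ => ?_
    rw [sum_comm (s := L)]
    refine sum_congr rfl fun E _ => ?_
    rw [sum_comm (s := L)]
    simp_rw [ind_swap x]
  have hx : ∀ x ∈ L, ∑ u, ∑ v, ind H x u v ≤ 2 * #W * n +
      ∑ u ∈ L, ∑ E, ∑ i, ind H x u (vert E i) + ∑ E, ∑ i, ∑ u ∈ L, ind H x (vert E i) u +
      ∑ E, ∑ i, ∑ F, ∑ j, ind H x (vert E i) (vert F j) := by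
    intro x hx
    rw [h.sum_split]
    simp_rw [h.sum_split (fun v => ind H x _ v)]
    have a1 : ∑ u ∈ W, (∑ v ∈ W, ind H x u v + ∑ v ∈ L, ind H x u v +
        ∑ E, ∑ i, ind H x u (vert E i)) ≤ #W * n := by
      refine sum_le_card_mul fun u _ => ?_
      rw [← h.sum_split (fun v => ind H x u v)]
      exact (sum_le_card_mul fun v _ => ind_le_one _ _ _).trans (by simp [hn])
    have a2 : ∑ u ∈ L, ∑ v ∈ W, ind H x u v ≤ #L * (#W * 1) :=
      sum_le_card_mul fun u _ => sum_le_card_mul fun v _ => ind_le_one _ _ _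
    have a3 : ∑ u ∈ L, ∑ v ∈ L, ind H x u v = 0 :=
      sum_eq_zero fun u hu => sum_eq_zero fun v hv => h.ind_left hx hu hv
    have a4 : ∑ E, ∑ i, ∑ v ∈ W, ind H x (vert E i) v ≤ m * (3 * (#W * 1)) := by
      refine (sum_le_card_mul fun E _ => sum_le_card_mul fun i _ => sum_le_card_mul fun v _ =>
        ind_le_one _ _ _).trans ?_
      simp [hm]
    simp only [sum_add_distrib] at a1 ⊢
    rw [a3]
    have : 0 ≤ (#W : ℝ) * #W := by positivity
    nlinarith
  refine (sum_le_sum hx).trans ?_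
  simp only [sum_add_distrib, sum_const, nsmul_eq_mul]
  rw [hRL]
  nlinarith

lemma sum_weight_le (h : IsMaxSystem H W L vert) (hL : 0 < #L)
    (hdeg : ∀ x, 5 / 9 * (Fintype.card V : ℝ) ^ 2 - 4 * Fintype.card V ≤ ∑ u, ∑ v, ind H x u v) :
    ∑ p ∈ (univ : Finset ι).offDiag, (5 - wt (richGraph H L vert p.1 p.2) : ℝ) ≤
      4 * Fintype.card V + 2 * #W * Fintype.card V + 20 * Fintype.card ι +
        27 * (Fintype.card ι * Fintype.card ι) / #L - 4 / 3 * (Fintype.card ι * #L) -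
        5 / 9 * (#L * #L) := by
  have h1 := h.sum_link_le
  have h2 : #L * (5 / 9 * (Fintype.card V : ℝ) ^ 2 - 4 * Fintype.card V) ≤
      ∑ x ∈ L, ∑ u, ∑ v, ind H x u v := by
    simpa using card_nsmul_le_sum L _ _ fun x _ => hdeg x
  have h3 := h.card_split
  rw [sum_sub_distrib, sum_const, offDiag_card, nsmul_eq_mul]
  set n : ℝ := (Fintype.card V : ℝ) with hn
  have hcast : ((#(univ : Finset ι) * #(univ : Finset ι) - #(univ : Finset ι) : ℕ) : ℝ) =
      Fintype.card ι * Fintype.card ι - Fintype.card ι := by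
    rw [Nat.cast_sub (Nat.le_mul_self _)]; simp
  rw [hcast]
  set m : ℝ := (Fintype.card ι : ℝ) with hm
  set X := ∑ p ∈ (univ : Finset ι).offDiag, (wt (richGraph H L vert p.1 p.2) : ℝ)
  have hW : (0 : ℝ) ≤ #W := by positivity
  have hL' : (0 : ℝ) < #L := by positivity
  have hm0 : 0 ≤ m := by positivity
  have h4 : 5 / 9 * n ^ 2 - 4 * n ≤ 2 * #W * n + 2 * m * (#L + 8) + 9 * m +
      27 * (m * m) / #L + X := by
    have h5 := h2.trans h1
    rw [← mul_le_mul_iff_right₀ hL']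
    refine h5.trans (le_of_eq ?_)
    field_simp
  have h6 : (3 * m + #L) ^ 2 ≤ n ^ 2 := by
    apply pow_le_pow_left₀ (by positivity); linarith
  nlinarith

end IsMaxSystem

namespace IsMaxSystem

variable {V ι : Type*} [Fintype V] [DecidableEq V] [Fintype ι] [DecidableEq ι]
  {H : Finset (Finset V)} {W L : Finset V} {vert : ι → Fin 3 → V}

set_option maxHeartbeats 1000000 in
open Classical in
/-- Few edges avoid the centers of the edges of the matching. -/
lemma sum_ind_le (h : IsMaxSystem H W L vert) (c : ι → Fin 3) {Q : ℝ}
    (hQ : (#{p ∈ (univ : Finset ι).offDiag |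
      ¬ IsTight.CenteredAt (richGraph H L vert) c p.1 p.2} : ℝ) ≤ Q) :
    ∑ x ∈ (univ.image fun E => vert E (c E))ᶜ, ∑ y ∈ (univ.image fun E => vert E (c E))ᶜ,
      ∑ z ∈ (univ.image fun E => vert E (c E))ᶜ, ind H x y z ≤
      3 * (#W + #L) * (Fintype.card V * Fintype.card V) +
        81 * (Fintype.card ι * (Fintype.card ι + Q)) := by
  set B := (univ.image fun E => vert E (c E))ᶜ with hB
  set n : ℝ := (Fintype.card V : ℝ) with hn
  set m : ℝ := (Fintype.card ι : ℝ) with hm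
  set w : ℝ := (#W + #L : ℝ) with hw
  have hm0 : 0 ≤ m := by positivity
  have hw0 : 0 ≤ w := by positivity
  have hn0 : 0 ≤ n := by positivity
  have hsum : n = w + 3 * m := by rw [hn, h.card_split]
  have hcB : ∀ E, vert E (c E) ∉ B := fun E => by simp [hB]
  let f : V → V → V → ℝ := fun x y z => if x ∈ B ∧ y ∈ B ∧ z ∈ B then ind H x y z else 0
  have hf0 : ∀ x y z, 0 ≤ f x y z := fun x y z => by
    simp only [f]; split_ifs; exacts [ind_nonneg _ _ _, le_rfl]
  have hf1 : ∀ x y z, f x y z ≤ 1 := fun x y z => by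
    simp only [f]; split_ifs; exacts [ind_le_one _ _ _, zero_le_one]
  have hfeq : ∑ x ∈ B, ∑ y ∈ B, ∑ z ∈ B, ind H x y z = ∑ x, ∑ y, ∑ z, f x y z := by
    symm
    rw [← sum_subset (subset_univ B) fun x _ hx => sum_eq_zero fun y _ => sum_eq_zero fun z _ => by
      simp [f, hx]]
    refine sum_congr rfl fun x hx => ?_
    rw [← sum_subset (subset_univ B) fun y _ hy => sum_eq_zero fun z _ => by simp [f, hy]]
    refine sum_congr rfl fun y hy => ?_
    rw [← sum_subset (subset_univ B) fun z _ hz => by simp [f, hz]]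
    exact sum_congr rfl fun z hz => by simp [f, hx, hy, hz]
  let bad : ι → ι → ℝ := fun E F =>
    if E = F ∨ ¬ IsTight.CenteredAt (richGraph H L vert) c E F then 1 else 0
  have hbad0 : ∀ E F, 0 ≤ bad E F := fun E F => by simp only [bad]; split_ifs <;> norm_num
  have hbad : ∑ E, ∑ F, bad E F ≤ m + Q := by
    have e1 : ∀ E F, bad E F = (if E = F then 1 else 0) +
        (if E ≠ F ∧ ¬ IsTight.CenteredAt (richGraph H L vert) c E F then 1 else 0) := by
      intro E F
      by_cases hEF : E = F <;> simp [bad, hEF]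
    simp_rw [e1, sum_add_distrib]
    gcongr
    · simp [hm]
    · refine le_trans (le_of_eq ?_) hQ
      rw [← sum_product', univ_product_univ, ← sum_filter, sum_const, nsmul_eq_mul, mul_one]
      congr 2
      ext p; simp
  have hcore : ∀ E F K i j k, f (vert E i) (vert F j) (vert K k) ≤
      bad E F + bad F K + bad K E := by
    intro E F K i j k
    by_cases h1 : E = F ∨ ¬ IsTight.CenteredAt (richGraph H L vert) c E F
    · have : bad E F = 1 := by simp only [bad, if_pos h1]
      linarith [hf1 (vert E i) (vert F j) (vert K k), hbad0 F K, hbad0 K E]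
    by_cases h2 : F = K ∨ ¬ IsTight.CenteredAt (richGraph H L vert) c F K
    · have : bad F K = 1 := by simp only [bad, if_pos h2]
      linarith [hf1 (vert E i) (vert F j) (vert K k), hbad0 E F, hbad0 K E]
    by_cases h3 : K = E ∨ ¬ IsTight.CenteredAt (richGraph H L vert) c K E
    · have : bad K E = 1 := by simp only [bad, if_pos h3]
      linarith [hf1 (vert E i) (vert F j) (vert K k), hbad0 F K, hbad0 E F]
    have : f (vert E i) (vert F j) (vert K k) = 0 := by
      simp only [f]
      split_ifs with hc
      · push Not at h1 h2 h3
        rw [ind, if_neg]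
        refine h.notMem_of_centeredAt h1.1 h3.1.symm h2.1 h1.2 h2.2 h3.2 ?_ ?_ ?_
        · rintro rfl; exact hcB _ hc.1
        · rintro rfl; exact hcB _ hc.2.1
        · rintro rfl; exact hcB _ hc.2.2
      · rfl
    rw [this]
    linarith [hbad0 E F, hbad0 F K, hbad0 K E]
  have hz : ∀ x y, ∑ z, f x y z ≤ n := fun x y =>
    (sum_le_card_mul fun z _ => hf1 x y z).trans (by simp [hn])
  have hyz : ∀ x, ∑ y, ∑ z, f x y z ≤ n * n := fun x =>
    (sum_le_card_mul fun y _ => hz x y).trans (by simp [hn])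
  have hx1 : ∑ x, ∑ y, ∑ z, f x y z ≤ w * (n * n) +
      ∑ E, ∑ i, ∑ y, ∑ z, f (vert E i) y z := by
    rw [h.sum_split]
    have a1 : ∑ x ∈ W, ∑ y, ∑ z, f x y z ≤ #W * (n * n) := sum_le_card_mul fun x _ => hyz x
    have a2 : ∑ x ∈ L, ∑ y, ∑ z, f x y z ≤ #L * (n * n) := sum_le_card_mul fun x _ => hyz x
    rw [hw, add_mul]
    linarith
  have hy1 : ∀ x, ∑ y, ∑ z, f x y z ≤ w * n + ∑ F, ∑ j, ∑ z, f x (vert F j) z := by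
    intro x
    rw [h.sum_split]
    have a1 : ∑ y ∈ W, ∑ z, f x y z ≤ #W * n := sum_le_card_mul fun y _ => hz x y
    have a2 : ∑ y ∈ L, ∑ z, f x y z ≤ #L * n := sum_le_card_mul fun y _ => hz x y
    rw [hw, add_mul]
    linarith
  have hz1 : ∀ x y, ∑ z, f x y z ≤ w + ∑ K, ∑ k, f x y (vert K k) := by
    intro x y
    rw [h.sum_split]
    have a1 : ∑ z ∈ W, f x y z ≤ #W * 1 := sum_le_card_mul fun z _ => hf1 x y z
    have a2 : ∑ z ∈ L, f x y z ≤ #L * 1 := sum_le_card_mul fun z _ => hf1 x y z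
    rw [hw]
    linarith
  rw [hfeq]
  have main : ∑ E : ι, ∑ i : Fin 3, ∑ F : ι, ∑ j : Fin 3, ∑ K : ι, ∑ k : Fin 3, f (vert E i) (vert F j) (vert K k) ≤
      81 * (m * (m + Q)) := by
    have b1 : ∑ E : ι, ∑ i : Fin 3, ∑ F : ι, ∑ j : Fin 3, ∑ K : ι, ∑ k : Fin 3, f (vert E i) (vert F j) (vert K k) ≤
        ∑ E : ι, ∑ _i : Fin 3, ∑ F : ι, ∑ _j : Fin 3, ∑ K : ι, ∑ _k : Fin 3,
          (bad E F + bad F K + bad K E) :=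
      sum_le_sum fun E _ => sum_le_sum fun i _ => sum_le_sum fun F _ => sum_le_sum fun j _ =>
        sum_le_sum fun K _ => sum_le_sum fun k _ => hcore E F K i j k
    refine b1.trans ?_
    have b2 : ∑ i, ∑ x, bad x i = ∑ E, ∑ F, bad E F := sum_comm
    have b3 : ∑ E : ι, ∑ _i : Fin 3, ∑ F : ι, ∑ _j : Fin 3, ∑ K : ι, ∑ _k : Fin 3,
          (bad E F + bad F K + bad K E) = 81 * (m * ∑ E, ∑ F, bad E F) := by
      simp only [sum_const, card_univ, Fintype.card_fin, nsmul_eq_mul, ← mul_sum,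
        sum_add_distrib, ← hm]
      rw [b2]
      push_cast
      ring
    rw [b3]
    gcongr
  have s1 : ∑ E, ∑ i, ∑ y, ∑ z, f (vert E i) y z ≤ ∑ E, ∑ i : Fin 3, (w * n +
      ∑ F, ∑ j : Fin 3, (w + ∑ K, ∑ k, f (vert E i) (vert F j) (vert K k))) :=
    sum_le_sum fun E _ => sum_le_sum fun i _ => (hy1 _).trans <| by
      gcongr with F _ j _
      exact hz1 _ _
  have s2 : ∀ G : ι → Fin 3 → ι → Fin 3 → ℝ, ∑ E, ∑ i, (w * n + ∑ F, ∑ j, (w + G E i F j)) =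
      3 * m * (w * n) + 3 * m * (3 * m * w) + ∑ E, ∑ i, ∑ F, ∑ j, G E i F j := by
    intro G
    simp only [sum_add_distrib, sum_const, card_univ, Fintype.card_fin, nsmul_eq_mul, ← hm]
    push_cast
    ring
  rw [s2] at s1
  have h3m : 3 * m ≤ n := by linarith
  have t1 : 3 * m * (w * n) ≤ n * (w * n) := by gcongr
  have t2 : 3 * m * (3 * m * w) ≤ n * (n * w) := by gcongr
  linarith

/-- If a largest matching leaves many vertices uncovered, then the hypergraph has a large sparse
set of vertices. -/
lemma exists_sparse (h : IsMaxSystem H W L vert)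
    (hn : (10 : ℝ) ^ 30 ≤ Fintype.card V)
    (hdeg : ∀ x, 5 / 9 * (Fintype.card V : ℝ) ^ 2 - 4 * Fintype.card V ≤ ∑ u, ∑ v, ind H x u v)
    (hW : (#W : ℝ) ≤ (Fintype.card V : ℝ) / 10 ^ 21) (hL : (10 : ℝ) ^ 22 ≤ #L) :
    ∃ B : Finset V, Fintype.card V ≤ #B + Fintype.card ι ∧
      ∑ x ∈ B, ∑ y ∈ B, ∑ z ∈ B, ind H x y z ≤ (Fintype.card V : ℝ) ^ 3 / 10 ^ 9 := by
  classical
  have hL0 : (0 : ℝ) < #L := by linarith [show (0 : ℝ) < 10 ^ 22 by positivity]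
  have hS := h.sum_weight_le (by exact_mod_cast hL0) hdeg
  have h5 := h.isTight.card_wt_ne_five_le hS
  obtain ⟨c, hc⟩ := h.isTight.exists_center hS
  have hsum := h.card_split
  have hB := h.sum_ind_le c hc
  refine ⟨(univ.image fun E => vert E (c E))ᶜ, ?_, hB.trans ?_⟩
  · have := card_compl_add_card (univ.image fun E => vert E (c E))
    have h2 : #(univ.image fun E => vert E (c E)) ≤ Fintype.card ι := card_image_le
    omega
  · have h0 := (Nat.cast_nonneg _ : (0 : ℝ) ≤ _).trans h5
    clear hB hc h5 hS hdeg
    set n : ℝ := (Fintype.card V : ℝ) with hn'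
    set m : ℝ := (Fintype.card ι : ℝ) with hm
    set l : ℝ := (#L : ℝ) with hl
    set w : ℝ := (#W : ℝ) with hw
    have hw0 : 0 ≤ w := by positivity
    have hm0 : 0 ≤ m := by positivity
    have hn0 : 0 < n := by linarith [show (0 : ℝ) < 10 ^ 30 by positivity]
    have h3m : 3 * m ≤ n := by linarith
    have hnn : n ≤ n ^ 2 / 10 ^ 30 := by
      rw [le_div_iff₀ (by positivity)]; nlinarith
    have e1 : 27 * (m * m) / l ≤ 3 / 10 ^ 22 * n ^ 2 := by
      rw [div_le_iff₀ hL0]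
      have : 27 * (m * m) ≤ 3 * n ^ 2 := by nlinarith
      have : n ^ 2 * 10 ^ 22 ≤ n ^ 2 * l := by gcongr
      linarith
    have e2 : 2 * w * n ≤ 2 / 10 ^ 21 * n ^ 2 := by
      have : w * n ≤ n / 10 ^ 21 * n := by gcongr
      linarith
    have hml : 0 ≤ m * l := by positivity
    have hll : l ^ 2 ≤ (n / 10 ^ 10) ^ 2 := by
      have : 5 / 9 * (l * l) ≤ 4 * n + 2 * w * n + 23 * m + 27 * (m * m) / l := by linarith
      norm_num at *
      linarith
    have hl10 : l ≤ n / 10 ^ 10 := by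
      apply le_of_sq_le_sq hll |> fun h => h
      positivity
    have hwl : w + l ≤ 2 / 10 ^ 10 * n := by norm_num at *; linarith
    set S := 4 * n + 2 * w * n + 20 * m + 27 * (m * m) / l - 4 / 3 * (m * l) - 5 / 9 * (l * l)
    have hSle : m + (27 * S + 74 * m) ≤ n ^ 2 / 10 ^ 18 := by
      have : 0 ≤ l * l := by positivity
      simp only [S]
      norm_num at *
      linarith
    have f1 : 3 * (w + l) * (n * n) ≤ 3 * (2 / 10 ^ 10 * n) * (n * n) := by gcongr
    have f2 : 81 * (m * (m + (27 * S + 74 * m))) ≤ 81 * (n / 3 * (n ^ 2 / 10 ^ 18)) := by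
      have : m * (m + (27 * S + 74 * m)) ≤ m * (n ^ 2 / 10 ^ 18) := by gcongr
      have : m * (n ^ 2 / 10 ^ 18) ≤ n / 3 * (n ^ 2 / 10 ^ 18) := by gcongr; linarith
      linarith
    have f3 : 3 * (2 / 10 ^ 10 * n) * (n * n) + 81 * (n / 3 * (n ^ 2 / 10 ^ 18)) =
        (6 / 10 ^ 10 + 27 / 10 ^ 18) * n ^ 3 := by ring
    have : 0 < n ^ 3 := by positivity
    norm_num at *
    linarith

end IsMaxSystem

section Bipartite

variable {V : Type*} [DecidableEq V] {H : Finset (Finset V)}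

lemma one_sub_ind_nonneg (x y z : V) : 0 ≤ 1 - ind H x y z := by linarith [ind_le_one (H := H) x y z]

lemma sum_comp_le_of_injOn {α β : Type*} [DecidableEq β] {s : Finset α} {t : Finset β} {φ : α → β}
    {g : β → ℝ} (hφ : ∀ x ∈ s, φ x ∈ t) (hinj : Set.InjOn φ s) (hg : ∀ y, 0 ≤ g y) :
    ∑ x ∈ s, g (φ x) ≤ ∑ y ∈ t, g y := by
  rw [← sum_image hinj]
  exact sum_le_sum_of_subset_of_nonneg (image_subset_iff.2 hφ) fun y _ _ => hg y

lemma sum_sum_comp_le_of_injOn {α β : Type*} [DecidableEq β] {s : Finset α} {t t' : Finset β}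
    {φ ψ : α → β} {g : β → β → ℝ} (hφ : ∀ x ∈ s, φ x ∈ t) (hφi : Set.InjOn φ s)
    (hψ : ∀ x ∈ s, ψ x ∈ t') (hψi : Set.InjOn ψ s) (hg : ∀ x y, 0 ≤ g x y) :
    ∑ x ∈ s, ∑ y ∈ s, g (φ x) (ψ y) ≤ ∑ x ∈ t, ∑ y ∈ t', g x y :=
  (sum_le_sum fun x _ => sum_comp_le_of_injOn hψ hψi (hg (φ x))).trans
    (sum_comp_le_of_injOn (g := fun x => ∑ y ∈ t', g x y) hφ hφi
      fun x => sum_nonneg fun y _ => hg x y)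

open Classical in
/-- If `A` and `B` are such that almost all triples with one vertex in `A` and two in `B` are edges,
even locally at each vertex, then there is a matching of edges of this type that covers `A`. -/
lemma hasMatchingIn_bipartite (hH : ∀ e ∈ H, #e = 3) {A B : Finset V} (hAB : Disjoint A B)
    (hB : 2 * #A ≤ #B) {n : ℝ} (hn : 10 ^ 5 ≤ n) (hA : n / 4 ≤ #A)
    (ha : ∀ a ∈ A, ∑ u ∈ B, ∑ w ∈ B, (1 - ind H a u w) ≤ n ^ 2 / 1000)
    (hb : ∀ b ∈ B, ∑ u ∈ A, ∑ w ∈ B, (1 - ind H b u w) ≤ n ^ 2 / 1000) :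
    HasMatchingIn H (A ∪ B) #A := by
  set H3 : Finset (Finset V) := {e ∈ H | ∃ a ∈ A, ∃ b ∈ B, ∃ c ∈ B, e = {a, b, c}} with hH3
  have hH3H : H3 ⊆ H := filter_subset _ _
  have hH3' : ∀ e ∈ H3, #e = 3 := fun e he => hH e (hH3H he)
  suffices h : ∀ k ≤ #A, HasMatchingIn H3 (A ∪ B) k from (h _ le_rfl).mono_left hH3H
  intro k
  induction k with
  | zero => exact fun _ => HasMatchingIn.zero
  | succ k ih =>
  intro hk
  obtain ⟨M, h1, h2, h3, h4⟩ := ih (by omega)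
  have hex : ∀ e ∈ M, ∃ a ∈ A, ∃ b ∈ B, ∃ c ∈ B, e = {a, b, c} := fun e he =>
    (mem_filter.1 (h1 he)).2
  have hV : Nonempty V := by
    obtain ⟨x, -⟩ := card_pos.1 (by omega : 0 < #A)
    exact ⟨x⟩
  choose! va hva vb hvb vc hvc he using hex
  have hme : ∀ e ∈ M, ∀ v, v ∈ e ↔ v = va e ∨ v = vb e ∨ v = vc e := fun e h v => by
    conv_lhs => rw [he e h]
    simp
  have hdisj : ∀ e ∈ M, ∀ f ∈ M, ∀ v, v ∈ e → v ∈ f → e = f := by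
    intro e he f hf v hv hv'
    by_contra hne
    exact disjoint_left.1 (h2 he hf hne) hv hv'
  have hne : ∀ e ∈ M, va e ≠ vb e ∧ va e ≠ vc e ∧ vb e ≠ vc e := fun e h => by
    have := hH3' e (h1 h)
    rw [he e h] at this
    exact ne_of_card_triple this
  have ia : Set.InjOn va M := fun e h f h' hef =>
    hdisj e h f h' (va e) (by simp [hme e h]) (by simp [hme f h', hef])
  have ib : Set.InjOn vb M := fun e h f h' hef =>
    hdisj e h f h' (vb e) (by simp [hme e h]) (by simp [hme f h', hef])
  have ic : Set.InjOn vc M := fun e h f h' hef =>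
    hdisj e h f h' (vc e) (by simp [hme e h]) (by simp [hme f h', hef])
  obtain ⟨a, haA, haM⟩ : ∃ a ∈ A, a ∉ M.image va :=
    exists_mem_notMem_of_card_lt_card (lt_of_le_of_lt card_image_le (by omega))
  have ha' : ∀ e ∈ M, a ∉ e := by
    intro e h hc
    rcases (hme e h a).1 hc with rfl | rfl | rfl
    · exact haM (mem_image_of_mem _ h)
    · exact disjoint_left.1 hAB haA (hvb e h)
    · exact disjoint_left.1 hAB haA (hvc e h)
  set U := B \ (M.image vb ∪ M.image vc) with hU
  have hUc : #B ≤ #U + 2 * k := by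
    have e1 : #B - #(M.image vb ∪ M.image vc) ≤ #U := le_card_sdiff _ _
    have e2 := card_union_le (M.image vb) (M.image vc)
    have e3 : #(M.image vb) ≤ #M := card_image_le
    have e4 : #(M.image vc) ≤ #M := card_image_le
    omega
  have hUM : ∀ e ∈ M, ∀ u ∈ U, u ∉ e := by
    intro e h u hu hc
    rw [hU, mem_sdiff, mem_union, not_or] at hu
    rcases (hme e h u).1 hc with rfl | rfl | rfl
    · exact disjoint_left.1 hAB (hva e h) hu.1
    · exact hu.2.1 (mem_image_of_mem _ h)
    · exact hu.2.2 (mem_image_of_mem _ h)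
  have hUB : U ⊆ B := sdiff_subset
  have mem3 : ∀ {x y z : V}, x ∈ A → y ∈ B → z ∈ B → ({x, y, z} : Finset V) ∈ H →
      ({x, y, z} : Finset V) ∈ H3 := fun hx hy hz h =>
    mem_filter.2 ⟨h, _, hx, _, hy, _, hz, rfl⟩
  have sub3 : ∀ {x y z : V}, x ∈ A → y ∈ B → z ∈ B → ({x, y, z} : Finset V) ⊆ A ∪ B := by
    intro x y z hx hy hz
    simp only [insert_subset_iff, singleton_subset_iff, mem_union]
    tauto
  rcases le_or_gt (k : ℝ) (n / 16) with hkn | hkn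
  · obtain ⟨u, hu, w, hw, huw⟩ : ∃ u ∈ U, ∃ w ∈ U, ({a, u, w} : Finset V) ∈ H := by
      by_contra! hc
      have e1 : ∑ u ∈ U, ∑ w ∈ U, (1 - ind H a u w) = #U * #U := by
        rw [sum_congr rfl fun u hu => sum_congr rfl fun w hw => by rw [ind, if_neg (hc u hu w hw)]]
        simp
      have e2 : ∑ u ∈ U, ∑ w ∈ U, (1 - ind H a u w) ≤ ∑ u ∈ B, ∑ w ∈ B, (1 - ind H a u w) := by
        refine (sum_le_sum fun u _ => sum_le_sum_of_subset_of_nonneg hUB fun _ _ _ =>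
          one_sub_ind_nonneg _ _ _).trans ?_
        exact sum_le_sum_of_subset_of_nonneg hUB fun _ _ _ => sum_nonneg fun _ _ =>
          one_sub_ind_nonneg _ _ _
      have e3 := ha a haA
      have e4 : n / 4 ≤ #U := by
        have : (2 * #A : ℝ) ≤ #B := by exact_mod_cast hB
        have : (#B : ℝ) ≤ #U + 2 * k := by exact_mod_cast hUc
        linarith
      have e5 : (n / 4) * (n / 4) ≤ #U * #U := by gcongr
      nlinarith
    have hM : HasMatchingIn H3 (M.biUnion id) k :=
      ⟨M, h1, h2, fun e he => subset_biUnion_of_mem id he, h4⟩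
    refine (hM.union hH3' (HasMatchingIn.one (mem3 haA (hUB hu) (hUB hw) huw) subset_rfl) ?_).mono
      (union_subset (biUnion_subset.2 h3) (sub3 haA (hUB hu) (hUB hw)))
    rw [disjoint_biUnion_left]
    intro e h
    rw [disjoint_right]
    intro v hv
    simp only [mem_insert, mem_singleton] at hv
    rcases hv with rfl | rfl | rfl
    exacts [ha' e h, hUM e h _ hu, hUM e h _ hw]
  · obtain ⟨b, hbU, b', hbU', hbb⟩ : ∃ b ∈ U, ∃ b' ∈ U, b ≠ b' :=
      one_lt_card.1 (by omega)
    obtain ⟨E, hE, F, hF, hEF, g1, g2, g3⟩ : ∃ E ∈ M, ∃ F ∈ M, E ≠ F ∧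
        ({a, vb E, vb F} : Finset V) ∈ H ∧ ({b, va E, vc F} : Finset V) ∈ H ∧
        ({b', va F, vc E} : Finset V) ∈ H := by
      by_contra! hc
      have e1 : ∑ E ∈ M, ∑ F ∈ M, (1 - ind H a (vb E) (vb F)) ≤ n ^ 2 / 1000 :=
        (sum_sum_comp_le_of_injOn (g := fun x y => 1 - ind H a x y) hvb ib hvb ib
          fun _ _ => one_sub_ind_nonneg _ _ _).trans (ha a haA)
      have e2 : ∑ E ∈ M, ∑ F ∈ M, (1 - ind H b (va E) (vc F)) ≤ n ^ 2 / 1000 :=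
        (sum_sum_comp_le_of_injOn (g := fun x y => 1 - ind H b x y) hva ia hvc ic
          fun _ _ => one_sub_ind_nonneg _ _ _).trans (hb b (hUB hbU))
      have e3 : ∑ F ∈ M, ∑ E ∈ M, (1 - ind H b' (va F) (vc E)) ≤ n ^ 2 / 1000 :=
        (sum_sum_comp_le_of_injOn (g := fun x y => 1 - ind H b' x y) hva ia hvc ic
          fun _ _ => one_sub_ind_nonneg _ _ _).trans (hb b' (hUB hbU'))
      rw [sum_comm] at e3
      have e4 : ∑ E ∈ M, ∑ F ∈ M, (1 : ℝ) ≤ ∑ E ∈ M, ∑ F ∈ M, ((if E = F then 1 else 0) +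
          (1 - ind H a (vb E) (vb F)) + (1 - ind H b (va E) (vc F)) +
            (1 - ind H b' (va F) (vc E))) := by
        refine sum_le_sum fun E hE => sum_le_sum fun F hF => ?_
        have n1 := one_sub_ind_nonneg (H := H) a (vb E) (vb F)
        have n2 := one_sub_ind_nonneg (H := H) b (va E) (vc F)
        have n3 := one_sub_ind_nonneg (H := H) b' (va F) (vc E)
        by_cases hEF : E = F
        · rw [if_pos hEF]; linarith
        rw [if_neg hEF]
        by_cases c1 : ({a, vb E, vb F} : Finset V) ∈ H
        · by_cases c2 : ({b, va E, vc F} : Finset V) ∈ H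
          · have : ind H b' (va F) (vc E) = 0 := by rw [ind, if_neg (hc E hE F hF hEF c1 c2)]
            linarith
          · have : ind H b (va E) (vc F) = 0 := by rw [ind, if_neg c2]
            linarith
        · have : ind H a (vb E) (vb F) = 0 := by rw [ind, if_neg c1]
          linarith
      simp only [sum_add_distrib] at e4
      have e5 : ∑ E ∈ M, ∑ F ∈ M, (if E = F then 1 else 0 : ℝ) = k := by
        rw [sum_congr rfl fun E hE => by rw [sum_ite_eq, if_pos hE]]
        simp [h4]
      have e6 : ∑ E ∈ M, ∑ F ∈ M, (1 : ℝ) = k * k := by simp [h4]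
      rw [e5, e6] at e4
      have e7 : n / 16 * (n / 16 - 1) ≤ k * (k - 1) := by
        apply mul_le_mul <;> linarith
      nlinarith
    have hE' := hme E hE
    have hF' := hme F hF
    have hdEF := hdisj E hE F hF
    have hbB := hUB hbU
    have hbB' := hUB hbU'
    have haE := ha' E hE
    have haF := ha' F hF
    have u1 := hUM E hE b hbU
    have u2 := hUM F hF b hbU
    have u3 := hUM E hE b' hbU'
    have u4 := hUM F hF b' hbU'
    have hneE := hne E hE
    have hneF := hne F hF
    have hab : a ≠ b := fun h => disjoint_left.1 hAB haA (h ▸ hbB)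
    have hab' : a ≠ b' := fun h => disjoint_left.1 hAB haA (h ▸ hbB')
    rw [hE'] at haE u1 u3
    rw [hF'] at haF u2 u4
    have d1 := hdEF (va E) (by simp [hE']) |> mt <| hEF
    have d2 := hdEF (vb E) (by simp [hE']) |> mt <| hEF
    have d3 := hdEF (vc E) (by simp [hE']) |> mt <| hEF
    rw [hF'] at d1 d2 d3
    rw [triple_rotate, triple_swap] at g2
    rw [triple_rotate, triple_swap] at g3
    have m1 : HasMatchingIn H3 {a, vb E, vb F} 1 :=
      HasMatchingIn.one (mem3 haA (hvb E hE) (hvb F hF) g1) subset_rfl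
    have m2 : HasMatchingIn H3 {va E, b, vc F} 1 :=
      HasMatchingIn.one (mem3 (hva E hE) hbB (hvc F hF) g2) subset_rfl
    have m3 : HasMatchingIn H3 {va F, b', vc E} 1 :=
      HasMatchingIn.one (mem3 (hva F hF) hbB' (hvc E hE) g3) subset_rfl
    have m4 : HasMatchingIn H3 (((M.erase E).erase F).biUnion id) (k - 2) := by
      refine ⟨(M.erase E).erase F, ((erase_subset _ _).trans (erase_subset _ _)).trans h1,
        h2.subset (by exact_mod_cast (erase_subset _ _).trans (erase_subset _ _)),
        fun e he => subset_biUnion_of_mem id he, ?_⟩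
      rw [card_erase_of_mem (mem_erase.2 ⟨hEF.symm, hF⟩), card_erase_of_mem hE, h4]
      omega
    have hk2 : 2 ≤ k := by
      have := card_le_card (show ({E, F} : Finset (Finset V)) ⊆ M by
        simp [insert_subset_iff, hE, hF])
      rw [card_pair hEF] at this
      omega
    have D12 : Disjoint ({a, vb E, vb F} : Finset V) {va E, b, vc F} := by
      rw [disjoint_left]
      intro v hv hv'
      simp only [mem_insert, mem_singleton] at hv hv'
      clear hme hdisj ha hb hUM ha' ih he hva hvb hvc hne hdEF
      grind
    have D123 : Disjoint ({a, vb E, vb F} ∪ {va E, b, vc F} : Finset V) {va F, b', vc E} := by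
      rw [disjoint_left]
      intro v hv hv'
      simp only [mem_insert, mem_singleton, mem_union] at hv hv'
      clear hme hdisj ha hb hUM ha' ih he hva hvb hvc hne hdEF
      grind
    have D4 : Disjoint ({a, vb E, vb F} ∪ {va E, b, vc F} ∪ {va F, b', vc E} : Finset V)
        (((M.erase E).erase F).biUnion id) := by
      rw [disjoint_biUnion_right]
      intro K hK
      simp only [mem_erase] at hK
      rw [disjoint_left]
      intro v hv hvK
      have k1 : ∀ x, x ∈ E → x ∉ K := fun x hx hx' => hK.2.1 (hdisj K hK.2.2 E hE x hx' hx)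
      have k2 : ∀ x, x ∈ F → x ∉ K := fun x hx hx' => hK.1 (hdisj K hK.2.2 F hF x hx' hx)
      simp only [mem_insert, mem_singleton, mem_union] at hv
      rcases hv with ((rfl | rfl | rfl) | (rfl | rfl | rfl)) | (rfl | rfl | rfl)
      · exact ha' K hK.2.2 hvK
      · exact k1 _ (by simp [hE']) hvK
      · exact k2 _ (by simp [hF']) hvK
      · exact k1 _ (by simp [hE']) hvK
      · exact hUM K hK.2.2 _ hbU hvK
      · exact k2 _ (by simp [hF']) hvK
      · exact k2 _ (by simp [hF']) hvK
      · exact hUM K hK.2.2 _ hbU' hvK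
      · exact k1 _ (by simp [hE']) hvK
    have hfin := ((m1.union hH3' m2 D12).union hH3' m3 D123).union hH3' m4 D4
    rw [show 1 + 1 + 1 + (k - 2) = k + 1 by omega] at hfin
    refine hfin.mono ?_
    refine union_subset (union_subset (union_subset ?_ ?_) ?_) (biUnion_subset.2 ?_)
    · exact sub3 haA (hvb E hE) (hvb F hF)
    · exact sub3 (hva E hE) hbB (hvc F hF)
    · exact sub3 (hva F hF) hbB' (hvc E hE)
    · intro K hK
      simp only [mem_erase] at hK
      exact h3 K hK.2.2

end Bipartite

section Extremal

variable {V : Type*} [Fintype V] [DecidableEq V] {H : Finset (Finset V)}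

lemma sum_sum_le_add {g : V → V → ℝ} (h0 : ∀ u w, 0 ≤ g u w) (h1 : ∀ u w, g u w ≤ 1)
    (S T : Finset V) :
    ∑ u ∈ S, ∑ w ∈ S, g u w ≤ ∑ u ∈ T, ∑ w ∈ T, g u w + 2 * #(S \ T) * Fintype.card V := by
  have hle : ∀ R : Finset V, (#R : ℝ) ≤ Fintype.card V := fun R => by
    exact_mod_cast card_le_univ R
  have key : ∀ f : V → ℝ, (∀ u, 0 ≤ f u) → ∑ u ∈ S, f u ≤ ∑ u ∈ T, f u + ∑ u ∈ S \ T, f u := by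
    intro f hf
    rw [← sum_inter_add_sum_sdiff S T f]
    gcongr
    exacts [fun _ _ _ => hf _, inter_subset_right]
  have e1 : ∀ u, ∑ w ∈ S, g u w ≤ ∑ w ∈ T, g u w + #(S \ T) * 1 := fun u =>
    (key _ (h0 u)).trans (by gcongr; exact sum_le_card_mul fun w _ => h1 u w)
  have e2 : ∑ u ∈ S, ∑ w ∈ S, g u w ≤ ∑ u ∈ S, ∑ w ∈ T, g u w + #S * #(S \ T) := by
    refine (sum_le_sum fun u _ => e1 u).trans ?_
    rw [sum_add_distrib]; simp
  have e3 := key (fun u => ∑ w ∈ T, g u w) fun u => sum_nonneg fun w _ => h0 u w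
  have e4 : ∑ u ∈ S \ T, ∑ w ∈ T, g u w ≤ #(S \ T) * (#T * 1) :=
    sum_le_card_mul fun u _ => sum_le_card_mul fun w _ => h1 u w
  have e5 : (#S : ℝ) * #(S \ T) ≤ Fintype.card V * #(S \ T) := mul_le_mul_of_nonneg_right (hle S) (Nat.cast_nonneg _)
  have e6 : (#(S \ T) : ℝ) * #T ≤ #(S \ T) * Fintype.card V := mul_le_mul_of_nonneg_left (hle T) (Nat.cast_nonneg _)
  linarith

lemma ind_eq_zero (hH : ∀ e ∈ H, #e = 3) {x y z : V} (h : x = y ∨ x = z ∨ y = z) :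
    ind H x y z = 0 := by
  rw [ind, if_neg]
  intro hc
  have := ne_of_card_triple (hH _ hc)
  tauto

lemma sum_ind_eq_offDiag (hH : ∀ e ∈ H, #e = 3) (v : V) (S : Finset V) :
    ∑ u ∈ S, ∑ w ∈ S, ind H v u w = ∑ p ∈ (S.erase v).offDiag, ind H v p.1 p.2 := by
  rw [← sum_product']
  symm
  refine sum_subset ?_ ?_
  · intro p; simp only [mem_offDiag, mem_erase, mem_product]; tauto
  · intro p hp hp'
    apply ind_eq_zero hH
    simp only [mem_offDiag, mem_erase, mem_product] at hp hp'
    grind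

lemma card_offDiag_erase {v : V} {S : Finset V} (hv : v ∈ S) :
    (#(S.erase v).offDiag : ℝ) = (#S - 1) * (#S - 2) := by
  rw [offDiag_card, card_erase_of_mem hv]
  have h1 : 1 ≤ #S := card_pos.2 ⟨v, hv⟩
  rw [Nat.cast_sub (Nat.le_mul_self _), Nat.cast_mul, Nat.cast_sub h1]
  push_cast
  ring

/-- The degree of a vertex inside a subset, given a bound for its degree. -/
lemma le_sum_ind_inside (hH : ∀ e ∈ H, #e = 3) {v : V} {M : ℝ}
    (hv : ((Fintype.card V : ℝ) - 1) * (Fintype.card V - 2) - M ≤ ∑ u, ∑ w, ind H v u w)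
    {S : Finset V} (hS : v ∈ S) :
    ((#S : ℝ) - 1) * (#S - 2) - M ≤ ∑ u ∈ S, ∑ w ∈ S, ind H v u w := by
  rw [sum_ind_eq_offDiag hH] at hv ⊢
  have h1 : ∑ p ∈ (S.erase v).offDiag, (1 - ind H v p.1 p.2) ≤
      ∑ p ∈ (univ.erase v).offDiag, (1 - ind H v p.1 p.2) :=
    sum_le_sum_of_subset_of_nonneg (offDiag_mono (erase_subset_erase _ (subset_univ _)))
      fun _ _ _ => one_sub_ind_nonneg _ _ _
  rw [sum_sub_distrib, sum_sub_distrib] at h1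
  simp only [sum_const, nsmul_eq_mul, mul_one] at h1
  rw [card_offDiag_erase hS, card_offDiag_erase (mem_univ v), card_univ] at h1
  linarith

lemma exists_of_sum_pos {v : V} {S : Finset V} (h : 0 < ∑ u ∈ S, ∑ w ∈ S, ind H v u w) :
    ∃ u ∈ S, ∃ w ∈ S, ({v, u, w} : Finset V) ∈ H := by
  by_contra! hc
  refine h.ne' (sum_eq_zero fun u hu => sum_eq_zero fun w hw => ?_)
  rw [ind, if_neg (hc u hu w hw)]

/-- Vertices of large degree into `B` can be covered by disjoint edges having their other two
vertices in `B`. -/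
lemma exists_cover (hH : ∀ e ∈ H, #e = 3) {Z B : Finset V} (hZB : Disjoint Z B)
    (hZ : ∀ z ∈ Z, (4 * #Z * Fintype.card V : ℝ) < ∑ u ∈ B, ∑ w ∈ B, ind H z u w) :
    ∃ P ⊆ B, #P = 2 * #Z ∧ HasMatchingIn H (Z ∪ P) #Z := by
  suffices h : ∀ S ⊆ Z, ∃ P ⊆ B, #P = 2 * #S ∧ HasMatchingIn H (S ∪ P) #S from h Z subset_rfl
  intro S
  induction S using Finset.induction_on with
  | empty => exact fun _ => ⟨∅, by simp, by simp, HasMatchingIn.zero⟩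
  | insert z S hz ih =>
    intro hS
    obtain ⟨hzZ, hSZ⟩ := insert_subset_iff.1 hS
    obtain ⟨P, hPB, hP, hM⟩ := ih hSZ
    have h1 := sum_sum_le_add (ind_nonneg (H := H) z) (ind_le_one z) B (B \ P)
    have h2 : #(B \ (B \ P)) = #P := by rw [Finset.sdiff_sdiff_eq_self hPB]
    have h3 : (#P : ℝ) ≤ 2 * #Z := by
      rw [hP]; push_cast
      have : (#S : ℝ) ≤ #Z := by exact_mod_cast card_le_card hSZ
      linarith
    have h4 : (#P : ℝ) * Fintype.card V ≤ 2 * #Z * Fintype.card V := by gcongr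
    rw [h2] at h1
    obtain ⟨u, hu, w, hw, huw⟩ := exists_of_sum_pos (H := H) (v := z) (S := B \ P)
      (by linarith [hZ z hzZ])
    obtain ⟨n1, n2, n3⟩ := ne_of_card_triple (hH _ huw)
    rw [mem_sdiff] at hu hw
    refine ⟨insert u (insert w P), ?_, ?_, ?_⟩
    · simp [insert_subset_iff, hu.1, hw.1, hPB]
    · rw [card_insert_of_notMem (by simp [n3, hu.2]), card_insert_of_notMem hw.2,
        card_insert_of_notMem hz, hP]
      ring
    · rw [card_insert_of_notMem hz]
      refine (hM.union hH (HasMatchingIn.one huw subset_rfl) ?_).mono ?_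
      · have q : ∀ x ∈ B, x ∉ S := fun x hx hxS => disjoint_left.1 hZB (hSZ hxS) hx
        have q' : z ∉ P := fun h => disjoint_left.1 hZB hzZ (hPB h)
        rw [disjoint_right]
        intro x hx
        simp only [mem_insert, mem_singleton] at hx
        rw [mem_union, not_or]
        rcases hx with rfl | rfl | rfl
        exacts [⟨hz, q'⟩, ⟨q _ hu.1, hu.2⟩, ⟨q _ hw.1, hw.2⟩]
      · intro x; simp only [mem_union, mem_insert, mem_singleton]; tauto

/-- Disjoint edges inside a set `B` in which all degrees are small but not too small. -/
lemma hasMatchingIn_sparse (hH : ∀ e ∈ H, #e = 3) {B : Finset V} {t : ℕ} {N Δ : ℝ}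
    (hlow : ∀ v ∈ B, 2 * (t - 1) * N + 2 ≤ ∑ u ∈ B, ∑ w ∈ B, ind H v u w)
    (hup : ∀ v ∈ B, ∑ u ∈ B, ∑ w ∈ B, ind H v u w ≤ Δ) (hB : 0 < #B)
    (hΔ : 9 * Δ < #B * (2 * N)) : HasMatchingIn H B t := by
  refine HasMatchingIn.greedy hH fun U hU => ?_
  by_contra! hc
  have h0 : ∀ x ∈ B, ∀ y ∈ B, ∀ z ∈ B, ind H x y z ≤ (if x ∈ U then ind H x y z else 0) +
      (if y ∈ U then ind H y z x else 0) + (if z ∈ U then ind H z x y else 0) := by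
    intro x hx y hy z hz
    rw [← ind_rotate x y z, ind_rotate z x y]
    by_cases he : ({x, y, z} : Finset V) ∈ H
    · have h1 := hc _ he (by simp [insert_subset_iff, hx, hy, hz])
      have h2 : x ∈ U ∨ y ∈ U ∨ z ∈ U := by
        rw [disjoint_left] at h1
        push Not at h1
        obtain ⟨a, ha, haU⟩ := h1
        simp only [mem_insert, mem_singleton] at ha
        rcases ha with rfl | rfl | rfl <;> tauto
      have h3 := ind_nonneg (H := H) x y z
      split_ifs <;> first | linarith | tauto
    · have : ind H x y z = 0 := by rw [ind, if_neg he]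
      simp [this]
  have key : ∀ x ∈ B, (if x ∈ U then ∑ y ∈ B, ∑ z ∈ B, ind H x y z else 0) ≤
      if x ∈ U then Δ else 0 := fun x hx => by
    split_ifs
    exacts [hup x hx, le_rfl]
  have hΔ0 : 0 ≤ Δ := by
    obtain ⟨x, hx⟩ := card_pos.1 hB
    exact (sum_nonneg fun y _ => sum_nonneg fun z _ => ind_nonneg _ _ _).trans (hup x hx)
  have hsum : ∑ x ∈ B, (if x ∈ U then ∑ y ∈ B, ∑ z ∈ B, ind H x y z else 0) ≤ #U * Δ := by
    refine (sum_le_sum key).trans ?_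
    rw [← sum_filter, sum_const, nsmul_eq_mul]
    gcongr
    intro x hx
    exact (mem_filter.1 hx).2
  have s1 : ∑ x ∈ B, ∑ y ∈ B, ∑ z ∈ B, ind H x y z ≤ 3 * (#U * Δ) := by
    calc _ ≤ ∑ x ∈ B, ∑ y ∈ B, ∑ z ∈ B, ((if x ∈ U then ind H x y z else 0) +
      (if y ∈ U then ind H y z x else 0) + (if z ∈ U then ind H z x y else 0)) :=
          sum_le_sum fun x hx => sum_le_sum fun y hy => sum_le_sum fun z hz => h0 x hx y hy z hz
      _ = 3 * ∑ x ∈ B, (if x ∈ U then ∑ y ∈ B, ∑ z ∈ B, ind H x y z else 0) := by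
          have i1 : ∀ x ∈ B, (if x ∈ U then ∑ y ∈ B, ∑ z ∈ B, ind H x y z else 0) =
              ∑ y ∈ B, ∑ z ∈ B, (if x ∈ U then ind H x y z else 0) := by
            intro x _; split_ifs <;> simp
          rw [sum_congr rfl i1]
          simp only [sum_add_distrib]
          have i2 : ∑ x ∈ B, ∑ y ∈ B, ∑ z ∈ B, (if y ∈ U then ind H y z x else 0) =
              ∑ x ∈ B, ∑ y ∈ B, ∑ z ∈ B, (if x ∈ U then ind H x y z else 0) := by
            rw [sum_comm]
            exact sum_congr rfl fun y _ => sum_comm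
          have i3 : ∑ x ∈ B, ∑ y ∈ B, ∑ z ∈ B, (if z ∈ U then ind H z x y else 0) =
              ∑ x ∈ B, ∑ y ∈ B, ∑ z ∈ B, (if x ∈ U then ind H x y z else 0) := by
            rw [sum_congr rfl fun x _ => sum_comm, sum_comm]
          rw [i2, i3]
          ring
      _ ≤ _ := by gcongr
  have s2 : #B * (2 * (t - 1) * N + 2) ≤ ∑ x ∈ B, ∑ y ∈ B, ∑ z ∈ B, ind H x y z := by
    rw [← nsmul_eq_mul]
    exact card_nsmul_le_sum B _ _ hlow
  have hU' : (#U : ℝ) + 3 ≤ 3 * t := by exact_mod_cast hU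
  have hB' : (0 : ℝ) < #B := by exact_mod_cast hB
  have ht : (0 : ℝ) ≤ t - 1 := by
    have : (0 : ℝ) ≤ #U := by positivity
    linarith
  have s3 : 3 * (#U * Δ) ≤ 3 * ((3 * (t - 1)) * Δ) := by gcongr; linarith
  nlinarith

end Extremal

section Extremal

variable {V : Type*} [Fintype V] [DecidableEq V] {H : Finset (Finset V)}

lemma HasMatchingIn.exists_card (hH : ∀ e ∈ H, #e = 3) {X : Finset V} {k : ℕ}
    (h : HasMatchingIn H X k) : ∃ Y ⊆ X, HasMatchingIn H Y k ∧ #Y = 3 * k ∧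
      ∀ (A : Finset V) (c : ℕ), (∀ e ∈ H, #(e ∩ A) = c) → #(Y ∩ A) = c * k := by
  obtain ⟨M, h1, h2, h3, h4⟩ := h
  refine ⟨M.biUnion id, biUnion_subset.2 h3,
    ⟨M, h1, h2, fun e he => subset_biUnion_of_mem id he, h4⟩, ?_, fun A c hA => ?_⟩
  · rw [card_biUnion h2, sum_congr rfl fun e he => show #(id e) = 3 from hH e (h1 he), sum_const,
      h4, smul_eq_mul, mul_comm]
  · rw [biUnion_inter, card_biUnion, sum_congr rfl fun e he => show #(id e ∩ A) = c from
      hA e (h1 he), sum_const, h4, smul_eq_mul, mul_comm]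
    exact fun e he f hf hef => (h2 he hf hef).mono inter_subset_left inter_subset_left

/-- The extremal case, once a suitable matching of the right size has been set aside. -/
lemma hasMatchingIn_of_setAside (hH : ∀ e ∈ H, #e = 3) {d j : ℕ} {A B G X : Finset V}
    (hd1 : 3 * d ≤ Fintype.card V) (hd2 : Fintype.card V ≤ 3 * d + 1)
    (hn : (10 : ℝ) ^ 12 ≤ Fintype.card V) (hGA : G ⊆ A) (hGB : Disjoint G B)
    (hG : ∀ a ∈ G, ∑ u ∈ B, ∑ w ∈ B, (1 - ind H a u w) ≤ (Fintype.card V : ℝ) ^ 2 / 4000)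
    (hA : ∀ z ∈ A, (Fintype.card V : ℝ) ^ 2 / 4000 ≤ ∑ u ∈ B, ∑ w ∈ B, ind H z u w)
    (hB : ∀ b ∉ A, ∑ u ∈ Bᶜ, ∑ w, (1 - ind H b u w) ≤ (Fintype.card V : ℝ) ^ 2 / 2000)
    (hAG : (#(A \ G) : ℝ) ≤ 2 / 10 ^ 5 * Fintype.card V)
    (hBG : (#(Bᶜ \ G) : ℝ) ≤ 2 / 10 ^ 5 * Fintype.card V)
    (hX : HasMatchingIn H X j) (hXj : #X = 3 * j) (hj : (j : ℝ) ≤ 2 / 10 ^ 5 * Fintype.card V)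
    (hAX : #(A \ X) + j = d) : HasMatchingIn H univ d := by
  set n : ℝ := (Fintype.card V : ℝ) with hn'
  have hn0 : 0 < n := by linarith [show (0 : ℝ) < 10 ^ 12 by positivity]
  set B1 := Aᶜ \ X with hB1
  set Z := (A \ X) \ G with hZ
  set A2 := (A \ X) ∩ G with hA2
  have hZc : (#Z : ℝ) ≤ 2 / 10 ^ 5 * n := by
    refine le_trans ?_ hAG
    exact_mod_cast card_le_card (sdiff_subset_sdiff sdiff_subset subset_rfl)
  have hXc : (#X : ℝ) ≤ 6 / 10 ^ 5 * n := by
    rw [hXj]; push_cast; linarith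
  have hAAX : #(A \ X) = #A2 + #Z := by rw [hA2, hZ, card_inter_add_card_sdiff]
  have hpart : #(A \ X) + #B1 + #X = Fintype.card V := by
    have e1 : Disjoint (A \ X) B1 := by
      rw [disjoint_left]; intro v; simp only [hB1, mem_sdiff, mem_compl]; tauto
    have e2 : Disjoint (A \ X ∪ B1) X := by
      rw [disjoint_left]; intro v; simp only [hB1, mem_sdiff, mem_compl, mem_union]; tauto
    rw [← card_union_of_disjoint e1, ← card_union_of_disjoint e2, ← card_univ]
    congr 1
    ext v; simp only [hB1, mem_sdiff, mem_compl, mem_union, mem_univ, iff_true]; tauto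
  have hZB : Disjoint Z B1 := by
    rw [disjoint_left]; intro v; simp only [hZ, hB1, mem_sdiff, mem_compl]; tauto
  obtain ⟨P, hPB, hP, hM⟩ := exists_cover hH hZB (by
    intro z hz
    have hzA : z ∈ A := (mem_sdiff.1 (mem_sdiff.1 hz).1).1
    have e1 := hA z hzA
    have e2 := sum_sum_le_add (ind_nonneg (H := H) z) (ind_le_one z) B B1
    have e3 : (#(B \ B1) : ℝ) ≤ 8 / 10 ^ 5 * n := by
      have e4 : B \ B1 ⊆ (A \ G) ∪ X := by
        intro v
        have : v ∈ G → v ∉ B := fun h => disjoint_left.1 hGB h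
        simp only [hB1, mem_sdiff, mem_union, mem_compl]
        tauto
      have e5 : (#(B \ B1) : ℝ) ≤ #(A \ G) + #X := by
        exact_mod_cast (card_le_card e4).trans (card_union_le _ _)
      linarith
    have e6 : #(B \ B1) * n ≤ 8 / 10 ^ 5 * n * n := by gcongr
    have e7 : #Z * n ≤ 2 / 10 ^ 5 * n * n := by gcongr
    rw [← hn'] at e2 ⊢
    have : 0 < n ^ 2 := by positivity
    nlinarith)
  set B2 := B1 \ P with hB2
  have hB2c : #B2 + 2 * #Z = #B1 := by rw [hB2, ← hP, card_sdiff_add_card_eq_card hPB]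
  have hA2c : n / 4 ≤ #A2 := by
    have e1 : (#A2 : ℝ) + #Z + j = d := by exact_mod_cast (by omega : #A2 + #Z + j = d)
    have e2 : n ≤ 3 * d + 1 := by rw [hn']; exact_mod_cast hd2
    linarith
  have hfin := hasMatchingIn_bipartite (A := A2) (B := B2) (n := n) hH
    (by rw [disjoint_left]; intro v; simp only [hA2, hB2, hB1, mem_inter, mem_sdiff, mem_compl]
        tauto)
    (by omega) (by linarith) hA2c
    (by
      intro a ha
      have haG : a ∈ G := (mem_inter.1 ha).2
      have e1 := hG a haG
      have e2 := sum_sum_le_add (one_sub_ind_nonneg (H := H) a)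
        (fun u w => by linarith [ind_nonneg (H := H) a u w]) B2 B
      have e3 : (#(B2 \ B) : ℝ) ≤ 2 / 10 ^ 5 * n := by
        refine le_trans ?_ hBG
        refine Nat.cast_le.2 (card_le_card ?_)
        intro v
        have := @hGA v
        simp only [hB2, hB1, mem_sdiff, mem_compl]
        tauto
      have e4 : #(B2 \ B) * n ≤ 2 / 10 ^ 5 * n * n := by gcongr
      rw [← hn'] at e2
      have : 0 < n ^ 2 := by positivity
      nlinarith)
    (by
      intro b hb
      have hbA : b ∉ A := by
        simp only [hB2, hB1, mem_sdiff, mem_compl] at hb; tauto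
      have e1 := hB b hbA
      have e2 : ∑ u ∈ A2, ∑ w ∈ B2, (1 - ind H b u w) ≤ ∑ u ∈ Bᶜ, ∑ w, (1 - ind H b u w) := by
        refine (sum_le_sum fun u _ => sum_le_sum_of_subset_of_nonneg (subset_univ _) fun _ _ _ =>
          one_sub_ind_nonneg _ _ _).trans ?_
        refine sum_le_sum_of_subset_of_nonneg ?_ fun _ _ _ => sum_nonneg fun _ _ =>
          one_sub_ind_nonneg _ _ _
        intro v hv
        exact mem_compl.2 (disjoint_left.1 hGB (mem_inter.1 hv).2)
      have : 0 < n ^ 2 := by positivity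
      linarith)
  have D1 : Disjoint X (Z ∪ P) := by
    rw [disjoint_left]; intro v
    have := @hPB v
    simp only [hB1, hZ, mem_union, mem_sdiff, mem_compl] at this ⊢
    tauto
  have D2 : Disjoint (X ∪ (Z ∪ P)) (A2 ∪ B2) := by
    rw [disjoint_left]; intro v
    have := @hPB v
    simp only [hB2, hA2, hB1, hZ, mem_union, mem_sdiff, mem_compl, mem_inter] at this ⊢
    tauto
  have := ((hX.union hH hM D1).union hH hfin D2).mono (subset_univ _)
  rwa [show j + #Z + #A2 = d by omega] at this

set_option maxHeartbeats 2000000 in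
open Classical in
lemma hasMatchingIn_of_sparse (hH : ∀ e ∈ H, #e = 3) {d : ℕ}
    (hd1 : 3 * d ≤ Fintype.card V) (hd2 : Fintype.card V ≤ 3 * d + 1)
    (hn : (10 : ℝ) ^ 12 ≤ Fintype.card V)
    (hdeg : ∀ v, ((Fintype.card V : ℝ) - 1) * (Fintype.card V - 2) -
      (((Fintype.card V : ℝ) - d) * (Fintype.card V - d - 1) - 2) ≤ ∑ u, ∑ w, ind H v u w)
    {B₀ : Finset V} (hB₀ : Fintype.card V ≤ #B₀ + d)
    (hsp : ∑ x ∈ B₀, ∑ y ∈ B₀, ∑ z ∈ B₀, ind H x y z ≤ (Fintype.card V : ℝ) ^ 3 / 10 ^ 9) :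
    HasMatchingIn H univ d := by
  obtain ⟨B, hBB₀, hBc⟩ := exists_subset_card_eq (show Fintype.card V - d ≤ #B₀ by omega)
  have hBn : #B + d = Fintype.card V := by omega
  have hsp' : ∑ x ∈ B, ∑ y ∈ B, ∑ z ∈ B, ind H x y z ≤ (Fintype.card V : ℝ) ^ 3 / 10 ^ 9 := by
    refine le_trans ?_ hsp
    refine (sum_le_sum fun x _ => (sum_le_sum fun y _ => sum_le_sum_of_subset_of_nonneg hBB₀
      fun _ _ _ => ind_nonneg _ _ _).trans (sum_le_sum_of_subset_of_nonneg hBB₀ fun _ _ _ =>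
        sum_nonneg fun _ _ => ind_nonneg _ _ _)).trans ?_
    exact sum_le_sum_of_subset_of_nonneg hBB₀ fun _ _ _ => sum_nonneg fun _ _ =>
      sum_nonneg fun _ _ => ind_nonneg _ _ _
  clear hsp hBB₀ hB₀
  set n : ℝ := (Fintype.card V : ℝ) with hn'
  have hn0 : 0 < n := by linarith [show (0 : ℝ) < 10 ^ 12 by positivity]
  have hNd : (#B : ℝ) = n - d := by
    rw [hn', ← hBn]; push_cast; ring
  have hd1' : 3 * (d : ℝ) ≤ n := by rw [hn']; exact_mod_cast hd1
  have hd2' : n ≤ 3 * (d : ℝ) + 1 := by rw [hn']; exact_mod_cast hd2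
  have hd0 : (0 : ℝ) ≤ d := by positivity
  set N : ℝ := n - d with hN
  -- the pairs not inside `B`
  have htot : ∀ v, ∑ u, ∑ w, (1 - ind H v u w) ≤ N ^ 2 + 3 * n := by
    intro v
    have := hdeg v
    simp only [sum_sub_distrib, sum_const, card_univ, nsmul_eq_mul, mul_one, ← hn']
    nlinarith
  have hin : ∀ v, ∑ u ∈ B, ∑ w ∈ B, (1 - ind H v u w) =
      N ^ 2 - ∑ u ∈ B, ∑ w ∈ B, ind H v u w := by
    intro v
    simp only [sum_sub_distrib, sum_const, nsmul_eq_mul, mul_one, hNd]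
    ring
  have hsplit : ∀ v, ∑ u ∈ Bᶜ, ∑ w, (1 - ind H v u w) + ∑ u ∈ B, ∑ w ∈ Bᶜ, (1 - ind H v u w) ≤
      ∑ u ∈ B, ∑ w ∈ B, ind H v u w + 3 * n := by
    intro v
    have h1 := htot v
    rw [← sum_add_sum_compl B] at h1
    have h2 : ∑ u ∈ B, ∑ w, (1 - ind H v u w) = ∑ u ∈ B, ∑ w ∈ B, (1 - ind H v u w) +
        ∑ u ∈ B, ∑ w ∈ Bᶜ, (1 - ind H v u w) := by
      rw [← sum_add_distrib]
      exact sum_congr rfl fun u _ => (sum_add_sum_compl B _).symm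
    rw [h2, hin] at h1
    linarith
  have hnn0 : ∀ (v : V) (S T : Finset V), 0 ≤ ∑ u ∈ S, ∑ w ∈ T, (1 - ind H v u w) :=
    fun v S T => sum_nonneg fun _ _ => sum_nonneg fun _ _ => one_sub_ind_nonneg _ _ _
  have hin0 : ∀ (v : V) (S T : Finset V), 0 ≤ ∑ u ∈ S, ∑ w ∈ T, ind H v u w :=
    fun v S T => sum_nonneg fun _ _ => sum_nonneg fun _ _ => ind_nonneg _ _ _
  set A : Finset V := {v | n ^ 2 / 4000 ≤ ∑ u ∈ B, ∑ w ∈ B, ind H v u w} with hA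
  set G : Finset V := {v ∈ Bᶜ | ∑ u ∈ B, ∑ w ∈ B, (1 - ind H v u w) ≤ n ^ 2 / 4000} with hG
  have hNn : 2 / 3 * n ≤ N := by linarith
  have hGA : G ⊆ A := by
    intro v hv
    rw [hG, mem_filter, hin] at hv
    rw [hA, mem_filter]
    refine ⟨mem_univ _, ?_⟩
    nlinarith [hv.2]
  have hGB : Disjoint G B := by
    rw [disjoint_left]
    intro v hv
    exact mem_compl.1 (mem_filter.1 hv).1
  have hn3 : 0 < n ^ 2 / 4000 := by positivity
  have hn2 : n * 10 ^ 12 ≤ n ^ 2 := by nlinarith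
  have hn23 : 10 ^ 12 * n ^ 2 ≤ n ^ 3 := by nlinarith [sq_nonneg n]
  -- few vertices of `B` are in `A`
  have hBA : (#(B ∩ A) : ℝ) ≤ 4 / 10 ^ 6 * n := by
    have h1 : #(B ∩ A) * (n ^ 2 / 4000) ≤ ∑ x ∈ B ∩ A, ∑ y ∈ B, ∑ z ∈ B, ind H x y z := by
      rw [← nsmul_eq_mul]
      exact card_nsmul_le_sum _ _ _ fun x hx => (mem_filter.1 (mem_inter.1 hx).2).2
    have h2 : ∑ x ∈ B ∩ A, ∑ y ∈ B, ∑ z ∈ B, ind H x y z ≤ n ^ 3 / 10 ^ 9 :=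
      (sum_le_sum_of_subset_of_nonneg inter_subset_left fun _ _ _ => hin0 _ _ _).trans hsp'
    refine le_of_mul_le_mul_right ?_ hn3
    calc _ ≤ _ := h1
      _ ≤ _ := h2
      _ = _ := by ring
  have hBG : (#(Bᶜ \ G) : ℝ) ≤ 8 / 10 ^ 6 * n := by
    have h1 : #(Bᶜ \ G) * (n ^ 2 / 4000) ≤
        ∑ x ∈ Bᶜ \ G, ∑ y ∈ B, ∑ z ∈ B, (1 - ind H x y z) := by
      rw [← nsmul_eq_mul]
      refine card_nsmul_le_sum _ _ _ fun x hx => ?_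
      rw [mem_sdiff, hG, mem_filter, not_and, not_le] at hx
      exact (hx.2 hx.1).le
    have h2 : ∑ x ∈ Bᶜ \ G, ∑ y ∈ B, ∑ z ∈ B, (1 - ind H x y z) ≤
        ∑ x ∈ Bᶜ, ∑ y ∈ B, ∑ z ∈ B, (1 - ind H x y z) :=
      sum_le_sum_of_subset_of_nonneg sdiff_subset fun _ _ _ => hnn0 _ _ _
    have h3 : ∑ x ∈ Bᶜ, ∑ y ∈ B, ∑ z ∈ B, (1 - ind H x y z) =
        ∑ y ∈ B, ∑ z ∈ B, ∑ x ∈ Bᶜ, (1 - ind H y z x) := by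
      rw [sum_comm]
      refine sum_congr rfl fun y _ => ?_
      rw [sum_comm]
      simp_rw [ind_rotate]
    have h4 : ∑ y ∈ B, ∑ z ∈ B, ∑ x ∈ Bᶜ, (1 - ind H y z x) ≤
        ∑ y ∈ B, (∑ u ∈ B, ∑ w ∈ B, ind H y u w + 3 * n) :=
      sum_le_sum fun y _ => by linarith [hsplit y, hnn0 y Bᶜ univ]
    rw [sum_add_distrib, sum_const, nsmul_eq_mul, hNd] at h4
    have h5 : N * (3 * n) ≤ n * (3 * n) := by gcongr; linarith
    refine le_of_mul_le_mul_right ?_ hn3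
    calc _ ≤ _ := h1
      _ ≤ n ^ 3 / 10 ^ 9 + n * (3 * n) := by linarith
      _ ≤ 2 * (n ^ 3 / 10 ^ 9) := by norm_num at *; nlinarith
      _ = _ := by ring
  have hAG : (#(A \ G) : ℝ) ≤ 2 / 10 ^ 5 * n := by
    have h1 : A \ G ⊆ (B ∩ A) ∪ (Bᶜ \ G) := by
      intro v
      simp only [mem_sdiff, mem_union, mem_inter, mem_compl]
      tauto
    have h2 : (#(A \ G) : ℝ) ≤ #(B ∩ A) + #(Bᶜ \ G) := by
      exact_mod_cast (card_le_card h1).trans (card_union_le _ _)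
    linarith
  have hBc' : #Bᶜ = d := by rw [card_compl]; omega
  have hAd1 : #A ≤ d + #(B ∩ A) := by
    have h1 : A ⊆ Bᶜ ∪ (B ∩ A) := by
      intro v; simp only [mem_union, mem_inter, mem_compl]; tauto
    have := (card_le_card h1).trans (card_union_le _ _)
    omega
  have hAd2 : d ≤ #A + #(Bᶜ \ G) := by
    have h1 : Bᶜ ⊆ A ∪ (Bᶜ \ G) := by
      intro v
      have := @hGA v
      simp only [mem_union, mem_sdiff, mem_compl]; tauto
    have := (card_le_card h1).trans (card_union_le _ _)
    omega
  have hAm : ∀ z ∈ A, n ^ 2 / 4000 ≤ ∑ u ∈ B, ∑ w ∈ B, ind H z u w := fun z hz =>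
    (mem_filter.1 hz).2
  have hAm' : ∀ z ∉ A, ∑ u ∈ B, ∑ w ∈ B, ind H z u w ≤ n ^ 2 / 4000 := fun z hz => by
    rw [hA, mem_filter, not_and, not_le] at hz
    exact (hz (mem_univ _)).le
  have hBm : ∀ b ∉ A, ∑ u ∈ Bᶜ, ∑ w, (1 - ind H b u w) ≤ n ^ 2 / 2000 := by
    intro b hb
    have h1 := hAm' b hb
    linarith [hsplit b, hnn0 b B Bᶜ]
  have final : ∀ (j : ℕ) (X : Finset V), (j : ℝ) ≤ 8 / 10 ^ 6 * n → HasMatchingIn H X j →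
      #X = 3 * j → #(A \ X) + j = d → HasMatchingIn H univ d := fun j X hj hX hXj hAX =>
    hasMatchingIn_of_setAside hH hd1 hd2 hn hGA hGB (fun a ha => (mem_filter.1 ha).2) hAm hBm hAG
      (by rw [← hn']; linarith) hX hXj (by rw [← hn']; linarith) hAX
  rcases le_total (#A) d with hAd | hAd
  · obtain ⟨t, ht⟩ := Nat.exists_eq_add_of_le hAd
    have htn : (t : ℝ) ≤ 8 / 10 ^ 6 * n := by
      refine le_trans ?_ hBG
      exact_mod_cast (by omega : t ≤ #(Bᶜ \ G))
    have hAcn : #Aᶜ = #B + t := by rw [card_compl]; omega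
    have hAc' : (#Aᶜ : ℝ) = N + t := by rw [hAcn]; push_cast; rw [hNd]
    have ht0 : (0 : ℝ) ≤ t := by positivity
    have hm := hasMatchingIn_sparse hH (B := Aᶜ) (t := t) (N := N)
      (Δ := n ^ 2 / 4000 + 2 * (8 / 10 ^ 6 * n) * n)
      (fun v hv => by
        have h1 := le_sum_ind_inside hH (hdeg v) hv
        rw [hAc'] at h1
        have h2 : (0 : ℝ) ≤ (t - 1) * (t - 2) := by
          rcases t with _ | _ | t
          · norm_num
          · norm_num
          · push_cast
            have : (0 : ℝ) ≤ t := by positivity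
            nlinarith
        nlinarith)
      (fun v hv => by
        have h1 := hAm' v (mem_compl.1 hv)
        have h2 := sum_sum_le_add (ind_nonneg (H := H) v) (ind_le_one v) Aᶜ B
        have h3 : (#(Aᶜ \ B) : ℝ) ≤ 8 / 10 ^ 6 * n := by
          refine le_trans ?_ hBG
          refine Nat.cast_le.2 (card_le_card ?_)
          intro x
          have := @hGA x
          simp only [mem_sdiff, mem_compl]
          tauto
        rw [← hn'] at h2
        have h4 : 2 * #(Aᶜ \ B) * n ≤ 2 * (8 / 10 ^ 6 * n) * n := by gcongr
        linarith)
      (by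
        have : (0 : ℝ) < #Aᶜ := by rw [hAc']; linarith
        exact_mod_cast this)
      (by rw [hAc']; nlinarith)
    obtain ⟨Y, hYA, hY, hYc, -⟩ := hm.exists_card hH
    refine final t Y htn hY hYc ?_
    have : A \ Y = A := by
      rw [Finset.sdiff_eq_self_iff_disjoint, disjoint_left]
      intro v hv hv'
      exact mem_compl.1 (hYA hv') hv
    rw [this]; omega
  · obtain ⟨s, hs⟩ := Nat.exists_eq_add_of_le hAd
    have hsn : (s : ℝ) ≤ 4 / 10 ^ 6 * n := by
      refine le_trans ?_ hBA
      exact_mod_cast (by omega : s ≤ #(B ∩ A))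
    set H2 : Finset (Finset V) := {e ∈ H | #(e ∩ A) = 2} with hH2
    have hH2H : H2 ⊆ H := filter_subset _ _
    have hm : HasMatchingIn H2 univ s := by
      refine HasMatchingIn.greedy (fun e he => hH e (hH2H he)) fun U hU => ?_
      have hUn : (#U : ℝ) ≤ 12 / 10 ^ 6 * n := by
        have : (#U : ℝ) + 3 ≤ 3 * s := by exact_mod_cast hU
        linarith
      obtain ⟨b, hb, hbU⟩ : ∃ b ∈ Aᶜ, b ∉ U := by
        apply exists_mem_notMem_of_card_lt_card
        have h1 : #A + #Aᶜ = Fintype.card V := card_add_card_compl A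
        have h2 : (#A : ℝ) + #Aᶜ = n := by rw [hn']; exact_mod_cast h1
        have h3 : (#A : ℝ) = d + s := by rw [hs]; push_cast; rfl
        have : (#U : ℝ) < #Aᶜ := by linarith
        exact_mod_cast this
      rw [mem_compl] at hb
      obtain ⟨x, hx, y, hy, hxy⟩ : ∃ x ∈ G \ U, ∃ y ∈ G \ U, ({b, x, y} : Finset V) ∈ H := by
        apply exists_of_sum_pos
        have h1 : ∑ u ∈ G \ U, ∑ w ∈ G \ U, (1 - ind H b u w) ≤
            ∑ u ∈ Bᶜ, ∑ w, (1 - ind H b u w) := by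
          refine (sum_le_sum fun u _ => sum_le_sum_of_subset_of_nonneg (subset_univ _)
            fun _ _ _ => one_sub_ind_nonneg _ _ _).trans ?_
          exact sum_le_sum_of_subset_of_nonneg (sdiff_subset.trans (filter_subset _ _))
            fun _ _ _ => sum_nonneg fun _ _ => one_sub_ind_nonneg _ _ _
        have h2 := hBm b hb
        simp only [sum_sub_distrib, sum_const, nsmul_eq_mul, mul_one] at h1 h2
        have h3 : n / 4 ≤ #(G \ U) := by
          have h4 : Bᶜ ⊆ (G \ U) ∪ U ∪ (Bᶜ \ G) := by
            intro v; simp only [mem_union, mem_sdiff, mem_compl]; tauto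
          have h5 := (card_le_card h4).trans ((card_union_le _ _).trans
            (Nat.add_le_add_right (card_union_le _ _) _))
          rw [hBc'] at h5
          have : (d : ℝ) ≤ #(G \ U) + #U + #(Bᶜ \ G) := by exact_mod_cast h5
          linarith
        have h6 : n / 4 * (n / 4) ≤ #(G \ U) * #(G \ U) := by gcongr
        nlinarith
      obtain ⟨n1, n2, n3⟩ := ne_of_card_triple (hH _ hxy)
      rw [mem_sdiff] at hx hy
      refine ⟨_, mem_filter.2 ⟨hxy, ?_⟩, subset_univ _, ?_⟩
      · rw [card_eq_two]
        refine ⟨x, y, n3, ?_⟩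
        ext v
        simp only [mem_inter, mem_insert, mem_singleton]
        constructor
        · rintro ⟨rfl | h | h, hv⟩
          exacts [absurd hv hb, Or.inl h, Or.inr h]
        · rintro (rfl | rfl)
          exacts [⟨by tauto, hGA hx.1⟩, ⟨by tauto, hGA hy.1⟩]
      · rw [disjoint_left]
        intro v hv
        simp only [mem_insert, mem_singleton] at hv
        rcases hv with rfl | rfl | rfl
        exacts [hbU, hx.2, hy.2]
    obtain ⟨Y, -, hY, hYc, hYA⟩ := hm.exists_card fun e he => hH e (hH2H he)
    refine final s Y (by linarith) (hY.mono_left hH2H) hYc ?_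
    have h1 := hYA A 2 fun e he => (mem_filter.1 he).2
    have h2 := card_sdiff_add_card_inter A Y
    rw [inter_comm] at h2
    omega

end Extremal

/-- `S` together with the triple `x y z` contains four disjoint edges, provided that the triple is
disjoint from `S`. -/
def AbsorbsTriple {V : Type*} [DecidableEq V] (H : Finset (Finset V)) (S : Finset V) (x y z : V) : Prop :=
  #({x, y, z} : Finset V) = 3 → Disjoint {x, y, z} S → HasMatchingIn H (S ∪ {x, y, z}) 4

section Absorbing

variable {V : Type*} [DecidableEq V] {H : Finset (Finset V)}

lemma mem_of_ind_pos {x y z : V} (h : 0 < ind H x y z) : ({x, y, z} : Finset V) ∈ H := by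
  unfold ind at h
  by_contra hc
  simp [hc] at h

lemma hasMatchingIn_biUnion (hH : ∀ e ∈ H, #e = 3) {J : Finset (Finset V)} {k : ℕ}
    (hJ : (J : Set (Finset V)).PairwiseDisjoint id) (h : ∀ S ∈ J, HasMatchingIn H S k) :
    HasMatchingIn H (J.biUnion id) (k * #J) := by
  induction J using Finset.induction_on with
  | empty => exact HasMatchingIn.zero
  | insert S J hS ih =>
    have h1 := ih (hJ.subset (by simp)) fun T hT => h T (mem_insert_of_mem hT)
    rw [biUnion_insert, card_insert_of_notMem hS, mul_add, mul_one, add_comm]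
    refine (h S (mem_insert_self _ _)).union hH h1 ?_
    rw [disjoint_biUnion_right]
    intro T hT
    exact hJ (by simp) (by simp [hT]) (fun hc => hS (by rwa [hc]))

open Classical in
/-- Absorb triples of the leftover `L` one at a time. -/
lemma hasMatchingIn_absorb (hH : ∀ e ∈ H, #e = 3) {k : ℕ} {J : Finset (Finset V)} {L : Finset V}
    (hJ : (J : Set (Finset V)).PairwiseDisjoint id) (h : ∀ S ∈ J, HasMatchingIn H S 3)
    (hL : Disjoint L (J.biUnion id)) (hk : 3 * k ≤ #L)
    (hA : ∀ x y z, k ≤ #{S ∈ J | AbsorbsTriple H S x y z}) :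
    HasMatchingIn H (L ∪ J.biUnion id) (3 * #J + k) := by
  induction k generalizing J L with
  | zero => exact (hasMatchingIn_biUnion hH hJ h).mono subset_union_right
  | succ k ih =>
    obtain ⟨T, hTL, hT⟩ := exists_subset_card_eq (show 3 ≤ #L by omega)
    obtain ⟨x, y, z, -, -, -, rfl⟩ := card_eq_three.1 hT
    have h1 : 0 < #{S ∈ J | AbsorbsTriple H S x y z} := by have := hA x y z; omega
    obtain ⟨S, hS⟩ := card_pos.1 h1
    obtain ⟨hSJ, hS⟩ := mem_filter.1 hS
    have hLS : ∀ R ∈ J, Disjoint L R := (disjoint_biUnion_right _ _ _).1 hL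
    have h4 : HasMatchingIn H (S ∪ {x, y, z}) 4 := hS hT ((hLS S hSJ).mono_left hTL)
    have h5 := ih (J := J.erase S) (L := L \ {x, y, z})
      (hJ.subset (by exact_mod_cast erase_subset _ _)) (fun R hR => h R (mem_of_mem_erase hR))
      (by
        rw [disjoint_biUnion_right]
        exact fun R hR => (hLS R (mem_of_mem_erase hR)).mono_left sdiff_subset)
      (by rw [card_sdiff_of_subset hTL]; omega)
      (fun a b c => by
        have := hA a b c
        rw [filter_erase]
        have := pred_card_le_card_erase (s := {S ∈ J | AbsorbsTriple H S a b c}) (a := S)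
        omega)
    have h6 : Disjoint (S ∪ {x, y, z}) ((L \ {x, y, z}) ∪ (J.erase S).biUnion id) := by
      rw [disjoint_union_left, disjoint_union_right, disjoint_union_right]
      refine ⟨⟨((hLS S hSJ).mono_left sdiff_subset).symm, ?_⟩, disjoint_sdiff, ?_⟩
      · rw [disjoint_biUnion_right]
        intro R hR
        exact hJ (by exact_mod_cast hSJ) (by exact_mod_cast mem_of_mem_erase hR)
          (ne_of_mem_erase hR).symm
      · rw [disjoint_biUnion_right]
        exact fun R hR => (hLS R (mem_of_mem_erase hR)).mono_left hTL
    have h7 := h4.union hH h5 h6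
    have hc : 4 + (3 * #(J.erase S) + k) = 3 * #J + (k + 1) := by
      rw [card_erase_of_mem hSJ]
      have := card_pos.2 ⟨S, hSJ⟩
      omega
    rw [hc] at h7
    refine h7.mono ?_
    have hSs : S ⊆ J.biUnion id := subset_biUnion_of_mem id hSJ
    have hJs : (J.erase S).biUnion id ⊆ J.biUnion id :=
      biUnion_subset_biUnion_of_subset_left _ (erase_subset _ _)
    exact union_subset (union_subset (hSs.trans subset_union_right) (hTL.trans subset_union_left))
      (union_subset (sdiff_subset.trans subset_union_left) (hJs.trans subset_union_right))

variable [Fintype V]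

/-- Some pair in the link of `y` lies in the links of a positive proportion of the vertices
`π t`, weighted by `w t`. -/
lemma exists_common_pair (hn : (10 : ℝ) ^ 12 ≤ Fintype.card V)
    (hdeg : ∀ x, 5 / 9 * (Fintype.card V : ℝ) ^ 2 - 4 * Fintype.card V ≤ ∑ u, ∑ v, ind H x u v)
    {W : Finset V} (hW : (#W : ℝ) ≤ (Fintype.card V : ℝ) / 10 ^ 4)
    {α : Type*} [Fintype α] (π : α → V) (w : α → ℝ) (hw : ∀ t, 0 ≤ w t) (hw' : 0 < ∑ t, w t)
    (y : V) : ∃ u v, u ∉ W ∧ v ∉ W ∧ ({y, u, v} : Finset V) ∈ H ∧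
      1 / 10 * ∑ t, w t ≤ ∑ t, w t * ind H (π t) u v := by
  set n : ℝ := (Fintype.card V : ℝ) with hn'
  have hn0 : 0 < n := by linarith [show (0 : ℝ) < 10 ^ 12 by positivity]
  have common : ∀ x, n ^ 2 / 10 ≤ ∑ u ∈ Wᶜ, ∑ v ∈ Wᶜ, ind H y u v * ind H x u v := by
    intro x
    have e1 := sum_sum_le_add (g := fun u v => ind H y u v * ind H x u v)
      (fun u v => mul_nonneg (ind_nonneg _ _ _) (ind_nonneg _ _ _))
      (fun u v => mul_le_one₀ (ind_le_one _ _ _) (ind_nonneg _ _ _) (ind_le_one _ _ _)) univ Wᶜ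
    rw [← compl_eq_univ_sdiff, compl_compl, ← hn'] at e1
    have e2 : ∑ u, ∑ v, (ind H y u v + ind H x u v - 1) ≤ ∑ u, ∑ v, ind H y u v * ind H x u v := by
      gcongr with u _ v _
      nlinarith [ind_le_one (H := H) y u v, ind_le_one (H := H) x u v]
    simp only [sum_sub_distrib, sum_add_distrib, sum_const, card_univ, nsmul_eq_mul, mul_one] at e2
    rw [← hn'] at e2
    have e3 := hdeg x
    have e4 := hdeg y
    nlinarith
  have h1 : n ^ 2 / 10 * ∑ t, w t ≤
      ∑ p ∈ Wᶜ ×ˢ Wᶜ, ind H y p.1 p.2 * ∑ t, w t * ind H (π t) p.1 p.2 := by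
    calc n ^ 2 / 10 * ∑ t, w t
        ≤ ∑ t, w t * ∑ p ∈ Wᶜ ×ˢ Wᶜ, ind H y p.1 p.2 * ind H (π t) p.1 p.2 := by
          rw [mul_sum]
          refine sum_le_sum fun t _ => ?_
          rw [mul_comm, sum_product]
          exact mul_le_mul_of_nonneg_left (common _) (hw t)
      _ = _ := by
          simp only [mul_sum]
          rw [sum_comm]
          exact sum_congr rfl fun p _ => sum_congr rfl fun t _ => by ring
  have hc : (#(Wᶜ ×ˢ Wᶜ) : ℝ) ≤ n ^ 2 := by
    rw [card_product, Nat.cast_mul, sq]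
    have : (#Wᶜ : ℝ) ≤ n := by rw [hn']; exact_mod_cast card_le_univ _
    gcongr
  obtain ⟨p, hp, h2⟩ : ∃ p ∈ Wᶜ ×ˢ Wᶜ,
      1 / 10 * ∑ t, w t ≤ ind H y p.1 p.2 * ∑ t, w t * ind H (π t) p.1 p.2 := by
    refine exists_le_of_sum_le ?_ (le_trans ?_ h1)
    · rw [nonempty_iff_ne_empty]
      intro he
      rw [he, sum_empty] at h1
      have : 0 < n ^ 2 / 10 * ∑ t, w t := by positivity
      linarith
    · rw [sum_const, nsmul_eq_mul]
      have : (#(Wᶜ ×ˢ Wᶜ) : ℝ) * (1 / 10 * ∑ t, w t) ≤ n ^ 2 * (1 / 10 * ∑ t, w t) := by gcongr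
      linarith
  have h0 : 0 ≤ ∑ t, w t * ind H (π t) p.1 p.2 :=
    sum_nonneg fun t _ => mul_nonneg (hw t) (ind_nonneg _ _ _)
  have hpos : 0 < ind H y p.1 p.2 := by
    by_contra hc
    have : ind H y p.1 p.2 = 0 := le_antisymm (not_lt.1 hc) (ind_nonneg _ _ _)
    rw [this] at h2
    linarith
  simp only [mem_product, mem_compl] at hp
  refine ⟨p.1, p.2, hp.1, hp.2, mem_of_ind_pos hpos, h2.trans ?_⟩
  exact mul_le_of_le_one_left h0 (ind_le_one _ _ _)

lemma absorbs_of_edges (hH : ∀ e ∈ H, #e = 3) {Y P Q R : Finset V} {x y z : V}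
    (hY : Y ∈ H) (hP : insert x P ∈ H) (hQ : insert y Q ∈ H) (hR : insert z R ∈ H)
    (hYP : Disjoint Y P) (hYPQ : Disjoint (Y ∪ P) Q) (hYPQR : Disjoint (Y ∪ P ∪ Q) R) :
    AbsorbsTriple H (Y ∪ P ∪ Q ∪ R) x y z := by
  intro hT hd
  obtain ⟨hxy, hxz, hyz⟩ := ne_of_card_triple hT
  simp only [disjoint_insert_left, disjoint_singleton_left, mem_union, not_or] at hd
  simp only [disjoint_union_left] at hYPQ hYPQR
  have h1 := HasMatchingIn.one hY subset_rfl
  have h2 := h1.union hH (HasMatchingIn.one hP subset_rfl) (by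
    rw [disjoint_insert_right]; tauto)
  have h3 := h2.union hH (HasMatchingIn.one hQ subset_rfl) (by
    simp only [disjoint_insert_right, disjoint_union_left, disjoint_insert_left, mem_union,
      mem_insert]
    tauto)
  have h4 := h3.union hH (HasMatchingIn.one hR subset_rfl) (by
    simp only [disjoint_insert_right, disjoint_union_left, disjoint_insert_left, mem_union,
      mem_insert]
    have := hxz.symm
    have := hyz.symm
    tauto)
  refine h4.mono ?_
  intro v
  simp only [mem_union, mem_insert, mem_singleton]
  tauto

lemma hasMatchingIn_of_edges (hH : ∀ e ∈ H, #e = 3) {P Q R : Finset V} {x y z : V}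
    (hT : #({x, y, z} : Finset V) = 3)
    (hP : insert x P ∈ H) (hQ : insert y Q ∈ H) (hR : insert z R ∈ H)
    (hYP : Disjoint {x, y, z} P) (hYPQ : Disjoint ({x, y, z} ∪ P) Q)
    (hYPQR : Disjoint ({x, y, z} ∪ P ∪ Q) R) :
    HasMatchingIn H ({x, y, z} ∪ P ∪ Q ∪ R) 3 := by
  obtain ⟨hxy, hxz, hyz⟩ := ne_of_card_triple hT
  simp only [disjoint_union_left, disjoint_insert_left, disjoint_singleton_left]
    at hYP hYPQ hYPQR
  have h2 := (HasMatchingIn.one hP subset_rfl).union hH (HasMatchingIn.one hQ subset_rfl) (by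
    simp only [disjoint_insert_right, disjoint_insert_left, mem_insert]
    have := hxy.symm
    tauto)
  have h3 := h2.union hH (HasMatchingIn.one hR subset_rfl) (by
    simp only [disjoint_insert_right, disjoint_union_left, disjoint_insert_left, mem_union,
      mem_insert]
    have := hxz.symm
    have := hyz.symm
    tauto)
  refine h3.mono ?_
  intro v
  simp only [mem_union, mem_insert, mem_singleton]
  tauto

open Classical in
/-- There is a set of nine vertices that absorbs a positive proportion of the weighted triples. -/
lemma exists_absorber (hH : ∀ e ∈ H, #e = 3) (hn : (10 : ℝ) ^ 12 ≤ Fintype.card V)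
    (hdeg : ∀ x, 5 / 9 * (Fintype.card V : ℝ) ^ 2 - 4 * Fintype.card V ≤ ∑ u, ∑ v, ind H x u v)
    {W : Finset V} (hW : (#W : ℝ) ≤ (Fintype.card V : ℝ) / 10 ^ 5)
    (w : V × V × V → ℝ) (hw : ∀ t, 0 ≤ w t) (hw' : 0 < ∑ t, w t) :
    ∃ S, Disjoint S W ∧ #S ≤ 9 ∧ HasMatchingIn H S 3 ∧
      1 / 1000 * ∑ t, w t ≤ ∑ t with AbsorbsTriple H S t.1 t.2.1 t.2.2, w t := by
  set n : ℝ := (Fintype.card V : ℝ) with hn'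
  have hn1 : (10 : ℝ) ^ 12 ≤ n := hn
  have small : ∀ U : Finset V, #U ≤ 9 → (#(W ∪ U) : ℝ) ≤ n / 10 ^ 4 := by
    intro U hU
    have h1 : (#(W ∪ U) : ℝ) ≤ #W + #U := by exact_mod_cast card_union_le _ _
    have h2 : (#U : ℝ) ≤ 9 := by exact_mod_cast hU
    linarith
  obtain ⟨x, hx⟩ : ∃ x, x ∉ W := by
    by_contra! hc
    have h1 : W = univ := eq_univ_iff_forall.2 hc
    rw [h1, card_univ, ← hn'] at hW
    linarith
  obtain ⟨y, z, hy, hz, hY, -⟩ := exists_common_pair hn hdeg (W := W)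
    (by simpa using small ∅ (by simp)) (fun t : V × V × V => t.1) w hw hw' x
  have hYc := hH _ hY
  obtain ⟨p, p', hp, hp', hP, h1⟩ := exists_common_pair hn hdeg (W := W ∪ {x, y, z})
    (small _ (by omega)) (fun t : V × V × V => t.1) w hw hw' x
  have hPc : #({p, p'} : Finset V) ≤ 2 := card_le_two
  have hYPc := card_union_le ({x, y, z} : Finset V) {p, p'}
  obtain ⟨q, q', hq, hq', hQ, h2⟩ := exists_common_pair hn hdeg (W := W ∪ ({x, y, z} ∪ {p, p'}))
    (small _ (by omega)) (fun t : V × V × V => t.2.1) _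
    (fun t => mul_nonneg (hw t) (ind_nonneg t.1 p p')) (lt_of_lt_of_le (by positivity) h1) y
  have hQc : #({q, q'} : Finset V) ≤ 2 := card_le_two
  have hYPQc := card_union_le (({x, y, z} : Finset V) ∪ {p, p'}) {q, q'}
  obtain ⟨r, r', hr, hr', hR, h3⟩ := exists_common_pair hn hdeg
    (W := W ∪ ({x, y, z} ∪ {p, p'} ∪ {q, q'}))
    (small _ (by omega)) (fun t : V × V × V => t.2.2) _
    (fun t => mul_nonneg (mul_nonneg (hw t) (ind_nonneg t.1 p p')) (ind_nonneg t.2.1 q q'))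
    (lt_of_lt_of_le (by linarith) h2) z
  have hRc : #({r, r'} : Finset V) ≤ 2 := card_le_two
  have hYPQRc := card_union_le (({x, y, z} : Finset V) ∪ {p, p'} ∪ {q, q'}) {r, r'}
  rw [mem_union, not_or] at hp hp' hq hq' hr hr'
  have d1 : Disjoint ({x, y, z} : Finset V) {p, p'} := by
    rw [disjoint_insert_right, disjoint_singleton_right]; exact ⟨hp.2, hp'.2⟩
  have d2 : Disjoint (({x, y, z} : Finset V) ∪ {p, p'}) {q, q'} := by
    rw [disjoint_insert_right, disjoint_singleton_right]; exact ⟨hq.2, hq'.2⟩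
  have d3 : Disjoint (({x, y, z} : Finset V) ∪ {p, p'} ∪ {q, q'}) {r, r'} := by
    rw [disjoint_insert_right, disjoint_singleton_right]; exact ⟨hr.2, hr'.2⟩
  refine ⟨{x, y, z} ∪ {p, p'} ∪ {q, q'} ∪ {r, r'}, ?_, by omega,
    hasMatchingIn_of_edges hH hYc hP hQ hR d1 d2 d3, ?_⟩
  · simp only [disjoint_union_left, disjoint_insert_left, disjoint_singleton_left]
    tauto
  · rw [sum_filter]
    refine le_trans (by linarith) (h3.trans (sum_le_sum fun t _ => ?_))
    have i1 := ind_le_one (H := H) t.1 p p'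
    have i2 := ind_le_one (H := H) t.2.1 q q'
    have i3 := ind_le_one (H := H) t.2.2 r r'
    have j1 := ind_nonneg (H := H) t.1 p p'
    have j2 := ind_nonneg (H := H) t.2.1 q q'
    have j3 := ind_nonneg (H := H) t.2.2 r r'
    split_ifs with hA
    · have : ind H t.1 p p' * ind H t.2.1 q q' * ind H t.2.2 r r' ≤ 1 :=
        mul_le_one₀ (mul_le_one₀ i1 j2 i2) j3 i3
      nlinarith [hw t]
    · by_contra hc
      have hc' : 0 < w t * ind H t.1 p p' * ind H t.2.1 q q' * ind H t.2.2 r r' := not_le.1 hc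
      have k3 : 0 < ind H t.2.2 r r' := pos_of_mul_pos_right hc' (by have := hw t; positivity)
      have k2' := pos_of_mul_pos_left hc' j3
      have k2 : 0 < ind H t.2.1 q q' := pos_of_mul_pos_right k2' (by have := hw t; positivity)
      have k1 : 0 < ind H t.1 p p' :=
        pos_of_mul_pos_right (pos_of_mul_pos_left k2' j2) (hw t)
      exact hA (absorbs_of_edges hH hY (mem_of_ind_pos k1) (mem_of_ind_pos k2) (mem_of_ind_pos k3)
        d1 d2 d3)

open Classical in
/-- Absorbing sets chosen greedily leave few triples with few absorbers. -/
lemma exists_absorbers (hH : ∀ e ∈ H, #e = 3) (hn : (10 : ℝ) ^ 12 ≤ Fintype.card V)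
    (hdeg : ∀ x, 5 / 9 * (Fintype.card V : ℝ) ^ 2 - 4 * Fintype.card V ≤ ∑ u, ∑ v, ind H x u v)
    (k : ℕ) (hk : (9 * k : ℝ) ≤ (Fintype.card V : ℝ) / 10 ^ 5) :
    ∃ J : Finset (Finset V), #J = k ∧ (J : Set (Finset V)).PairwiseDisjoint id ∧
      (∀ S ∈ J, HasMatchingIn H S 3) ∧ #(J.biUnion id) ≤ 9 * k ∧
      ∑ t : V × V × V, (1 / 2 : ℝ) ^ #{S ∈ J | AbsorbsTriple H S t.1 t.2.1 t.2.2} ≤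
        (Fintype.card V : ℝ) ^ 3 * (1999 / 2000) ^ k := by
  have hn0 : (0 : ℝ) < Fintype.card V := by linarith [show (0 : ℝ) < 10 ^ 12 by positivity]
  induction k with
  | zero =>
    refine ⟨∅, rfl, by simp, by simp, by simp, ?_⟩
    simp only [filter_empty, card_empty, pow_zero, sum_const, card_univ, Fintype.card_prod,
      nsmul_eq_mul, mul_one]
    push_cast
    linarith
  | succ k ih =>
    push_cast at hk
    obtain ⟨J, h1, h2, h3, h4, h5⟩ := ih (by linarith)
    set w : V × V × V → ℝ := fun t => (1 / 2) ^ #{S ∈ J | AbsorbsTriple H S t.1 t.2.1 t.2.2} with hw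
    have hV : Nonempty V := Fintype.card_pos_iff.1 (by exact_mod_cast hn0)
    obtain ⟨S, k1, k2, k3, k4⟩ := exists_absorber hH hn hdeg (W := J.biUnion id)
      ((show (#(J.biUnion id) : ℝ) ≤ 9 * k by exact_mod_cast h4).trans (by linarith)) w
      (fun t => by positivity) (sum_pos (fun t _ => by positivity) univ_nonempty)
    have k5 := (disjoint_biUnion_right _ _ _).1 k1
    have hSJ : S ∉ J := by
      intro hS
      have := k5 S hS
      simp only [id, disjoint_self, bot_eq_empty] at this
      obtain ⟨M, m1, m2, m3, m4⟩ := k3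
      obtain ⟨e, he⟩ := card_pos.1 (by omega : 0 < #M)
      have := card_le_card (m3 e he)
      have := hH e (m1 he)
      simp_all
    refine ⟨insert S J, by rw [card_insert_of_notMem hSJ, h1], ?_, ?_, ?_, ?_⟩
    · rw [coe_insert, Set.pairwiseDisjoint_insert]
      exact ⟨h2, fun R hR _ => k5 R (by exact_mod_cast hR)⟩
    · intro R hR
      rcases mem_insert.1 hR with rfl | hR
      exacts [k3, h3 R hR]
    · rw [biUnion_insert]
      have := card_union_le (id S) (J.biUnion id)
      simp only [id] at this ⊢
      omega
    · calc ∑ t : V × V × V,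
            (1 / 2 : ℝ) ^ #{R ∈ insert S J | AbsorbsTriple H R t.1 t.2.1 t.2.2}
          = ∑ t, (w t - 1 / 2 * if AbsorbsTriple H S t.1 t.2.1 t.2.2 then w t else 0) := by
            refine sum_congr rfl fun t _ => ?_
            rw [filter_insert]
            split_ifs
            · rw [card_insert_of_notMem (by simp [hSJ]), pow_succ, hw]; ring
            · simp [hw]
        _ = ∑ t, w t - 1 / 2 * ∑ t with AbsorbsTriple H S t.1 t.2.1 t.2.2, w t := by
            rw [sum_sub_distrib, ← mul_sum, sum_filter]
        _ ≤ 1999 / 2000 * ∑ t, w t := by linarith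
        _ ≤ 1999 / 2000 * ((Fintype.card V : ℝ) ^ 3 * (1999 / 2000) ^ k) := by gcongr
        _ = _ := by rw [pow_succ]; ring

end Absorbing

lemma exists_cube_mul_pow_lt (K : ℕ) : ∃ n₀ : ℕ, ∀ n ≥ n₀,
    (n : ℝ) ^ 3 * (1999 / 2000) ^ (n / 10 ^ 23) < (1 / 2) ^ K := by
  have h1 := tendsto_pow_const_mul_const_pow_of_abs_lt_one 3 (r := (1999 / 2000 : ℝ))
    (by rw [abs_of_pos] <;> norm_num)
  have h2 : (0 : ℝ) < (1 / 2) ^ K / (2 * 10 ^ 23) ^ 3 := by positivity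
  obtain ⟨m₀, hm⟩ := Filter.eventually_atTop.1 (h1.eventually (gt_mem_nhds h2))
  refine ⟨10 ^ 23 * (m₀ + 1), fun n hn => ?_⟩
  have h3 : m₀ + 1 ≤ n / 10 ^ 23 := by
    rw [Nat.le_div_iff_mul_le (by positivity)]; linarith
  have h4 := hm (n / 10 ^ 23) (by omega)
  have h5 : n ≤ 2 * 10 ^ 23 * (n / 10 ^ 23) := by omega
  have h6 : (n : ℝ) ≤ 2 * 10 ^ 23 * (n / 10 ^ 23 : ℕ) := by exact_mod_cast h5
  rw [lt_div_iff₀ (by positivity)] at h4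
  calc (n : ℝ) ^ 3 * (1999 / 2000) ^ (n / 10 ^ 23)
      ≤ (2 * 10 ^ 23 * (n / 10 ^ 23 : ℕ)) ^ 3 * (1999 / 2000) ^ (n / 10 ^ 23) := by gcongr
    _ < _ := by rw [mul_pow]; linarith

lemma HasMatchingIn.three_mul_le {V : Type*} [DecidableEq V] {H : Finset (Finset V)}
    (hH : ∀ e ∈ H, #e = 3) {X : Finset V} {k : ℕ} (h : HasMatchingIn H X k) : 3 * k ≤ #X := by
  obtain ⟨M, h1, h2, h3, h4⟩ := h
  rw [← h4, mul_comm]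
  refine le_trans (le_of_eq ?_) (card_le_card (biUnion_subset.2 h3 : M.biUnion id ⊆ X))
  rw [card_biUnion h2, sum_congr rfl fun e he => show #(id e) = 3 from hH e (h1 he), sum_const,
    smul_eq_mul]

open Classical in
/-- A largest matching avoiding `W`, as a system. -/
lemma exists_isMaxSystem {V : Type*} [Fintype V] [DecidableEq V] {H : Finset (Finset V)}
    (hH : ∀ e ∈ H, #e = 3) (W : Finset V) :
    ∃ (M : Finset (Finset V)) (L : Finset V) (vert : M → Fin 3 → V),
      IsMaxSystem H W L vert ∧ HasMatchingIn H (W ∪ L)ᶜ #M ∧ #L + #W + 3 * #M = Fintype.card V := by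
  set m := Nat.findGreatest (HasMatchingIn H Wᶜ) (Fintype.card V) with hm
  have h0 : HasMatchingIn H Wᶜ m :=
    Nat.findGreatest_spec (P := HasMatchingIn H Wᶜ) (Nat.zero_le _) HasMatchingIn.zero
  have hmax : ¬ HasMatchingIn H Wᶜ (m + 1) := by
    intro hc
    have h1 := hc.three_mul_le hH
    have h2 := card_le_univ (Wᶜ : Finset V)
    have := Nat.le_findGreatest (P := HasMatchingIn H Wᶜ) (n := Fintype.card V)
      (by omega) hc
    omega
  obtain ⟨M, h1, h2, h3, h4⟩ := h0
  have hc : ∀ E : M, #E.1 = 3 := fun E => hH _ (h1 E.2)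
  set vert : M → Fin 3 → V := fun E i => ((equivFinOfCardEq (hc E)).symm i).1 with hvert
  have hmem : ∀ E i, vert E i ∈ E.1 := fun E i => ((equivFinOfCardEq (hc E)).symm i).2
  have himg : ∀ E, univ.image (vert E) = E.1 := by
    intro E
    ext v
    simp only [mem_image, mem_univ, true_and]
    refine ⟨?_, fun hv => ⟨equivFinOfCardEq (hc E) ⟨v, hv⟩, by simp [hvert]⟩⟩
    rintro ⟨i, rfl⟩
    exact hmem E i
  have hMW : Disjoint (M.biUnion id) W := by
    rw [disjoint_biUnion_left]
    exact fun e he => disjoint_left.2 fun v hv => mem_compl.1 (h3 e he hv)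
  have hcM : #(M.biUnion id) = 3 * #M := by
    rw [card_biUnion h2, sum_congr rfl fun e he => show #(id e) = 3 from hH e (h1 he), sum_const,
      smul_eq_mul, mul_comm]
  refine ⟨M, (W ∪ M.biUnion id)ᶜ, vert, ⟨hH, ?_, ?_, ?_, ?_, ?_⟩, ?_, ?_⟩
  · intro E F i j hij
    have hEF : E = F := by
      by_contra hne
      exact disjoint_left.1 (h2 E.2 F.2 (fun h => hne (Subtype.ext h))) (hmem E i)
        (hij ▸ hmem F j)
    subst hEF
    refine ⟨rfl, ?_⟩
    simpa [hvert, Subtype.ext_iff] using Subtype.ext_iff.2 hij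
  · intro E; rw [himg]; exact h1 E.2
  · intro v
    simp only [mem_compl, mem_union, mem_biUnion, id, not_or, not_exists, not_and]
    refine and_congr_right fun _ => ⟨fun h E i hv => h E.1 E.2 (hv ▸ hmem E i), ?_⟩
    intro h e he hv
    have : v ∈ univ.image (vert ⟨e, he⟩) := by rw [himg]; exact hv
    simp only [mem_image, mem_univ, true_and] at this
    obtain ⟨i, hi⟩ := this
    exact h _ i hi
  · exact fun E i => mem_compl.1 (h3 _ E.2 (hmem E i))
  · rwa [Fintype.card_coe, h4]
  · refine ⟨M, h1, h2, fun e he v hv => ?_, rfl⟩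
    have := mem_biUnion.2 (⟨e, he, hv⟩ : ∃ a ∈ M, v ∈ id a)
    have := disjoint_left.1 hMW this
    simp only [mem_compl, mem_union, not_or]
    tauto
  · have e1 := card_union_of_disjoint hMW
    have e2 := card_compl_add_card (W ∪ M.biUnion id)
    rw [union_comm] at e1
    omega

/-- The main theorem when the matching is almost perfect. -/
lemma exists_threshold_of_almost_perfect : ∃ n₀ : ℕ, ∀ (V : Type) [Fintype V] [DecidableEq V]
    (H : Finset (Finset V)) (d : ℕ), (∀ e ∈ H, #e = 3) → n₀ ≤ Fintype.card V →
    3 * d ≤ Fintype.card V → Fintype.card V ≤ 3 * d + 1 →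
    (∀ v, ((Fintype.card V : ℝ) - 1) * (Fintype.card V - 2) -
      (((Fintype.card V : ℝ) - d) * (Fintype.card V - d - 1) - 2) ≤ ∑ u, ∑ w, ind H v u w) →
    HasMatchingIn H univ d := by
  classical
  obtain ⟨K, hK⟩ : ∃ K : ℕ, K = 10 ^ 22 := ⟨_, rfl⟩
  obtain ⟨n₀, hn₀⟩ := exists_cube_mul_pow_lt K
  refine ⟨max n₀ (10 ^ 30), fun V _ _ H d hH hn hd1 hd2 hdeg => ?_⟩
  have hn1 := hn₀ _ (le_of_max_le_left hn)
  have hn2 : (10 : ℝ) ^ 30 ≤ Fintype.card V := by exact_mod_cast le_of_max_le_right hn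
  have hn3 : (10 : ℝ) ^ 12 ≤ Fintype.card V := le_trans (by norm_num) hn2
  have hdeg' : ∀ x, 5 / 9 * (Fintype.card V : ℝ) ^ 2 - 4 * Fintype.card V ≤
      ∑ u, ∑ v, ind H x u v := by
    intro x
    refine le_trans ?_ (hdeg x)
    have e1 : (Fintype.card V : ℝ) ≤ 3 * d + 1 := by exact_mod_cast hd2
    have e2 : (3 * d : ℝ) ≤ Fintype.card V := by exact_mod_cast hd1
    nlinarith
  have hk : Fintype.card V / 10 ^ 23 * 10 ^ 23 ≤ Fintype.card V := Nat.div_mul_le_self _ _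
  have hk' : ((Fintype.card V / 10 ^ 23 : ℕ) : ℝ) * 10 ^ 23 ≤ Fintype.card V := by
    exact_mod_cast hk
  obtain ⟨J, hJ, hJ1, hJ2, hJ3, hJ4⟩ := exists_absorbers hH hn3 hdeg' (Fintype.card V / 10 ^ 23)
    (by linarith)
  have hW : (#(J.biUnion id) : ℝ) ≤ (Fintype.card V : ℝ) / 10 ^ 21 := by
    have : (#(J.biUnion id) : ℝ) ≤ 9 * (Fintype.card V / 10 ^ 23 : ℕ) := by exact_mod_cast hJ3
    linarith
  obtain ⟨M, L, vert, hsys, hM, hcard⟩ := exists_isMaxSystem hH (J.biUnion id)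
  rcases le_or_gt K #L with hL | hL
  · rcases le_or_gt d #M with hdM | hdM
    · exact (hM.mono (subset_univ _)).of_le hdM
    obtain ⟨B, hB, hsp⟩ := hsys.exists_sparse hn2 hdeg' hW (by rw [hK] at hL; exact_mod_cast hL)
    rw [Fintype.card_coe] at hB
    exact hasMatchingIn_of_sparse hH hd1 hd2 hn3 hdeg (by omega) hsp
  · have hA : ∀ x y z, #L / 3 ≤ #{S ∈ J | AbsorbsTriple H S x y z} := by
      intro x y z
      have h1 := single_le_sum
        (f := fun t : V × V × V => (1 / 2 : ℝ) ^ #{S ∈ J | AbsorbsTriple H S t.1 t.2.1 t.2.2})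
        (fun t _ => by positivity) (mem_univ (x, y, z))
      have h2 := (h1.trans hJ4).trans_lt hn1
      rw [pow_lt_pow_iff_right_of_lt_one₀ (by norm_num) (by norm_num)] at h2
      simp only at h2
      omega
    have hLW : Disjoint L (J.biUnion id) :=
      disjoint_left.2 fun v hv => ((hsys.mem_left v).1 hv).1
    have h1 := hasMatchingIn_absorb hH hJ1 hJ2 hLW (by omega) hA
    rw [union_comm] at h1
    have h2 := h1.union hH hM disjoint_compl_right
    exact (h2.mono (subset_univ _)).of_le (by omega)

section Join

variable {V : Type*} [Fintype V] [DecidableEq V] {H : Finset (Finset V)}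

lemma two_mul_degree_le (hH : ∀ e ∈ H, #e = 3) (v : V) :
    2 * (#{e ∈ H | v ∈ e} : ℝ) ≤ ∑ u, ∑ w, ind H v u w := by
  set P : Finset (V × V) := {p | ({v, p.1, p.2} : Finset V) ∈ H} with hP
  have h1 : ∑ u, ∑ w, ind H v u w = #P := by
    rw [← Fintype.sum_prod_type' (f := fun u w => ind H v u w), hP, card_filter]
    push_cast
    rfl
  have h2 : #P = ∑ e ∈ H with v ∈ e, #{p ∈ P | ({v, p.1, p.2} : Finset V) = e} :=
    card_eq_sum_card_fiberwise fun p hp => by simpa [hP] using hp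
  have h3 : ∀ e ∈ H.filter (v ∈ ·), 2 ≤ #{p ∈ P | ({v, p.1, p.2} : Finset V) = e} := by
    intro e he
    obtain ⟨he, hv⟩ := mem_filter.1 he
    have hc : #(e.erase v) = 2 := by rw [card_erase_of_mem hv, hH e he]
    obtain ⟨a, b, hab, h4⟩ := card_eq_two.1 hc
    have h5 : ({v, a, b} : Finset V) = e := by rw [← h4, insert_erase hv]
    rw [← card_pair (show (a, b) ≠ (b, a) from fun h => hab (Prod.ext_iff.1 h).1)]
    refine card_le_card ?_
    intro p hp
    rw [mem_insert, mem_singleton] at hp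
    rw [mem_filter, hP, mem_filter]
    rcases hp with rfl | rfl
    · exact ⟨⟨mem_univ _, by rwa [h5]⟩, h5⟩
    · rw [triple_swap] at h5
      exact ⟨⟨mem_univ _, by rwa [h5]⟩, h5⟩
  have h4 : #{e ∈ H | v ∈ e} * 2 ≤ #P := by
    rw [h2, ← smul_eq_mul]
    exact card_nsmul_le_sum _ _ _ h3
  rw [h1]
  have : (#{e ∈ H | v ∈ e} : ℝ) * 2 ≤ #P := by exact_mod_cast h4
  linarith

/-- The hypergraph obtained by adding new vertices and all triples that meet them. -/
def joinEdges (H : Finset (Finset V)) (α : Type*) [Fintype α] [DecidableEq α] :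
    Finset (Finset (V ⊕ α)) :=
  {e | #e = 3 ∧ (e.toLeft ∈ H ∨ e.toRight.Nonempty)}

variable {α : Type*} [Fintype α] [DecidableEq α]

lemma mem_joinEdges {e : Finset (V ⊕ α)} :
    e ∈ joinEdges H α ↔ #e = 3 ∧ (e.toLeft ∈ H ∨ e.toRight.Nonempty) := by
  simp [joinEdges]

lemma ind_joinEdges_inl (hH : ∀ e ∈ H, #e = 3) (x u w : V) :
    ind (joinEdges H α) (.inl x) (.inl u) (.inl w) = ind H x u w := by
  unfold ind
  congr 1
  have h1 : ({.inl x, .inl u, .inl w} : Finset (V ⊕ α)).toLeft = {x, u, w} := by ext; simp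
  have h2 : ({.inl x, .inl u, .inl w} : Finset (V ⊕ α)).toRight = ∅ := by ext; simp
  rw [mem_joinEdges, ← card_toLeft_add_card_toRight, h1, h2]
  simp only [card_empty, add_zero, Finset.not_nonempty_empty, or_false, eq_iff_iff,
    and_iff_right_iff_imp]
  exact hH _

lemma ind_joinEdges_eq_one {x y z : V ⊕ α} (hxy : x ≠ y) (hxz : x ≠ z) (hyz : y ≠ z)
    (h : ∃ j, .inr j ∈ ({x, y, z} : Finset (V ⊕ α))) : ind (joinEdges H α) x y z = 1 := by
  unfold ind
  rw [if_pos]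
  rw [mem_joinEdges]
  obtain ⟨j, hj⟩ := h
  exact ⟨card_eq_three.2 ⟨x, y, z, hxy, hxz, hyz, rfl⟩, .inr ⟨j, mem_toRight.2 hj⟩⟩

lemma card_three_of_mem_joinEdges : ∀ e ∈ joinEdges H α, #e = 3 :=
  fun _ he => (mem_joinEdges.1 he).1

lemma sum_ind_joinEdges_inr (j : α) :
    ∑ u, ∑ w, ind (joinEdges H α) (.inr j) u w =
      ((Fintype.card (V ⊕ α) : ℝ) - 1) * (Fintype.card (V ⊕ α) - 2) := by
  rw [sum_ind_eq_offDiag card_three_of_mem_joinEdges, ← card_univ,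
    ← card_offDiag_erase (mem_univ (.inr j : V ⊕ α)), card_eq_sum_ones, Nat.cast_sum]
  refine sum_congr rfl fun p hp => ?_
  simp only [mem_offDiag, mem_erase, mem_univ, and_true] at hp
  rw [Nat.cast_one]
  exact ind_joinEdges_eq_one hp.1.symm hp.2.1.symm hp.2.2 ⟨j, by simp⟩

lemma sum_ite_eq_zero_else_one {β : Type*} [Fintype β] [DecidableEq β] (b : β) :
    ∑ c, (if c = b then (0 : ℝ) else 1) = Fintype.card β - 1 := by
  have : ∀ c, (if c = b then (0 : ℝ) else 1) = 1 - if c = b then 1 else 0 := by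
    intro c; split_ifs <;> norm_num
  simp [this]

lemma sum_ind_joinEdges_inl (hH : ∀ e ∈ H, #e = 3) (x : V) :
    ∑ u, ∑ w, ind (joinEdges H α) (.inl x) u w =
      ∑ u, ∑ w, ind H x u w + 2 * ((Fintype.card V : ℝ) - 1) * Fintype.card α +
        Fintype.card α * ((Fintype.card α : ℝ) - 1) := by
  have h1 : ∀ (u : V) (j : α), ind (joinEdges H α) (.inl x) (.inl u) (.inr j) =
      if u = x then 0 else 1 := by
    intro u j
    split_ifs with h
    · exact ind_eq_zero card_three_of_mem_joinEdges (.inl (by rw [h]))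
    · exact ind_joinEdges_eq_one (by simpa using Ne.symm h) (by simp) (by simp) ⟨j, by simp⟩
  have h2 : ∀ (u : V) (j : α), ind (joinEdges H α) (.inl x) (.inr j) (.inl u) =
      if u = x then 0 else 1 := fun u j => by rw [ind_swap, h1]
  have h3 : ∀ i j : α, ind (joinEdges H α) (.inl x) (.inr i) (.inr j) =
      if j = i then 0 else 1 := by
    intro i j
    split_ifs with h
    · exact ind_eq_zero card_three_of_mem_joinEdges (.inr (.inr (by rw [h])))
    · exact ind_joinEdges_eq_one (by simp) (by simp) (by simpa using Ne.symm h) ⟨j, by simp⟩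
  simp only [Fintype.sum_sum_type, ind_joinEdges_inl hH, h1, h2, h3, sum_add_distrib, sum_const,
    card_univ, nsmul_eq_mul, ← mul_sum, sum_ite_eq_zero_else_one]
  ring

lemma HasMatchingIn.of_joinEdges {d : ℕ}
    (h : HasMatchingIn (joinEdges H α) univ (d + Fintype.card α)) : HasMatchingIn H univ d := by
  obtain ⟨M, h1, h2, -, h4⟩ := h
  set R := M.filter fun e => e.toRight.Nonempty with hR
  set N := M.filter fun e => ¬ e.toRight.Nonempty with hN
  have hRN : #R + #N = #M := card_filter_add_card_filter_not _
  have hRc : #R ≤ Fintype.card α := by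
    refine (card_le_card_biUnion (f := toRight) ?_ ?_).trans (card_le_univ _)
    · intro e he f hf hef
      have := h2 (mem_filter.1 he).1 (mem_filter.1 hf).1 hef
      exact disjoint_left.2 fun j hj hj' =>
        disjoint_left.1 this (mem_toRight.1 hj) (mem_toRight.1 hj')
    · exact fun e he => (mem_filter.1 he).2
  have hright : ∀ e ∈ N, e.toRight = ∅ := fun e he => not_nonempty_iff_eq_empty.1 (mem_filter.1 he).2
  refine HasMatchingIn.of_le (k := #N) ⟨N.image toLeft, ?_, ?_, fun _ _ => subset_univ _, ?_⟩
    (by omega)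
  · intro f hf
    obtain ⟨e, he, rfl⟩ := mem_image.1 hf
    have h5 := mem_joinEdges.1 (h1 (mem_filter.1 he).1)
    exact h5.2.resolve_right (mem_filter.1 he).2
  · intro f hf g hg hfg
    obtain ⟨e, he, rfl⟩ := mem_image.1 (mem_coe.1 hf)
    obtain ⟨e', he', rfl⟩ := mem_image.1 (mem_coe.1 hg)
    have := h2 (mem_filter.1 he).1 (mem_filter.1 he').1 (fun hee => hfg (by rw [hee]))
    exact disjoint_left.2 fun j hj hj' =>
      disjoint_left.1 this (mem_toLeft.1 hj) (mem_toLeft.1 hj')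
  · refine card_image_of_injOn fun e he f hf hef => ?_
    rw [← toLeft_disjSum_toRight (u := e), ← toLeft_disjSum_toRight (u := f),
      hright e he, hright f hf]
    exact congrArg (fun s => disjSum s ∅) hef

end Join

/-- There exists `n₀` such that every 3-uniform hypergraph `H` on
`n ≥ n₀` vertices with `d ≤ n/3` and minimum vertex degree greater than
`C(n-1,2) - C(n-d,2)` contains a matching of size at least `d`. -/
theorem stmt_3 :
    ∃ n₀ : ℕ, ∀ (V : Type) [Fintype V] [DecidableEq V] (H : Finset (Finset V)) (d : ℕ),
      (∀ e ∈ H, e.card = 3) →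
      n₀ ≤ Fintype.card V →
      3 * d ≤ Fintype.card V →
      (∀ v : V, Nat.choose (Fintype.card V - 1) 2 - Nat.choose (Fintype.card V - d) 2
        < (H.filter fun e => v ∈ e).card) →
      ∃ M ⊆ H, (M : Set (Finset V)).PairwiseDisjoint id ∧ d ≤ M.card := by
  obtain ⟨n₀, hn₀⟩ := exists_threshold_of_almost_perfect
  refine ⟨max n₀ 10, fun V _ _ H d hH hn hd hdeg => ?_⟩
  set a := (Fintype.card V - 3 * d) / 2 with ha
  have hc : Fintype.card (V ⊕ Fin a) = Fintype.card V + a := by simp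
  have hdR : (3 * d : ℝ) ≤ Fintype.card V := by exact_mod_cast hd
  have hnR : (10 : ℝ) ≤ Fintype.card V := by exact_mod_cast le_of_max_le_right hn
  have key : ∀ v, ((Fintype.card V : ℝ) - 1) * (Fintype.card V - 2) -
      (((Fintype.card V : ℝ) - d) * (Fintype.card V - d - 1) - 2) ≤ ∑ u, ∑ w, ind H v u w := by
    intro v
    refine le_trans ?_ (two_mul_degree_le hH v)
    have h1 : (Fintype.card V - 1).choose 2 + 1 ≤
        #{e ∈ H | v ∈ e} + (Fintype.card V - d).choose 2 := by
      have := hdeg v; omega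
    have h2 : (((Fintype.card V - 1).choose 2 : ℕ) : ℝ) + 1 ≤
        #{e ∈ H | v ∈ e} + ((Fintype.card V - d).choose 2 : ℕ) := by exact_mod_cast h1
    rw [Nat.cast_choose_two, Nat.cast_choose_two, Nat.cast_sub (by omega),
      Nat.cast_sub (by omega)] at h2
    push_cast at h2
    linarith
  have h := hn₀ (V ⊕ Fin a) (joinEdges H (Fin a)) (d + a) card_three_of_mem_joinEdges
    (by omega) (by omega) (by omega) (by
      rintro (x | j)
      · rw [sum_ind_joinEdges_inl hH, hc, Fintype.card_fin]
        have := key x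
        push_cast
        linarith
      · rw [sum_ind_joinEdges_inr, hc]
        push_cast
        nlinarith)
  obtain ⟨M, h1, h2, -, h4⟩ := HasMatchingIn.of_joinEdges (by rwa [Fintype.card_fin])
  exact ⟨M, h1, h2, h4.ge⟩
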